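/- arXiv:1610.02766 — 3 statements merged into one kernel-verified Lean document; each statement's English description precedes it below -/
import Mathlib

section
/- Let κ ∈ (0,1), K = 2^k ≥ 2, and m ≥ 2. Let T be a finite rooted tree of depth m with all leaves at depth m, where each node u at depth 1 ≤ L(u) ≤ m−1 carries a positive real ‖u‖ and is marked tame or untame, and d_u denotes the number of children of u. Assume the root degree satisfies d_ρ ≥ κK/2; every depth-1 node u satisfies ‖u‖ ≥ K^{m−1}; for every node u with 1 ≤ L(u) ≤ m−2, every child v of u satisfies ‖v‖ ≥ ‖u‖/d_u, and ‖v‖ ≥ (1 + 1/K²)·‖u‖/d_u if u is marked untame; and every node u with L(u) = m−1 satisfies d_u ≥ ‖u‖/2. Then every leaf v, with root-to-leaf ray ρ = v₀, v₁, …, v_m = v and C_v := |{1 ≤ r ≤ m−1 : v_r is marked untame}|, satisfies θ(v) ≤ (8/(κK^m))·exp(−C_v/(K²+1)) for the unit uniform flow θ on T. -/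
open MeasureTheory ProbabilityTheory Real Set Filter

/-- A finite rooted tree is encoded as a finite, prefix-closed set of finite
sequences of natural numbers; the root is the empty sequence, the children of a
node `u` are the nodes of the form `u ++ [i]`, and the depth `L(u)` of a node is
its length. -/
def PrefixClosed (T : Finset (List ℕ)) : Prop := ∀ l ∈ T, ∀ p, p <+: l → p ∈ T

/-- The number `d_u` of children of the node `u` in the tree `T`. -/
def degT (T : Finset (List ℕ)) (u : List ℕ) : ℕ :=
  (T.filter (fun l => u <+: l ∧ l.length = u.length + 1)).card

/-- A node is a leaf if it has no children. -/
def IsLeaf (T : Finset (List ℕ)) (u : List ℕ) : Prop := degT T u = 0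

/-- The unit uniform flow `θ` on the tree `T`: `θ(root) = 1` and
`θ(v) = θ(u) / d_u` whenever `v` is a child of the node `u` with `d_u` children. -/
noncomputable def flowT (T : Finset (List ℕ)) (u : List ℕ) : ℝ :=
  ∏ r ∈ Finset.range u.length, ((degT T (u.take r) : ℝ))⁻¹

/-- A finite rooted tree of depth `m` all of whose leaves are at depth `m`. -/
def IsUniformDepthTree (T : Finset (List ℕ)) (m : ℕ) : Prop :=
  ([] : List ℕ) ∈ T ∧ PrefixClosed T ∧ (∀ l ∈ T, l.length ≤ m) ∧
    (∀ l ∈ T, l.length < m → ∃ i, l ++ [i] ∈ T)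

/-- The abstract version along a single ray. -/
lemma ray_bound_aux (κ : ℝ) (hκ : 0 < κ) (K : ℝ) (hK : 2 ≤ K) (M : ℕ) (d n : ℕ → ℝ)
    (b : ℕ → Bool) (hd : ∀ r, 0 ≤ d r)
    (h0 : κ * K / 2 ≤ d 0) (h1 : K ^ (M + 1) ≤ n 1)
    (hpos : ∀ r, 1 ≤ r → r ≤ M + 1 → 0 < n r)
    (hstep : ∀ r, 1 ≤ r → r ≤ M → n r / d r ≤ n (r + 1) ∧
      (b r = true → (1 + 1 / K ^ 2) * n r / d r ≤ n (r + 1)))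
    (hlast : n (M + 1) / 2 ≤ d (M + 1)) :
    ∏ r ∈ Finset.range (M + 2), (d r)⁻¹ ≤ 8 / (κ * K ^ (M + 2)) *
      Real.exp (-(((Finset.Icc 1 (M + 1)).filter (fun r => b r = true)).card : ℝ) /
        (K ^ 2 + 1)) := by
  have hK0 : 0 < K := by linarith
  have hKK : 0 < K ^ 2 := by positivity
  set c : ℝ := 1 / (K ^ 2 + 1) with hc
  have hc0 : 0 < c := by positivity
  have hexp : Real.exp c ≤ 1 + 1 / K ^ 2 := by
    have h := Real.add_one_le_exp (-c)
    rw [Real.exp_neg] at h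
    have h2 : -c + 1 = (1 + 1 / K ^ 2)⁻¹ := by
      rw [hc]; field_simp; ring
    rw [h2] at h
    exact (inv_le_inv₀ (by positivity) (Real.exp_pos c)).1 h
  have hexp2 : Real.exp c ≤ 2 := by
    have : 1 / K ^ 2 ≤ 1 := by
      rw [div_le_one hKK]; nlinarith
    linarith
  set C : ℕ → ℕ := fun j => ((Finset.Icc 1 j).filter (fun r => b r = true)).card with hC
  have hCs : ∀ j, C (j + 1) = C j + if b (j + 1) = true then 1 else 0 := by
    intro j
    simp only [hC]
    rw [← Finset.insert_Icc_right_eq_Icc_add_one (by omega), Finset.filter_insert]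
    split_ifs with h
    · rw [Finset.card_insert_of_notMem]
      simp
    · rfl
  have hd0 : 0 < d 0 := lt_of_lt_of_le (by positivity) h0
  have inv : ∀ j, j ≤ M → (∏ r ∈ Finset.range (j + 1), (d r)⁻¹) *
      ((κ * K / 2) * K ^ (M + 1) * Real.exp (c * C j)) ≤ n (j + 1) := by
    intro j
    induction j with
    | zero =>
      intro _
      have : C 0 = 0 := by simp [hC]
      rw [this]
      simp only [zero_add, Finset.prod_range_one, Nat.cast_zero, mul_zero, Real.exp_zero, mul_one]
      refine le_trans ?_ h1
      rw [← mul_assoc, inv_mul_eq_div]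
      have : κ * K / 2 / d 0 ≤ 1 := (div_le_one hd0).2 h0
      have hp : 0 ≤ K ^ (M + 1) := by positivity
      nlinarith
    | succ j ih =>
      intro hj
      have ih := ih (by omega)
      have hs := hstep (j + 1) (by omega) hj
      have hn := hpos (j + 1) (by omega) (by omega)
      have hdi : 0 ≤ (d (j + 1))⁻¹ := inv_nonneg.2 (hd _)
      rw [Finset.prod_range_succ, hCs]
      set X := ∏ r ∈ Finset.range (j + 1), (d r)⁻¹
      by_cases hb : b (j + 1) = true
      · refine le_trans ?_ (hs.2 hb)
        rw [if_pos hb]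
        push_cast
        rw [mul_add, Real.exp_add, mul_one]
        calc X * (d (j + 1))⁻¹ * ((κ * K / 2) * K ^ (M + 1) * (Real.exp (c * C j) * Real.exp c))
            = (X * ((κ * K / 2) * K ^ (M + 1) * Real.exp (c * C j))) * Real.exp c
              * (d (j + 1))⁻¹ := by ring
          _ ≤ n (j + 1) * (1 + 1 / K ^ 2) * (d (j + 1))⁻¹ := by gcongr
          _ = _ := by ring
      · refine le_trans ?_ hs.1
        rw [if_neg hb]
        calc _ = (X * ((κ * K / 2) * K ^ (M + 1) * Real.exp (c * C j)))
              * (d (j + 1))⁻¹ := by push_cast; ring_nf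
          _ ≤ n (j + 1) * (d (j + 1))⁻¹ := by gcongr
          _ = _ := by ring
  have hM := inv M le_rfl
  have hn := hpos (M + 1) (by omega) (by omega)
  have hdl : 0 < d (M + 1) := by linarith
  rw [Finset.prod_range_succ]
  set X := ∏ r ∈ Finset.range (M + 1), (d r)⁻¹
  change _ ≤ _ * Real.exp (-(C (M + 1) : ℝ) / (K ^ 2 + 1))
  have he : -(C (M + 1) : ℝ) / (K ^ 2 + 1) = -(c * C (M + 1)) := by rw [hc]; ring
  have hCl : (C (M + 1) : ℝ) ≤ C M + 1 := by
    rw [hCs]; push_cast; split_ifs <;> simp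
  have hE : Real.exp (c * C (M + 1)) ≤ 2 * Real.exp (c * C M) := by
    calc _ ≤ Real.exp (c + c * C M) := Real.exp_le_exp.2 (by nlinarith)
      _ = Real.exp c * Real.exp (c * C M) := Real.exp_add _ _
      _ ≤ _ := by gcongr
  have hX : 0 ≤ X := Finset.prod_nonneg fun r _ => inv_nonneg.2 (hd r)
  rw [he, Real.exp_neg, ← div_eq_mul_inv, ← div_eq_mul_inv, div_div,
    div_le_div_iff₀ hdl (by positivity)]
  calc X * (κ * K ^ (M + 2) * Real.exp (c * C (M + 1)))
      ≤ X * (κ * K ^ (M + 2) * (2 * Real.exp (c * C M))) := by gcongr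
    _ = 4 * (X * ((κ * K / 2) * K ^ (M + 1) * Real.exp (c * C M))) := by ring
    _ ≤ 4 * n (M + 1) := by gcongr
    _ ≤ 8 * d (M + 1) := by linarith

/-- **Equation (3.2) (flow bound along a ray).** Under the structural assumptions on
the tree `T` (root degree `≥ κK/2`, `‖u‖ ≥ K^{m-1}` at depth 1, `‖v‖ ≥ ‖u‖/d_u`
improved by the factor `1 + 1/K²` at untame nodes, and `d_u ≥ ‖u‖/2` at depth
`m-1`), every leaf `v` satisfies `θ(v) ≤ (8/(κ K^m)) e^{-C_v/(K²+1)}` where `C_v`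
is the number of untame nodes strictly between the root and `v`. -/
theorem flow_bound_along_ray :
    ∀ κ : ℝ, 0 < κ → κ < 1 →
      ∀ k K m : ℕ, K = 2 ^ k → 2 ≤ K → 2 ≤ m →
        ∀ (T : Finset (List ℕ)) (nrm : List ℕ → ℝ) (untame : List ℕ → Bool),
          IsUniformDepthTree T m →
          (∀ u ∈ T, 1 ≤ u.length → u.length + 1 ≤ m → 0 < nrm u) →
          κ * K / 2 ≤ (degT T ([] : List ℕ) : ℝ) →
          (∀ u ∈ T, u.length = 1 → (K : ℝ) ^ (m - 1) ≤ nrm u) →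
          (∀ u ∈ T, 1 ≤ u.length → u.length + 2 ≤ m →
            ∀ i : ℕ, u ++ [i] ∈ T →
              nrm u / (degT T u : ℝ) ≤ nrm (u ++ [i]) ∧
              (untame u = true →
                (1 + 1 / (K : ℝ) ^ 2) * nrm u / (degT T u : ℝ) ≤ nrm (u ++ [i]))) →
          (∀ u ∈ T, u.length + 1 = m → nrm u / 2 ≤ (degT T u : ℝ)) →
          ∀ v ∈ T, v.length = m →
            flowT T v ≤ 8 / (κ * (K : ℝ) ^ m) *
              Real.exp (-(((Finset.Icc 1 (m - 1)).filter
                  (fun r => untame (v.take r) = true)).card : ℝ) /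
                ((K : ℝ) ^ 2 + 1)) := by
  intro κ hκ _ k K m _ hK hm T nrm untame hT hpos h0 h1 hstep hlast v hv hvm
  obtain ⟨M, rfl⟩ : ∃ M, m = M + 2 := ⟨m - 2, by omega⟩
  have hmem : ∀ r, v.take r ∈ T := fun r => hT.2.1 v hv _ (List.take_prefix r v)
  have hlen : ∀ r, r ≤ M + 2 → (v.take r).length = r := by
    intro r hr
    rw [List.length_take]; omega
  unfold flowT
  rw [hvm]
  refine ray_bound_aux κ hκ K (by exact_mod_cast hK) M (fun r => (degT T (v.take r) : ℝ))
    (fun r => nrm (v.take r)) (fun r => untame (v.take r)) (fun r => Nat.cast_nonneg _)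
    (by simpa using h0) (h1 _ (hmem 1) (hlen 1 (by omega))) ?_ ?_ ?_
  · intro r hr1 hr2
    have := hlen r (by omega)
    exact hpos _ (hmem r) (by omega) (by omega)
  · intro r hr1 hr2
    have := hlen r (by omega)
    have hr : r < v.length := by omega
    have ht : v.take (r + 1) = v.take r ++ [v[r]] := (List.take_append_getElem hr).symm
    have h := hstep _ (hmem r) (by omega) (by omega) v[r] (ht ▸ hmem (r + 1))
    simp only [ht]
    exact h
  · exact hlast _ (hmem (M + 1)) (by rw [hlen _ (by omega)])
end

section
/- There exist universal constants C₇, C₈ > 0 and k₀ such that the following holds for all k ≥ k₀, K = 2^k, all N with K^m ≤ N < K^{m+1}, all ε > 0, all δ with C₈/(√k ε) ≤ δ ≤ 1, all 1 ≤ j ≤ m−1, and all boxes B₁, B₂ ∈ BD_{K^{j−2}}. The probability of the following event is at most K²·exp(−C₇ ε² k² δ²): there exist a tame path P ∈ SL_j with x_P ∈ B₁ and y_P ∈ B₂, and (for j ≥ 2) an integer d ≥ K, a real ℓ ∈ [K^{j−1}, (1+1/K)K^{j−1}], and pairwise disjoint subpaths P^{(1)}, …, P^{(d)} ∈ SL_{j−1}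 of P with ‖P^{(i)}‖ = ℓ and P^{(i)} ⊆ B(x_{P^{(i)}}, ℓ), each box of BD_{K^{j−1}} visited by at most 12 of them, such that at least δd of the subpaths P^{(i)} are open; or (for j = 1) at least d ≥ K/2 distinct lattice points z₁,…,z_d of P other than its endpoints such that at least δd of them satisfy η₀(z_i) ≥ εk. Here a path Q ∈ SL_{j−1} is called open if η_{j−1}(z) ≥ εk for some lattice point z on Q. -/
open MeasureTheory ProbabilityTheory Real Set Filter

/-- The lattice ℤ². -/
abbrev Z2 := ℤ × ℤ

/-- Nearest-neighbor adjacency on ℤ². -/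
def Adj (x y : Z2) : Prop := |x.1 - y.1| + |x.2 - y.2| = 1

/-- The `L^∞` distance on ℤ². -/
def linf (x y : Z2) : ℤ := max |x.1 - y.1| |x.2 - y.2|

/-- The Euclidean distance on ℤ². -/
noncomputable def eZ (x y : Z2) : ℝ :=
  Real.sqrt (((x.1 - y.1 : ℤ) : ℝ) ^ 2 + ((x.2 - y.2 : ℤ) : ℝ) ^ 2)

/-- Inner boundary `∂B` of a set `B ⊆ ℤ²`: points of `B` having a nearest neighbor
outside `B`. -/
def bdry (B : Set Z2) : Set Z2 := {z | z ∈ B ∧ ∃ w, Adj z w ∧ w ∉ B}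

/-- Number of nearest-neighbor paths of length `t` from `x` to `y` avoiding `∂B`. -/
noncomputable def nWalks (B : Set Z2) (t : ℕ) (x y : Z2) : ℕ :=
  Nat.card {f : Fin (t + 1) → Z2 //
    f 0 = x ∧ f (Fin.last t) = y ∧ (∀ i, f i ∉ bdry B) ∧
    ∀ i : Fin t, Adj (f i.castSucc) (f i.succ)}

/-- The Green function of simple random walk on ℤ² killed upon hitting `∂B`:
`G_B(x,y) = E_x [∑_{t=0}^{τ-1} 1_{S_t = y}]`, where `τ` is the hitting time of `∂B`. -/
noncomputable def greenFn (B : Set Z2) (x y : Z2) : ℝ :=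
  ∑' t : ℕ, (1 / 4 : ℝ) ^ t * nWalks B t x y

/-- A centered (jointly) Gaussian family: every finite linear combination is a
centered Gaussian random variable. -/
def IsCenteredGaussianFamily {Ω : Type*} [MeasureSpace Ω] {ι : Type*} (f : ι → Ω → ℝ) : Prop :=
  ∀ (s : Finset ι) (c : ι → ℝ), ∃ v : NNReal,
    Measure.map (fun ω => ∑ i ∈ s, c i * f i ω) (ℙ : Measure Ω) = gaussianReal 0 v

/-- `η` is a discrete Gaussian free field on `B` with Dirichlet boundary conditions:
a centered Gaussian field, vanishing outside `B`, whose covariance on `B` is the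
Green function of simple random walk killed at `∂B`. -/
def IsDGFF {Ω : Type*} [MeasureSpace Ω] (B : Set Z2) (η : Z2 → Ω → ℝ) : Prop :=
  IsCenteredGaussianFamily (fun z : Z2 => η z) ∧
  (∀ z, z ∉ B → η z = 0) ∧
  (∀ x ∈ B, ∀ y ∈ B, ∫ ω, η x ω * η y ω = greenFn B x y)

/-- `F` is the harmonic extension of `η` from outside `B`: it agrees with `η` on
`B^c ∪ ∂B` and is discrete harmonic on `B ∖ ∂B`. -/
def IsHarmExt {Ω : Type*} [MeasureSpace Ω] (η F : Z2 → Ω → ℝ) (B : Set Z2) : Prop :=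
  (∀ z, z ∉ B \ bdry B → F z = η z) ∧
  (∀ z ∈ B \ bdry B, ∀ ω, 4 * F z ω =
    F (z.1 + 1, z.2) ω + F (z.1 - 1, z.2) ω + F (z.1, z.2 + 1) ω + F (z.1, z.2 - 1) ω)

/-- The box of side length `ℓ` centered at `x`. -/
def boxZ (x : Z2) (ℓ : ℤ) : Set Z2 :=
  {z | x.1 - ℓ / 2 ≤ z.1 ∧ z.1 ≤ x.1 + ℓ / 2 ∧ x.2 - ℓ / 2 ≤ z.2 ∧ z.2 ≤ x.2 + ℓ / 2}

/-- `V_N = [0,N)² ∩ ℤ²`. -/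
def VN (N : ℕ) : Set Z2 := {z | 0 ≤ z.1 ∧ z.1 < (N : ℤ) ∧ 0 ≤ z.2 ∧ z.2 < (N : ℤ)}

/-- `V_{5N} = [-2N, 3N)² ∩ ℤ²`. -/
def V5N (N : ℕ) : Set Z2 :=
  {z | -(2 * (N : ℤ)) ≤ z.1 ∧ z.1 < 3 * (N : ℤ) ∧ -(2 * (N : ℤ)) ≤ z.2 ∧ z.2 < 3 * (N : ℤ)}

/-- The field `η_j`: `η_0 = η^{V_{5N}} - H_K` and `η_j = H_{K^j} - H_{K^{j+1}}` for
`j ≥ 1`, where `H ℓ x` denotes the value at `x` of the harmonic extension of the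
field `η` from outside the box of side `ℓ` centered at `x`. -/
def etaJ {Ω : Type*} (η : Z2 → Ω → ℝ) (H : ℤ → Z2 → Ω → ℝ) (K : ℕ) (j : ℕ) (x : Z2) :
    Ω → ℝ :=
  if j = 0 then fun ω => η x ω - H (K : ℤ) x ω
  else fun ω => H ((K : ℤ) ^ j) x ω - H ((K : ℤ) ^ (j + 1)) x ω

/-- A path in `V` given as a nonempty list of vertices of `V` in which consecutive
vertices are nearest neighbors. -/
def LPathIn (V : Set Z2) (P : List Z2) : Prop :=
  P ≠ [] ∧ P.Chain' Adj ∧ ∀ z ∈ P, z ∈ V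

/-- A lattice path viewed as a continuous curve in ℝ², parametrized at unit speed
along the unit edges of ℤ², allowed to start and end at interior points of edges.
`v n` is the lattice vertex occupied at integer time `n`; the curve is defined on
the time interval `[a, b]`, and consecutive vertices are nearest neighbors. -/
structure GridPath where
  a : ℝ
  b : ℝ
  hab : a ≤ b
  v : ℤ → Z2
  adj : ∀ n : ℤ, a < (n : ℝ) + 1 → (n : ℝ) < b → Adj (v n) (v (n + 1))

/-- The point of the curve at time `t` (affine interpolation along edges). -/
noncomputable def GridPath.pt (P : GridPath) (t : ℝ) : ℝ × ℝ :=
  (((P.v ⌊t⌋).1 : ℝ) + (t - ⌊t⌋) * (((P.v (⌊t⌋ + 1)).1 : ℝ) - ((P.v ⌊t⌋).1 : ℝ)),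
   ((P.v ⌊t⌋).2 : ℝ) + (t - ⌊t⌋) * (((P.v (⌊t⌋ + 1)).2 : ℝ) - ((P.v ⌊t⌋).2 : ℝ)))

/-- The starting point `x_P` of the path. -/
noncomputable def GridPath.start (P : GridPath) : ℝ × ℝ := P.pt P.a

/-- The ending point `y_P` of the path. -/
noncomputable def GridPath.fin (P : GridPath) : ℝ × ℝ := P.pt P.b

/-- The image (trace) of the path in ℝ². -/
noncomputable def GridPath.image (P : GridPath) : Set (ℝ × ℝ) := P.pt '' Set.Icc P.a P.b

/-- Euclidean distance on ℝ². -/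
noncomputable def e2 (p q : ℝ × ℝ) : ℝ := Real.sqrt ((p.1 - q.1) ^ 2 + (p.2 - q.2) ^ 2)

/-- `‖P‖`, the Euclidean distance between the endpoints of `P`. -/
noncomputable def GridPath.norm (P : GridPath) : ℝ := e2 P.start P.fin

/-- The closed Euclidean ball `B(c, r)` in ℝ². -/
def cball (c : ℝ × ℝ) (r : ℝ) : Set (ℝ × ℝ) := {p | e2 c p ≤ r}

/-- A lattice point of ℤ² as a point of ℝ². -/
def castZ (z : Z2) : ℝ × ℝ := ((z.1 : ℝ), (z.2 : ℝ))

/-- The set of lattice points visited by the path. -/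
noncomputable def GridPath.lattice (P : GridPath) : Set Z2 := {z | castZ z ∈ P.image}

/-- `Q` is a subpath of `P`. -/
def SubPath (Q P : GridPath) : Prop :=
  P.a ≤ Q.a ∧ Q.b ≤ P.b ∧ ∀ t ∈ Set.Icc Q.a Q.b, Q.pt t = P.pt t

/-- Two paths are disjoint if, after removing their endpoints, their traces are
disjoint subsets of ℝ². -/
def PathDisj (P Q : GridPath) : Prop :=
  (P.image \ {P.start, P.fin}) ∩ (Q.image \ {Q.start, Q.fin}) = ∅

/-- The class `SL_j` of paths in scale `K^j` (for `1 ≤ j ≤ m-1`):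
`K^j ≤ ‖P‖ ≤ (1 + 1/K) K^j` and `P ⊆ B(x_P, ‖P‖)`. -/
def SL (K j : ℕ) : Set GridPath :=
  {P | (K : ℝ) ^ j ≤ P.norm ∧ P.norm ≤ (1 + 1 / (K : ℝ)) * (K : ℝ) ^ j ∧
    P.image ⊆ cball P.start P.norm}

/-- The closed box of `BD_r` indexed by `(i₁, i₂) ∈ ℤ²`:
`[i₁ r - 1/2, (i₁+1) r - 1/2] × [i₂ r - 1/2, (i₂+1) r - 1/2]`. -/
def BDbox (r : ℝ) (i : Z2) : Set (ℝ × ℝ) :=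
  {p | (i.1 : ℝ) * r - 1 / 2 ≤ p.1 ∧ p.1 ≤ ((i.1 : ℝ) + 1) * r - 1 / 2 ∧
       (i.2 : ℝ) * r - 1 / 2 ≤ p.2 ∧ p.2 ≤ ((i.2 : ℝ) + 1) * r - 1 / 2}

/-- The ellipse `E(P) = {z : ‖x_P - z‖ + ‖y_P - z‖ ≤ (1 + 2/K²) ‖P‖}`. -/
noncomputable def ellipse (K : ℕ) (P : GridPath) : Set (ℝ × ℝ) :=
  {z | e2 P.start z + e2 P.fin z ≤ (1 + 2 / (K : ℝ) ^ 2) * P.norm}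

/-- A path `P ∈ SL_{j+1}` is tame if `P ⊆ Ẽ(P)`, where `Ẽ(P)` is the closed
`4 K^j`-neighborhood of the (compact) ellipse `E(P)`. -/
noncomputable def Tame (K j : ℕ) (P : GridPath) : Prop :=
  ∀ p ∈ P.image, ∃ w ∈ ellipse K P, e2 p w ≤ 4 * (K : ℝ) ^ j

/-- A path `Q ∈ SL_{j}` is open (w.r.t. the field `η_j`) if `η_j(z) ≥ ε k` for some
lattice point `z` on `Q`. -/
def OpenPath {Ω : Type*} (η : Z2 → Ω → ℝ) (H : ℤ → Z2 → Ω → ℝ) (K j : ℕ) (ε : ℝ)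
    (k : ℕ) (Q : GridPath) (ω : Ω) : Prop :=
  ∃ z ∈ Q.lattice, ε * k ≤ etaJ η H K j z ω

namespace TP

/-- The operator `I - P` for simple random walk. -/
noncomputable def Lp (u : Z2 → ℝ) (z : Z2) : ℝ :=
  u z - (u (z + (1, 0)) + u (z + (-1, 0)) + u (z + (0, 1)) + u (z + (0, -1))) / 4

/-- Finite support. -/
def FS (u : Z2 → ℝ) : Prop := (Function.support u).Finite

/-- Inner product (used when one of the functions has finite support). -/
noncomputable def ip (f u : Z2 → ℝ) : ℝ := ∑' z, f z * u z

lemma FS.mono {u v : Z2 → ℝ} (h : FS u) (huv : ∀ z, u z = 0 → v z = 0) : FS v := by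
  refine Set.Finite.subset h ?_
  intro z hz hz'
  exact hz (huv z hz')

lemma FS.mono2 {u v w : Z2 → ℝ} (h : FS u) (h2 : FS w)
    (huv : ∀ z, u z = 0 → w z = 0 → v z = 0) : FS v := by
  refine Set.Finite.subset (h.union h2) ?_
  intro z hz
  by_contra hc
  simp only [Set.mem_union, Function.mem_support, not_or, not_not] at hc
  exact hz (huv z hc.1 hc.2)

lemma FS.add {u v : Z2 → ℝ} (h : FS u) (h2 : FS v) : FS (fun z => u z + v z) :=
  h.mono2 h2 (by intro z a b; simp [a, b])

lemma FS.sub {u v : Z2 → ℝ} (h : FS u) (h2 : FS v) : FS (fun z => u z - v z) :=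
  h.mono2 h2 (by intro z a b; simp [a, b])

lemma FS.cmul {u : Z2 → ℝ} (h : FS u) (c : ℝ) : FS (fun z => c * u z) :=
  h.mono (by intro z a; simp [a])

lemma FS.sum {ι : Type*} (s : Finset ι) {u : ι → Z2 → ℝ} (h : ∀ i ∈ s, FS (u i)) :
    FS (fun z => ∑ i ∈ s, u i z) := by
  classical
  induction s using Finset.induction_on with
  | empty => simp [FS]
  | insert a s ha ih =>
    simp only [Finset.sum_insert ha]
    exact (h a (by simp)).add (ih (fun i hi => h i (by simp [hi])))

lemma FS.shift {u : Z2 → ℝ} (h : FS u) (e : Z2) : FS (fun z => u (z + e)) := by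
  have : Function.support (fun z => u (z + e)) = (fun z => z + e) ⁻¹' (Function.support u) := by
    ext z; simp
  unfold FS
  rw [this]
  exact Set.Finite.preimage (by intro a _ b _ hab; simpa using hab) h

lemma FS.mulr {u : Z2 → ℝ} (h : FS u) (v : Z2 → ℝ) : FS (fun z => u z * v z) :=
  h.mono (by intro z a; simp [a])

lemma FS.mull {u : Z2 → ℝ} (h : FS u) (v : Z2 → ℝ) : FS (fun z => v z * u z) :=
  h.mono (by intro z a; simp [a])

lemma FS.Lp {u : Z2 → ℝ} (h : FS u) : FS (Lp u) := by
  have h1 := h.sub (((((h.shift (1, 0)).add (h.shift (-1, 0))).add (h.shift (0, 1))).add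
    (h.shift (0, -1))).cmul (1/4))
  refine h1.mono ?_
  intro z hz
  unfold TP.Lp
  linarith

lemma FS.summable {u : Z2 → ℝ} (h : FS u) : Summable u := summable_of_hasFiniteSupport h

lemma Lp_sub (u v : Z2 → ℝ) (z : Z2) : Lp (fun z => u z - v z) z = Lp u z - Lp v z := by
  unfold Lp; ring

lemma Lp_add (u v : Z2 → ℝ) (z : Z2) : Lp (fun z => u z + v z) z = Lp u z + Lp v z := by
  unfold Lp; ring

lemma Lp_cmul (c : ℝ) (v : Z2 → ℝ) (z : Z2) : Lp (fun z => c * v z) z = c * Lp v z := by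
  unfold Lp; ring

lemma Lp_sum {ι : Type*} (s : Finset ι) (u : ι → Z2 → ℝ) (z : Z2) :
    Lp (fun z => ∑ i ∈ s, u i z) z = ∑ i ∈ s, Lp (u i) z := by
  unfold Lp
  simp only [Finset.sum_sub_distrib, Finset.sum_add_distrib, ← Finset.sum_div]

lemma Lp_shift (u : Z2 → ℝ) (e z : Z2) : Lp (fun z => u (z + e)) z = Lp u (z + e) := by
  unfold Lp
  simp only [add_right_comm]

lemma tsum_shift (u : Z2 → ℝ) (e : Z2) : ∑' z, u (z + e) = ∑' z, u z :=
  Equiv.tsum_eq (Equiv.addRight e) u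

lemma ip_shift (u v : Z2 → ℝ) (e : Z2) :
    ∑' z, u (z + e) * v z = ∑' z, u z * v (z + -e) := by
  rw [← tsum_shift (fun z => u z * v (z + -e)) e]
  simp

lemma ip_Lp_eq {u : Z2 → ℝ} (h : FS u) (v : Z2 → ℝ) :
    ip (Lp u) v = ip u v - ((∑' z, u (z + (1, 0)) * v z) + (∑' z, u (z + (-1, 0)) * v z)
      + (∑' z, u (z + (0, 1)) * v z) + ∑' z, u (z + (0, -1)) * v z) / 4 := by
  have s0 := (h.mulr v).summable
  have s1 := ((h.shift (1, 0)).mulr v).summable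
  have s2 := ((h.shift (-1, 0)).mulr v).summable
  have s3 := ((h.shift (0, 1)).mulr v).summable
  have s4 := ((h.shift (0, -1)).mulr v).summable
  unfold ip Lp
  rw [← s1.tsum_add s2, ← (s1.add s2).tsum_add s3, ← ((s1.add s2).add s3).tsum_add s4,
    ← tsum_div_const, ← s0.tsum_sub ((((s1.add s2).add s3).add s4).div_const 4)]
  congr 1
  ext z
  ring

lemma ip_comm (u v : Z2 → ℝ) : ip u v = ip v u := by
  unfold ip; simp only [mul_comm]

lemma ip_Lp_symm {u : Z2 → ℝ} (h : FS u) (v : Z2 → ℝ) : ip (Lp u) v = ip u (Lp v) := by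
  have s0 := (h.mulr v).summable
  have s1 := (h.mulr (fun z => v (z + (1, 0)))).summable
  have s2 := (h.mulr (fun z => v (z + (-1, 0)))).summable
  have s3 := (h.mulr (fun z => v (z + (0, 1)))).summable
  have s4 := (h.mulr (fun z => v (z + (0, -1)))).summable
  rw [ip_Lp_eq h v, ip_shift, ip_shift, ip_shift, ip_shift]
  have e1 : (-((1 : ℤ), (0 : ℤ)) : Z2) = (-1, 0) := by simp
  have e2 : (-((-1 : ℤ), (0 : ℤ)) : Z2) = (1, 0) := by simp
  have e3 : (-((0 : ℤ), (1 : ℤ)) : Z2) = (0, -1) := by simp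
  have e4 : (-((0 : ℤ), (-1 : ℤ)) : Z2) = (0, 1) := by simp
  rw [e1, e2, e3, e4]
  unfold ip Lp
  rw [← s2.tsum_add s1, ← (s2.add s1).tsum_add s4, ← ((s2.add s1).add s4).tsum_add s3,
    ← tsum_div_const, ← s0.tsum_sub ((((s2.add s1).add s4).add s3).div_const 4)]
  congr 1
  ext z
  ring

lemma ip_sub_left {f g : Z2 → ℝ} (hf : FS f) (hg : FS g) (u : Z2 → ℝ) :
    ip (fun z => f z - g z) u = ip f u - ip g u := by
  unfold ip
  rw [← (hf.mulr u).summable.tsum_sub (hg.mulr u).summable]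
  congr 1; ext z; ring

lemma ip_sub_right {f g : Z2 → ℝ} (hf : FS f) (hg : FS g) (u : Z2 → ℝ) :
    ip u (fun z => f z - g z) = ip u f - ip u g := by
  rw [ip_comm, ip_sub_left hf hg, ip_comm f, ip_comm g]

lemma dir_nonneg {w : Z2 → ℝ} (h : FS w) : 0 ≤ ip (Lp w) w := by
  rw [ip_Lp_eq h]
  have hsq := (h.mulr w).summable
  have key : ∀ e : Z2, ∑' z, w (z + e) * w z ≤ ip w w := by
    intro e
    have s1 := ((h.shift e).mulr w).summable
    have s2 := ((h.mulr w).shift e).summable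
    have : ∑' z, w (z + e) * w z ≤ ∑' z, (w z * w z / 2 + w (z + e) * w (z + e) / 2) := by
      refine s1.tsum_le_tsum (fun z => ?_) ((hsq.div_const 2).add (s2.div_const 2))
      nlinarith [sq_nonneg (w (z + e) - w z)]
    rw [(hsq.div_const 2).tsum_add (s2.div_const 2), tsum_div_const, tsum_div_const,
      tsum_shift (fun z => w z * w z) e] at this
    unfold ip; linarith
  have h1 := key (1, 0)
  have h2 := key (-1, 0)
  have h3 := key (0, 1)
  have h4 := key (0, -1)
  linarith

/-- sup norm on the lattice -/
def sn (z : Z2) : ℤ := max |z.1| |z.2|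

lemma sn_nonneg (z : Z2) : 0 ≤ sn z := le_max_of_le_left (abs_nonneg _)

lemma sn_le_iff {z : Z2} {a : ℤ} : sn z ≤ a ↔ (-a ≤ z.1 ∧ z.1 ≤ a) ∧ (-a ≤ z.2 ∧ z.2 ≤ a) := by
  unfold sn; rw [max_le_iff, abs_le, abs_le]

lemma sn_lt_iff {z : Z2} {a : ℤ} : sn z < a ↔ (-a < z.1 ∧ z.1 < a) ∧ (-a < z.2 ∧ z.2 < a) := by
  unfold sn; rw [max_lt_iff, abs_lt, abs_lt]

lemma sn_add_le (x y : Z2) : sn (x + y) ≤ sn x + sn y := by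
  unfold sn
  have h1 := abs_add_le x.1 y.1
  have h2 := abs_add_le x.2 y.2
  have a1 := le_max_left |x.1| |x.2|
  have a2 := le_max_right |x.1| |x.2|
  have a3 := le_max_left |y.1| |y.2|
  have a4 := le_max_right |y.1| |y.2|
  simp only [Prod.fst_add, Prod.snd_add]
  apply max_le <;> linarith

lemma sn_neg (x : Z2) : sn (-x) = sn x := by unfold sn; simp

lemma sn_sub_comm (x y : Z2) : sn (x - y) = sn (y - x) := by rw [← sn_neg, neg_sub]

lemma sn_zero : sn 0 = 0 := by simp [sn]

lemma finite_sn (M : ℤ) : {z : Z2 | sn z ≤ M}.Finite := by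
  refine Set.Finite.subset (Set.Finite.prod (Set.finite_Icc (-M) M) (Set.finite_Icc (-M) M)) ?_
  intro z hz
  have := sn_le_iff.1 hz
  simp only [Set.mem_prod, Set.mem_Icc]
  exact this

lemma FS_of_sn {u : Z2 → ℝ} (M : ℤ) (h : ∀ z, M < sn z → u z = 0) : FS u := by
  refine (finite_sn M).subset ?_
  intro z hz
  by_contra hc
  exact hz (h z (by simpa using hc))

/-- Maximum principle on a finite set. -/
lemma max_principle {S : Set Z2} (hS : S.Finite) (ψ : Z2 → ℝ)
    (hout : ∀ z, z ∉ S → 0 ≤ ψ z) (hin : ∀ z ∈ S, ψ z < 0 → 0 ≤ Lp ψ z) :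
    ∀ z, 0 ≤ ψ z := by
  by_contra hc
  push Not at hc
  obtain ⟨z0, hz0⟩ := hc
  have hz0S : z0 ∈ S := by
    by_contra h; exact absurd (hout z0 h) (not_le.2 hz0)
  obtain ⟨z1, hz1S, hz1⟩ := Set.exists_min_image S ψ hS ⟨z0, hz0S⟩
  have hneg : ψ z1 < 0 := lt_of_le_of_lt (hz1 z0 hz0S) hz0
  have hmin : ∀ z, ψ z1 ≤ ψ z := by
    intro z
    by_cases h : z ∈ S
    · exact hz1 z h
    · exact hneg.le.trans (hout z h)
  -- the set of minimizers in S, take the one with the largest first coordinate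
  have hfin : (S ∩ {z | ψ z = ψ z1}).Finite := hS.inter_of_left _
  obtain ⟨z2, ⟨hz2S, hz2⟩, hmax⟩ := Set.exists_max_image _ (fun z : Z2 => z.1) hfin ⟨z1, hz1S, rfl⟩
  have h2 : ψ z2 = ψ z1 := hz2
  have hL := hin z2 hz2S (by rw [h2]; exact hneg)
  unfold Lp at hL
  have a1 := hmin (z2 + (1, 0))
  have a2 := hmin (z2 + (-1, 0))
  have a3 := hmin (z2 + (0, 1))
  have a4 := hmin (z2 + (0, -1))
  have hEq : ψ (z2 + (1, 0)) = ψ z1 := by linarith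
  have hmem : z2 + (1, 0) ∈ S := by
    by_contra h
    have := hout _ h
    linarith
  have := hmax (z2 + (1, 0)) ⟨hmem, hEq⟩
  simp at this

end TP

namespace TP

/-- The set of walks counted by `nWalks`. -/
abbrev Wk (B : Set Z2) (t : ℕ) (x y : Z2) : Type :=
  {f : Fin (t + 1) → Z2 //
    f 0 = x ∧ f (Fin.last t) = y ∧ (∀ i, f i ∉ bdry B) ∧
    ∀ i : Fin t, Adj (f i.castSucc) (f i.succ)}

/-- The four directions. -/
def dirs : Fin 4 → Z2 := ![(1, 0), (-1, 0), (0, 1), (0, -1)]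

lemma dirs_inj : Function.Injective dirs := by decide

lemma adj_dirs (x : Z2) (e : Fin 4) : Adj x (x + dirs e) := by
  fin_cases e <;> simp [Adj, dirs]

lemma adj_exists {x w : Z2} (h : Adj x w) : ∃ e, w = x + dirs e := by
  obtain ⟨x1, x2⟩ := x
  obtain ⟨w1, w2⟩ := w
  unfold Adj at h
  simp only at h
  have hc : (w1 = x1 + 1 ∧ w2 = x2) ∨ (w1 = x1 - 1 ∧ w2 = x2) ∨ (w1 = x1 ∧ w2 = x2 + 1) ∨
      (w1 = x1 ∧ w2 = x2 - 1) := by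
    rcases abs_cases (x1 - w1) with h1 | h1 <;> rcases abs_cases (x2 - w2) with h2 | h2 <;> omega
  rcases hc with ⟨a, b⟩ | ⟨a, b⟩ | ⟨a, b⟩ | ⟨a, b⟩
  · exact ⟨0, by simp [dirs, a, b]⟩
  · exact ⟨1, by simp [dirs, a, b]; ring⟩
  · exact ⟨2, by simp [dirs, a, b]⟩
  · exact ⟨3, by simp [dirs, a, b]; ring⟩

/-- Prepending a step to a walk. -/
def consWalk (B : Set Z2) (t : ℕ) (x y : Z2) (hx : x ∉ bdry B) :
    (Σ e : Fin 4, Wk B t (x + dirs e) y) → Wk B (t + 1) x y := fun p =>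
  ⟨Fin.cons x p.2.1, by
    obtain ⟨e, g, h0, hl, hb, ha⟩ := p
    refine ⟨by simp, ?_, ?_, ?_⟩
    · rw [← Fin.succ_last, Fin.cons_succ]; exact hl
    · intro i
      refine Fin.cases ?_ (fun i => ?_) i
      · simpa using hx
      · simpa using hb i
    · intro i
      refine Fin.cases ?_ (fun i => ?_) i
      · simp only [Fin.castSucc_zero, Fin.cons_zero, Fin.cons_succ, h0]
        exact adj_dirs x e
      · rw [← Fin.succ_castSucc, Fin.cons_succ, Fin.cons_succ]
        exact ha i⟩

lemma consWalk_bij (B : Set Z2) (t : ℕ) (x y : Z2) (hx : x ∉ bdry B) :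
    Function.Bijective (consWalk B t x y hx) := by
  constructor
  · rintro ⟨e, g, h0, hg⟩ ⟨e', g', h0', hg'⟩ h
    have h1 : (Fin.cons x g : Fin (t + 2) → Z2) = Fin.cons x g' := congrArg Subtype.val h
    have h2 : g = g' := by
      have := (Fin.cons_injective2 h1).2
      exact this
    subst h2
    have h3 : e = e' := by
      apply dirs_inj
      have := h0.symm.trans h0'
      simpa using this
    subst h3
    rfl
  · rintro ⟨f, h0, hl, hb, ha⟩
    have h1 := ha 0
    simp only [Fin.castSucc_zero] at h1
    rw [h0] at h1
    obtain ⟨e, he⟩ := adj_exists h1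
    refine ⟨⟨e, Fin.tail f, ?_, ?_, ?_, ?_⟩, ?_⟩
    · simpa [Fin.tail] using he
    · simpa [Fin.tail] using hl
    · intro i; exact hb _
    · intro i
      have := ha i.succ
      rw [← Fin.succ_castSucc] at this
      exact this
    · apply Subtype.ext
      simp only [consWalk]
      rw [← h0]
      exact Fin.cons_self_tail f

lemma finite_Wk (B : Set Z2) (t : ℕ) : ∀ x y, Finite (Wk B t x y) := by
  induction t with
  | zero =>
    intro x y
    have : Subsingleton (Wk B 0 x y) := by
      constructor
      rintro ⟨f, h0, _⟩ ⟨g, g0, _⟩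
      apply Subtype.ext
      funext i
      have : i = 0 := Fin.ext (by have := i.2; simp at this ⊢)
      simp only [this]
      rw [h0, g0]
    infer_instance
  | succ t ih =>
    intro x y
    by_cases hx : x ∈ bdry B
    · have : IsEmpty (Wk B (t + 1) x y) := by
        constructor
        rintro ⟨f, h0, _, hb, _⟩
        exact hb 0 (h0 ▸ hx)
      infer_instance
    · have := fun e => ih (x + dirs e) y
      exact Finite.of_surjective _ (consWalk_bij B t x y hx).2

lemma nWalks_bdry (B : Set Z2) (t : ℕ) (x y : Z2) (hx : x ∈ bdry B) : nWalks B t x y = 0 := by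
  have : IsEmpty (Wk B t x y) := by
    constructor
    rintro ⟨f, h0, _, hb, _⟩
    exact hb 0 (h0 ▸ hx)
  exact Nat.card_of_isEmpty

lemma nWalks_zero (B : Set Z2) (x y : Z2) (hx : x ∉ bdry B) :
    nWalks B 0 x y = if x = y then 1 else 0 := by
  split_ifs with h
  · subst h
    unfold nWalks
    rw [Nat.card_eq_one_iff_unique]
    constructor
    · constructor
      rintro ⟨f, h0, _⟩ ⟨g, g0, _⟩
      apply Subtype.ext
      funext i
      have : i = 0 := Fin.ext (by have := i.2; simp at this ⊢)
      simp only [this]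
      rw [h0, g0]
    · exact ⟨⟨fun _ => x, rfl, rfl, fun _ => hx, fun i => i.elim0⟩⟩
  · have : IsEmpty (Wk B 0 x y) := by
      constructor
      rintro ⟨f, h0, h1, _⟩
      exact h (h0.symm.trans h1)
    exact Nat.card_of_isEmpty

lemma nWalks_succ (B : Set Z2) (t : ℕ) (x y : Z2) (hx : x ∉ bdry B) :
    nWalks B (t + 1) x y = nWalks B t (x + (1, 0)) y + nWalks B t (x + (-1, 0)) y +
      nWalks B t (x + (0, 1)) y + nWalks B t (x + (0, -1)) y := by
  have h1 : nWalks B (t + 1) x y = Nat.card (Σ e : Fin 4, Wk B t (x + dirs e) y) :=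
    (Nat.card_congr (Equiv.ofBijective _ (consWalk_bij B t x y hx))).symm
  have := fun e => finite_Wk B t (x + dirs e) y
  rw [h1, Nat.card_sigma, Fin.sum_univ_four]
  rfl

lemma nbr_mem {B : Set Z2} {x : Z2} (hx : x ∈ B \ bdry B) (e : Fin 4) : x + dirs e ∈ B := by
  by_contra h
  exact hx.2 ⟨hx.1, _, adj_dirs x e, h⟩

/-- partial sums of the Green function -/
noncomputable def gpart (B : Set Z2) (T : ℕ) (x y : Z2) : ℝ :=
  ∑ t ∈ Finset.range T, (1 / 4 : ℝ) ^ t * nWalks B t x y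

lemma gpart_succ (B : Set Z2) (T : ℕ) (x y : Z2) (hx : x ∉ bdry B) :
    gpart B (T + 1) x y = (if x = y then 1 else 0) + (gpart B T (x + (1, 0)) y +
      gpart B T (x + (-1, 0)) y + gpart B T (x + (0, 1)) y + gpart B T (x + (0, -1)) y) / 4 := by
  unfold gpart
  rw [Finset.sum_range_succ', nWalks_zero B x y hx, ← Finset.sum_add_distrib,
    ← Finset.sum_add_distrib, ← Finset.sum_add_distrib, Finset.sum_div, add_comm]
  congr 1
  · simp
  · apply Finset.sum_congr rfl
    intro t _
    rw [nWalks_succ B t x y hx]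
    push_cast
    ring

lemma gpart_le {B : Set Z2} {M : ℤ} (hB : ∀ z ∈ B, |z.1| ≤ M) (y : Z2) (T : ℕ) :
    ∀ x ∈ B, gpart B T x y ≤ 2 * ((M : ℝ) ^ 2 - (x.1 : ℝ) ^ 2) := by
  have hpos : ∀ x ∈ B, (0 : ℝ) ≤ 2 * ((M : ℝ) ^ 2 - (x.1 : ℝ) ^ 2) := by
    intro x hx
    have h1 := hB x hx
    have h2 : x.1 ^ 2 ≤ M ^ 2 := sq_le_sq' (abs_le.1 h1).1 (abs_le.1 h1).2
    have h3 : ((x.1 : ℝ)) ^ 2 ≤ (M : ℝ) ^ 2 := by exact_mod_cast h2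
    linarith
  induction T with
  | zero => intro x hx; simpa [gpart] using hpos x hx
  | succ T ih =>
    intro x hx
    by_cases hb : x ∈ bdry B
    · have : gpart B (T + 1) x y = 0 := by
        unfold gpart
        apply Finset.sum_eq_zero
        intro t _
        rw [nWalks_bdry B t x y hb]; simp
      rw [this]; exact hpos x hx
    · rw [gpart_succ B T x y hb]
      have h0 := ih _ (nbr_mem ⟨hx, hb⟩ 0)
      have h1 := ih _ (nbr_mem ⟨hx, hb⟩ 1)
      have h2 := ih _ (nbr_mem ⟨hx, hb⟩ 2)
      have h3 := ih _ (nbr_mem ⟨hx, hb⟩ 3)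
      simp [dirs] at h0 h1 h2 h3
      have : (if x = y then (1 : ℝ) else 0) ≤ 1 := by split_ifs <;> norm_num
      linarith

lemma green_summable {B : Set Z2} {M : ℤ} (hB : ∀ z ∈ B, |z.1| ≤ M) (x y : Z2) (hx : x ∈ B) :
    Summable (fun t : ℕ => (1 / 4 : ℝ) ^ t * nWalks B t x y) :=
  summable_of_sum_range_le (fun n => by positivity) (fun T => gpart_le hB y T x hx)

lemma green_bdry (B : Set Z2) (x y : Z2) (hx : x ∈ bdry B) : greenFn B x y = 0 := by
  unfold greenFn
  simp [nWalks_bdry B _ x y hx]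

lemma green_nonneg (B : Set Z2) (x y : Z2) : 0 ≤ greenFn B x y :=
  tsum_nonneg (fun t => by positivity)

lemma green_step {B : Set Z2} {M : ℤ} (hB : ∀ z ∈ B, |z.1| ≤ M) (x y : Z2)
    (hx : x ∈ B \ bdry B) :
    greenFn B x y = (if x = y then 1 else 0) + (greenFn B (x + (1, 0)) y +
      greenFn B (x + (-1, 0)) y + greenFn B (x + (0, 1)) y + greenFn B (x + (0, -1)) y) / 4 := by
  have s0 := green_summable hB x y hx.1
  have s1 : Summable (fun t : ℕ => (1 / 4 : ℝ) ^ t * nWalks B t (x + (1, 0)) y) :=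
    green_summable hB _ y (nbr_mem hx 0)
  have s2 : Summable (fun t : ℕ => (1 / 4 : ℝ) ^ t * nWalks B t (x + (-1, 0)) y) :=
    green_summable hB _ y (nbr_mem hx 1)
  have s3 : Summable (fun t : ℕ => (1 / 4 : ℝ) ^ t * nWalks B t (x + (0, 1)) y) :=
    green_summable hB _ y (nbr_mem hx 2)
  have s4 : Summable (fun t : ℕ => (1 / 4 : ℝ) ^ t * nWalks B t (x + (0, -1)) y) :=
    green_summable hB _ y (nbr_mem hx 3)
  have e : greenFn B x y = (1 / 4 : ℝ) ^ 0 * nWalks B 0 x y +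
      ∑' t : ℕ, (1 / 4 : ℝ) ^ (t + 1) * nWalks B (t + 1) x y := s0.tsum_eq_zero_add
  rw [e, nWalks_zero B x y hx.2]
  congr 1
  · simp
  · unfold greenFn
    rw [← s1.tsum_add s2, ← (s1.add s2).tsum_add s3, ← ((s1.add s2).add s3).tsum_add s4,
      ← tsum_div_const]
    congr 1
    ext t
    rw [nWalks_succ B t x y hx.2]
    push_cast
    ring

open Classical in
/-- Green function extended by zero. -/
noncomputable def gE (B : Set Z2) (y : Z2) (x : Z2) : ℝ := if x ∈ B then greenFn B x y else 0

lemma gE_nonneg (B : Set Z2) (y x : Z2) : 0 ≤ gE B y x := by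
  unfold gE; split_ifs
  · exact green_nonneg _ _ _
  · exact le_rfl

lemma gE_zero (B : Set Z2) (y x : Z2) (hx : x ∉ B \ bdry B) : gE B y x = 0 := by
  unfold gE; split_ifs with h
  · apply green_bdry
    by_contra hb; exact hx ⟨h, hb⟩
  · rfl

lemma gE_Lp {B : Set Z2} {M : ℤ} (hB : ∀ z ∈ B, |z.1| ≤ M) (y x : Z2) (hx : x ∈ B \ bdry B) :
    Lp (gE B y) x = if x = y then 1 else 0 := by
  have m0 : x + (1, 0) ∈ B := nbr_mem hx 0
  have m1 : x + (-1, 0) ∈ B := nbr_mem hx 1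
  have m2 : x + (0, 1) ∈ B := nbr_mem hx 2
  have m3 : x + (0, -1) ∈ B := nbr_mem hx 3
  unfold Lp gE
  rw [if_pos hx.1, if_pos m0, if_pos m1, if_pos m2, if_pos m3, green_step hB x y hx]
  ring

end TP

namespace TP

lemma map_gauss_aem {Ω : Type*} [MeasureSpace Ω] {X : Ω → ℝ} {v : NNReal}
    (h : Measure.map X (ℙ : Measure Ω) = gaussianReal 0 v) : AEMeasurable X (ℙ : Measure Ω) := by
  apply AEMeasurable.of_map_ne_zero
  rw [h]
  exact IsProbabilityMeasure.ne_zero _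

lemma map_gauss_memLp {Ω : Type*} [MeasureSpace Ω] {X : Ω → ℝ} {v : NNReal}
    (h : Measure.map X (ℙ : Measure Ω) = gaussianReal 0 v) : MemLp X 2 (ℙ : Measure Ω) := by
  have h1 : MemLp id 2 (Measure.map X (ℙ : Measure Ω)) := by
    rw [h]; exact memLp_id_gaussianReal' 2 (by simp)
  exact (memLp_map_measure_iff (by fun_prop) (map_gauss_aem h)).1 h1

lemma map_gauss_sq {Ω : Type*} [MeasureSpace Ω] {X : Ω → ℝ} {v : NNReal}
    (h : Measure.map X (ℙ : Measure Ω) = gaussianReal 0 v) : ∫ ω, X ω * X ω = v := by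
  have h1 : ∫ x, x * x ∂(Measure.map X (ℙ : Measure Ω)) = ∫ ω, X ω * X ω :=
    integral_map (map_gauss_aem h) (by fun_prop)
  rw [← h1, h]
  have h2 := variance_id_gaussianReal (μ := 0) (v := v)
  rw [variance_eq_integral (by fun_prop)] at h2
  simp only [id, integral_id_gaussianReal, sub_zero] at h2
  rw [← h2]
  congr 1; ext x; ring

lemma V5N_bd (N : ℕ) : ∀ z ∈ V5N N, |z.1| ≤ 3 * (N : ℤ) := by
  intro z hz
  unfold V5N at hz
  simp only [Set.mem_ofPred_eq] at hz
  rw [abs_le]; omega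

lemma V5N_sn (N : ℕ) : ∀ z ∈ V5N N, sn z ≤ 3 * (N : ℤ) := by
  intro z hz
  unfold V5N at hz
  simp only [Set.mem_ofPred_eq] at hz
  rw [sn_le_iff]; omega

lemma var_lemma {Ω : Type*} [MeasureSpace Ω] {N : ℕ} {η : Z2 → Ω → ℝ} (hη : IsDGFF (V5N N) η)
    {u : Z2 → ℝ} (hu : FS u) (S : Finset Z2) (hS : ∀ z, z ∉ S → Lp u z = 0) :
    ∃ v : NNReal, Measure.map (fun ω => ∑ z ∈ S, Lp u z * η z ω) (ℙ : Measure Ω)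
      = gaussianReal 0 v ∧ (v : ℝ) ≤ ip (Lp u) u := by
  classical
  obtain ⟨hG, hz, hcov⟩ := hη
  obtain ⟨v, hv⟩ := hG S (Lp u)
  refine ⟨v, hv, ?_⟩
  set f := Lp u with hf
  set V := V5N N with hV
  have hmem : ∀ z, MemLp (η z) 2 (ℙ : Measure Ω) := by
    intro z
    obtain ⟨v', hv'⟩ := hG {z} (fun _ => 1)
    simp only [Finset.sum_singleton, one_mul] at hv'
    exact map_gauss_memLp hv'
  have hIntg : ∀ x y, Integrable (fun ω => η x ω * η y ω) (ℙ : Measure Ω) := fun x y =>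
    MemLp.integrable_mul (hmem x) (hmem y)
  have hcov' : ∀ x y, ∫ ω, η x ω * η y ω = if x ∈ V ∧ y ∈ V then greenFn V x y else 0 := by
    intro x y
    split_ifs with h
    · exact hcov x h.1 y h.2
    · rw [not_and_or] at h
      rcases h with h | h
      · simp [hz x h]
      · simp [hz y h]
  -- the potential of f in V
  set w : Z2 → ℝ := fun x => ∑ y ∈ S.filter (· ∈ V), f y * gE V y x with hw
  have hwFS : FS w := by
    apply FS_of_sn (3 * (N : ℤ))
    intro z hzz
    apply Finset.sum_eq_zero
    intro y _
    rw [gE_zero, mul_zero]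
    intro h
    exact absurd (V5N_sn N z h.1) (not_le.2 hzz)
  have hw0 : ∀ x, x ∉ V \ bdry V → w x = 0 := by
    intro x hx
    apply Finset.sum_eq_zero
    intro y _
    rw [gE_zero V y x hx, mul_zero]
  have hwL : ∀ x ∈ V \ bdry V, Lp w x = f x := by
    intro x hx
    rw [hw, Lp_sum]
    have : ∀ y ∈ S.filter (· ∈ V), Lp (fun z => f y * gE V y z) x = if x = y then f y else 0 := by
      intro y _
      rw [Lp_cmul, gE_Lp (V5N_bd N) y x hx]
      split_ifs <;> simp
    rw [Finset.sum_congr rfl this, Finset.sum_ite_eq]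
    split_ifs with h
    · rfl
    · symm
      apply hS
      intro hxS
      exact h (by simp [hxS, hx.1])
  have hvw : (v : ℝ) = ip f w := by
    rw [← map_gauss_sq hv]
    simp only [Finset.sum_mul_sum]
    rw [integral_finsetSum]
    swap
    · intro x _
      apply integrable_finsetSum
      intro y _
      have := (hIntg x y).const_mul (f x * f y)
      refine this.congr (Filter.Eventually.of_forall fun ω => ?_)
      simp only; ring
    unfold ip
    rw [tsum_eq_sum (s := S)]
    swap
    · intro z hzS; rw [hS z hzS, zero_mul]
    apply Finset.sum_congr rfl
    intro x _
    rw [integral_finsetSum]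
    swap
    · intro y _
      have := (hIntg x y).const_mul (f x * f y)
      refine this.congr (Filter.Eventually.of_forall fun ω => ?_)
      simp only; ring
    have e1 : ∀ y, ∫ ω, f x * η x ω * (f y * η y ω) = f x * (f y * ∫ ω, η x ω * η y ω) := by
      intro y
      rw [← integral_const_mul, ← integral_const_mul]
      congr 1; ext ω; ring
    simp only [e1, hcov', hw]
    rw [← Finset.mul_sum, Finset.sum_filter]
    congr 1
    apply Finset.sum_congr rfl
    intro y _
    unfold gE
    by_cases h1 : x ∈ V <;> by_cases h2 : y ∈ V <;> simp [h1, h2]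
  have hnn := dir_nonneg (hu.sub hwFS)
  have hfun : Lp (fun z => u z - w z) = fun z => f z - Lp w z := by
    funext z; rw [Lp_sub]
  have hfFS : FS f := hu.Lp
  rw [hfun, ip_sub_left hfFS hwFS.Lp, ip_sub_right hu hwFS, ip_sub_right hu hwFS,
    ip_Lp_symm hwFS u] at hnn
  have e2 : ip (Lp w) w = ip f w := by
    unfold ip
    congr 1; ext z
    by_cases h : z ∈ V \ bdry V
    · rw [hwL z h]
    · rw [hw0 z h]; simp
  rw [e2, ip_comm w] at hnn
  rw [hvw]
  change 0 ≤ ip f u - ip f w - (ip f w - ip f w) at hnn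
  linarith

end TP

namespace TP

/-- centered box with half-width `L` -/
def bx (L : ℕ) : Set Z2 := {z | sn z ≤ (L : ℤ)}

lemma mem_bx {L : ℕ} {z : Z2} : z ∈ bx L ↔ sn z ≤ (L : ℤ) := Iff.rfl

lemma sn_dirs (e : Fin 4) : sn (dirs e) = 1 := by
  fin_cases e <;> simp [sn, dirs]

lemma exists_out {z : Z2} : ∃ e : Fin 4, sn (z + dirs e) = sn z + 1 := by
  obtain ⟨a, b⟩ := z
  rcases le_total |a| |b| with h | h
  · rcases le_total 0 b with hb | hb
    · refine ⟨2, ?_⟩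
      simp only [sn, dirs, Matrix.cons_val, Prod.mk_add_mk, add_zero]
      rw [max_eq_right h, abs_of_nonneg hb, abs_of_nonneg (by omega : 0 ≤ b + 1)]
      rw [abs_of_nonneg hb] at h
      exact max_eq_right (by omega)
    · refine ⟨3, ?_⟩
      simp only [sn, dirs, Matrix.cons_val, Prod.mk_add_mk, add_zero]
      rw [max_eq_right h, abs_of_nonpos hb, abs_of_nonpos (by omega : b + -1 ≤ 0)]
      rw [abs_of_nonpos hb] at h
      rw [max_eq_right (by omega)]; ring
  · rcases le_total 0 a with hb | hb
    · refine ⟨0, ?_⟩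
      simp only [sn, dirs, Matrix.cons_val, Prod.mk_add_mk, add_zero]
      rw [max_eq_left h, abs_of_nonneg hb, abs_of_nonneg (by omega : 0 ≤ a + 1)]
      rw [abs_of_nonneg hb] at h
      exact max_eq_left (by omega)
    · refine ⟨1, ?_⟩
      simp only [sn, dirs, Matrix.cons_val, Prod.mk_add_mk, add_zero]
      rw [max_eq_left h, abs_of_nonpos hb, abs_of_nonpos (by omega : a + -1 ≤ 0)]
      rw [abs_of_nonpos hb] at h
      rw [max_eq_left (by omega)]; ring

lemma int_bx {L : ℕ} {z : Z2} : z ∈ bx L \ bdry (bx L) ↔ sn z < (L : ℤ) := by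
  constructor
  · rintro ⟨h1, h2⟩
    obtain ⟨e, he⟩ := exists_out (z := z)
    by_contra hc
    apply h2
    refine ⟨h1, _, adj_dirs z e, ?_⟩
    rw [mem_bx, he]
    rw [mem_bx] at h1
    omega
  · intro h
    refine ⟨h.le, ?_⟩
    rintro ⟨_, w, hw, hwB⟩
    obtain ⟨e, rfl⟩ := adj_exists hw
    apply hwB
    have := sn_add_le z (dirs e)
    rw [sn_dirs] at this
    rw [mem_bx]; omega

lemma bx_bd (L : ℕ) : ∀ z ∈ bx L, |z.1| ≤ (L : ℤ) := by
  intro z hz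
  exact (le_max_left _ _).trans hz

/-- Green function of the centered box with pole at the origin. -/
noncomputable def gg (L : ℕ) : Z2 → ℝ := gE (bx L) 0

lemma gg_nonneg (L : ℕ) (z : Z2) : 0 ≤ gg L z := gE_nonneg _ _ _

lemma gg_zero {L : ℕ} {z : Z2} (h : (L : ℤ) ≤ sn z) : gg L z = 0 :=
  gE_zero _ _ _ (by rw [int_bx]; omega)

lemma gg_Lp {L : ℕ} {z : Z2} (h : sn z < (L : ℤ)) : Lp (gg L) z = if z = 0 then 1 else 0 :=
  gE_Lp (bx_bd L) 0 z (int_bx.2 h)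

lemma gg_FS (L : ℕ) : FS (gg L) := FS_of_sn (L : ℤ) (fun _ h => gg_zero h.le)

/-- harmonic measure of the centered box seen from the origin -/
noncomputable def mu (L : ℕ) (z : Z2) : ℝ := (if z = 0 then 1 else 0) - Lp (gg L) z

lemma Lp_gg (L : ℕ) (z : Z2) : Lp (gg L) z = (if z = 0 then 1 else 0) - mu L z := by
  unfold mu; ring

lemma delta_FS : FS (fun z : Z2 => if z = 0 then (1 : ℝ) else 0) := by
  apply FS_of_sn 0
  intro z hz
  rw [if_neg]
  rintro rfl
  simp [sn_zero] at hz

lemma mu_FS (L : ℕ) : FS (mu L) := delta_FS.sub (gg_FS L).Lp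

lemma mu_nonneg (L : ℕ) (z : Z2) : 0 ≤ mu L z := by
  unfold mu
  by_cases h : sn z < (L : ℤ)
  · rw [gg_Lp h]; simp
  · unfold Lp
    rw [gg_zero (not_lt.1 h)]
    have h1 := gg_nonneg L (z + (1, 0))
    have h2 := gg_nonneg L (z + (-1, 0))
    have h3 := gg_nonneg L (z + (0, 1))
    have h4 := gg_nonneg L (z + (0, -1))
    have h5 : (0 : ℝ) ≤ if z = 0 then (1 : ℝ) else 0 := by split_ifs <;> norm_num
    linarith

lemma mu_supp {L : ℕ} {z : Z2} (h : sn z ≠ (L : ℤ)) : mu L z = 0 := by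
  unfold mu
  rcases lt_or_gt_of_ne h with h | h
  · rw [gg_Lp h]; simp
  · have key : ∀ e : Fin 4, (L : ℤ) ≤ sn (z + dirs e) := by
      intro e
      have := sn_add_le (z + dirs e) (-dirs e)
      rw [sn_neg, sn_dirs] at this
      simp at this
      omega
    have hz : z ≠ 0 := by
      rintro rfl
      rw [sn_zero] at h; omega
    unfold Lp
    have k0 : gg L (z + (1, 0)) = 0 := gg_zero (key 0)
    have k1 : gg L (z + (-1, 0)) = 0 := gg_zero (key 1)
    have k2 : gg L (z + (0, 1)) = 0 := gg_zero (key 2)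
    have k3 : gg L (z + (0, -1)) = 0 := gg_zero (key 3)
    rw [gg_zero h.le, k0, k1, k2, k3, if_neg hz]
    simp

lemma tsum_Lp {u : Z2 → ℝ} (hu : FS u) : ∑' z, Lp u z = 0 := by
  have h := ip_Lp_symm hu (fun _ => 1)
  have h2 : Lp (fun _ : Z2 => (1 : ℝ)) = fun _ => 0 := by
    funext z; unfold Lp; norm_num
  rw [h2] at h
  unfold ip at h
  simpa using h

lemma mu_sum (L : ℕ) : ∑' z, mu L z = 1 := by
  unfold mu
  rw [delta_FS.summable.tsum_sub (gg_FS L).Lp.summable, tsum_Lp (gg_FS L)]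
  simp

lemma mu_shift_sum (L : ℕ) (e : Z2) : ∑' z, mu L (z + e) = 1 := by
  rw [tsum_shift (mu L) e, mu_sum]

/-- averaging against `mu` -/
lemma mu_avg_le (L : ℕ) (e : Z2) (φ : Z2 → ℝ) (M : ℝ) (h : ∀ z, sn (z + e) = (L : ℤ) → φ z ≤ M) :
    ip (fun z => mu L (z + e)) φ ≤ M := by
  have hFS := (mu_FS L).shift e
  have : ip (fun z => mu L (z + e)) φ ≤ ∑' z, mu L (z + e) * M := by
    unfold ip
    refine (hFS.mulr φ).summable.tsum_le_tsum (fun z => ?_) (hFS.mulr (fun _ => M)).summable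
    by_cases hz : sn (z + e) = (L : ℤ)
    · exact mul_le_mul_of_nonneg_left (h z hz) (mu_nonneg _ _)
    · beta_reduce
      rw [mu_supp hz]; simp
  rw [tsum_mul_right, mu_shift_sum, one_mul] at this
  exact this

lemma mu_avg_ge (L : ℕ) (e : Z2) (φ : Z2 → ℝ) (M : ℝ) (h : ∀ z, sn (z + e) = (L : ℤ) → M ≤ φ z) :
    M ≤ ip (fun z => mu L (z + e)) φ := by
  have h1 := mu_avg_le L e (fun z => - φ z) (-M) (fun z hz => neg_le_neg (h z hz))
  have h2 : ip (fun z => mu L (z + e)) (fun z => - φ z) = - ip (fun z => mu L (z + e)) φ := by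
    unfold ip; rw [← tsum_neg]; congr 1; ext z; ring
  linarith

lemma boxZ_int {x z : Z2} {ℓ : ℤ} {L : ℕ} (hL : ℓ / 2 = (L : ℤ)) :
    z ∈ boxZ x ℓ \ bdry (boxZ x ℓ) ↔ sn (z + -x) < (L : ℤ) := by
  have hm : ∀ w, w ∈ boxZ x ℓ ↔ w + -x ∈ bx L := by
    intro w
    rw [mem_bx, sn_le_iff]
    unfold boxZ
    simp only [Set.mem_ofPred_eq, hL, Prod.fst_add, Prod.snd_add, Prod.fst_neg, Prod.snd_neg]
    omega
  rw [← int_bx]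
  unfold bdry
  simp only [Set.mem_sdiff, Set.mem_ofPred_eq, hm]
  constructor
  · rintro ⟨h1, h2⟩
    refine ⟨h1, ?_⟩
    rintro ⟨h3, w, hw, hwB⟩
    apply h2
    refine ⟨h3, w + x, ?_, by simpa using hwB⟩
    obtain ⟨e, rfl⟩ := adj_exists hw
    have : z + -x + dirs e + x = z + dirs e := by abel
    rw [this]; exact adj_dirs z e
  · rintro ⟨h1, h2⟩
    refine ⟨h1, ?_⟩
    rintro ⟨h3, w, hw, hwB⟩
    apply h2
    refine ⟨h3, w + -x, ?_, hwB⟩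
    obtain ⟨e, rfl⟩ := adj_exists hw
    have : z + dirs e + -x = z + -x + dirs e := by abel
    rw [this]; exact adj_dirs _ e

lemma H_rep {Ω : Type*} [MeasureSpace Ω] {η F : Z2 → Ω → ℝ} {x : Z2} {ℓ : ℤ} {L : ℕ}
    (hL : ℓ / 2 = (L : ℤ)) (h : IsHarmExt η F (boxZ x ℓ)) (ω : Ω) :
    F x ω = ip (fun z => mu L (z + -x)) (fun z => η z ω) := by
  obtain ⟨h1, h2⟩ := h
  have hFS := (gg_FS L).shift (-x)
  have e1 := ip_Lp_symm hFS (fun z => F z ω)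
  have e2 : ip (fun z => gg L (z + -x)) (Lp (fun z => F z ω)) = 0 := by
    unfold ip
    rw [← tsum_zero (α := ℝ) (β := Z2)]
    congr 1; ext z
    by_cases hz : sn (z + -x) < (L : ℤ)
    · have := h2 z ((boxZ_int hL).2 hz) ω
      have hh : Lp (fun z => F z ω) z = 0 := by
        unfold Lp
        simp only [sub_eq_add_neg] at this
        have a1 : z + (1, 0) = (z.1 + 1, z.2) := by ext <;> simp
        have a2 : z + (-1, 0) = (z.1 + -1, z.2) := by ext <;> simp
        have a3 : z + (0, 1) = (z.1, z.2 + 1) := by ext <;> simp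
        have a4 : z + (0, -1) = (z.1, z.2 + -1) := by ext <;> simp
        rw [a1, a2, a3, a4]
        linarith
      rw [hh, mul_zero]
    · beta_reduce
      rw [gg_zero (not_lt.1 hz), zero_mul]
  rw [e2] at e1
  have e3 : Lp (fun z => gg L (z + -x)) = fun z => (if z + -x = 0 then 1 else 0) - mu L (z + -x) := by
    funext z
    rw [Lp_shift, Lp_gg]
  rw [e3, ip_sub_left (delta_FS.shift (-x)) ((mu_FS L).shift (-x))] at e1
  have e4 : ip (fun z => if z + -x = 0 then (1 : ℝ) else 0) (fun z => F z ω) = F x ω := by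
    unfold ip
    rw [tsum_eq_single x]
    · simp
    · intro z hz
      beta_reduce
      rw [if_neg, zero_mul]
      intro hc
      exact hz (by rwa [← sub_eq_add_neg, sub_eq_zero] at hc)
  have e5 : ip (fun z => mu L (z + -x)) (fun z => F z ω) =
      ip (fun z => mu L (z + -x)) (fun z => η z ω) := by
    unfold ip
    congr 1; ext z
    beta_reduce
    by_cases hz : sn (z + -x) = (L : ℤ)
    · rw [h1 z (by rw [boxZ_int hL]; omega)]
    · rw [mu_supp hz]; simp
  rw [← e5]; linarith

/-- potential difference of the two centered boxes -/
noncomputable def uu (a A : ℕ) (z : Z2) : ℝ := gg A z - gg a z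

lemma uu_FS (a A : ℕ) : FS (uu a A) := (gg_FS A).sub (gg_FS a)

lemma Lp_uu (a A : ℕ) (z : Z2) : Lp (uu a A) z = mu a z - mu A z := by
  unfold uu; rw [Lp_sub, Lp_gg, Lp_gg]; ring

/-- the dominating covariance kernel -/
noncomputable def kap (a A : ℕ) (x y : Z2) : ℝ :=
  ip (fun z => mu a (z + -x) - mu A (z + -x)) (fun z => uu a A (z + -y))

/-- Gaussian domination of a field by a kernel -/
def GDom {Ω : Type*} [MeasureSpace Ω] (X : Z2 → Ω → ℝ) (κ : Z2 → Z2 → ℝ) : Prop :=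
  ∀ (n : ℕ) (c : Fin n → ℝ) (x : Fin n → Z2), ∃ v : NNReal,
    Measure.map (fun ω => ∑ i, c i * X (x i) ω) (ℙ : Measure Ω) = gaussianReal 0 v ∧
    (v : ℝ) ≤ ∑ i, ∑ j, c i * c j * κ (x i) (x j)

lemma ip_sum_sum {n : ℕ} (c : Fin n → ℝ) (f u : Fin n → Z2 → ℝ) (hf : ∀ i, FS (f i)) :
    ip (fun z => ∑ i, c i * f i z) (fun z => ∑ i, c i * u i z) =
      ∑ i, ∑ j, c i * c j * ip (f i) (u j) := by
  unfold ip
  have h1 : ∀ z, (∑ i, c i * f i z) * (∑ i, c i * u i z) =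
      ∑ i, ∑ j, c i * c j * (f i z * u j z) := by
    intro z
    rw [Finset.sum_mul_sum]
    apply Finset.sum_congr rfl; intro i _
    apply Finset.sum_congr rfl; intro j _
    ring
  simp only [h1]
  rw [Summable.tsum_finsetSum]
  · apply Finset.sum_congr rfl; intro i _
    rw [Summable.tsum_finsetSum]
    · apply Finset.sum_congr rfl; intro j _
      rw [tsum_mul_left]
    · intro j _
      exact (((hf i).mulr (u j)).cmul (c i * c j)).summable
  · intro i _
    exact (FS.sum Finset.univ (fun j _ => ((hf i).mulr (u j)).cmul (c i * c j))).summable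

lemma gdom {Ω : Type*} [MeasureSpace Ω] {N : ℕ} {η : Z2 → Ω → ℝ} (hη : IsDGFF (V5N N) η)
    {a A : ℕ} {X : Z2 → Ω → ℝ}
    (hX : ∀ x ω, X x ω = ip (fun z => mu a (z + -x)) (fun z => η z ω) -
      ip (fun z => mu A (z + -x)) (fun z => η z ω)) :
    GDom X (kap a A) := by
  classical
  intro n c x
  have hf : ∀ i, FS (fun z => mu a (z + -(x i)) - mu A (z + -(x i))) := fun i =>
    ((mu_FS a).shift (-(x i))).sub ((mu_FS A).shift (-(x i)))
  set u : Z2 → ℝ := fun z => ∑ i, c i * uu a A (z + -(x i)) with hu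
  have huFS : FS u := FS.sum Finset.univ (fun i _ => ((uu_FS a A).shift (-(x i))).cmul (c i))
  have hLu : Lp u = fun z => ∑ i, c i * (mu a (z + -(x i)) - mu A (z + -(x i))) := by
    funext z
    rw [hu, Lp_sum]
    apply Finset.sum_congr rfl
    intro i _
    rw [Lp_cmul, Lp_shift, Lp_uu]
  obtain ⟨v, hv, hvle⟩ := var_lemma hη huFS huFS.Lp.toFinset (by
    intro z hz
    by_contra hc
    exact hz ((Set.Finite.mem_toFinset _).2 hc))
  refine ⟨v, ?_, ?_⟩
  · rw [← hv]
    congr 1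
    funext ω
    have e1 : ∑ z ∈ huFS.Lp.toFinset, Lp u z * η z ω = ip (Lp u) (fun z => η z ω) := by
      unfold ip
      rw [tsum_eq_sum]
      intro z hz
      have : Lp u z = 0 := by
        by_contra hc
        exact hz ((Set.Finite.mem_toFinset _).2 hc)
      rw [this, zero_mul]
    rw [e1, hLu]
    have e2 : ∀ i, X (x i) ω =
        ip (fun z => mu a (z + -(x i)) - mu A (z + -(x i))) (fun z => η z ω) := by
      intro i
      rw [ip_sub_left ((mu_FS a).shift _) ((mu_FS A).shift _), hX]
    simp only [e2]
    unfold ip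
    have e3 : ∀ z, (∑ i, c i * (mu a (z + -(x i)) - mu A (z + -(x i)))) * η z ω =
        ∑ i, c i * ((mu a (z + -(x i)) - mu A (z + -(x i))) * η z ω) := by
      intro z; rw [Finset.sum_mul]; apply Finset.sum_congr rfl; intro i _; ring
    simp only [e3]
    rw [Summable.tsum_finsetSum]
    · simp only [tsum_mul_left]
    · intro i _
      exact (((hf i).mulr (fun z => η z ω)).cmul (c i)).summable
  · refine hvle.trans (le_of_eq ?_)
    rw [hLu]
    exact ip_sum_sum c _ _ hf

end TP

namespace TP

lemma mp_loc {S : Set Z2} (hS : S.Finite) (ψ : Z2 → ℝ)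
    (hout : ∀ z ∈ S, ∀ e, z + dirs e ∉ S → 0 ≤ ψ (z + dirs e))
    (hin : ∀ z ∈ S, ψ z < 0 → 0 ≤ Lp ψ z) : ∀ z ∈ S, 0 ≤ ψ z := by
  classical
  set φ : Z2 → ℝ := fun z => if z ∈ S then ψ z else max (ψ z) 0 with hφ
  have hS' : ∀ z ∈ S, φ z = ψ z := fun z hz => by simp [hφ, hz]
  have hN : ∀ z ∈ S, ∀ e, φ (z + dirs e) = ψ (z + dirs e) := by
    intro z hz e
    by_cases h : z + dirs e ∈ S
    · exact hS' _ h
    · simp only [hφ, if_neg h]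
      exact max_eq_left (hout z hz e h)
  have := max_principle hS φ (by
    intro z hz
    simp only [hφ, if_neg hz]
    exact le_max_right _ _) (by
    intro z hz hneg
    rw [hS' z hz] at hneg
    have h := hin z hz hneg
    have k0 : φ (z + (1, 0)) = ψ (z + (1, 0)) := hN z hz 0
    have k1 : φ (z + (-1, 0)) = ψ (z + (-1, 0)) := hN z hz 1
    have k2 : φ (z + (0, 1)) = ψ (z + (0, 1)) := hN z hz 2
    have k3 : φ (z + (0, -1)) = ψ (z + (0, -1)) := hN z hz 3
    unfold Lp at h ⊢
    rw [hS' z hz, k0, k1, k2, k3]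
    exact h)
  intro z hz
  rw [← hS' z hz]
  exact this z

/-- log potential -/
noncomputable def pl (z : Z2) : ℝ := Real.log ((z.1 : ℝ) ^ 2 + (z.2 : ℝ) ^ 2 + 1)

lemma pl_sub (z : Z2) : Lp pl z ≤ 0 := by
  obtain ⟨a, b⟩ := z
  unfold Lp pl
  simp only [Prod.mk_add_mk]
  push_cast
  set x : ℝ := (a : ℝ)
  set y : ℝ := (b : ℝ)
  have p1 : 0 < (x + 1) ^ 2 + (y + 0) ^ 2 + 1 := by positivity
  have p2 : 0 < (x + -1) ^ 2 + (y + 0) ^ 2 + 1 := by positivity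
  have p3 : 0 < (x + 0) ^ 2 + (y + 1) ^ 2 + 1 := by positivity
  have p4 : 0 < (x + 0) ^ 2 + (y + -1) ^ 2 + 1 := by positivity
  have p0 : 0 < x ^ 2 + y ^ 2 + 1 := by positivity
  have key : 4 * Real.log (x ^ 2 + y ^ 2 + 1) ≤ Real.log ((x + 1) ^ 2 + (y + 0) ^ 2 + 1) +
      Real.log ((x + -1) ^ 2 + (y + 0) ^ 2 + 1) + Real.log ((x + 0) ^ 2 + (y + 1) ^ 2 + 1) +
      Real.log ((x + 0) ^ 2 + (y + -1) ^ 2 + 1) := by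
    rw [← Real.log_mul p1.ne' p2.ne', ← Real.log_mul (by positivity) p3.ne',
      ← Real.log_mul (by positivity) p4.ne']
    have : (4 : ℝ) * Real.log (x ^ 2 + y ^ 2 + 1) = Real.log ((x ^ 2 + y ^ 2 + 1) ^ 4) := by
      rw [Real.log_pow]; norm_num
    rw [this]
    apply Real.log_le_log (by positivity)
    nlinarith [sq_nonneg (x * y), sq_nonneg x, sq_nonneg y, sq_nonneg (x ^ 2 + y ^ 2)]
  linarith

lemma pl_sub0 : Lp pl 0 = - Real.log 2 := by
  unfold Lp pl
  norm_num
  ring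

lemma sq_sn (z : Z2) : ((sn z : ℤ) : ℝ) ^ 2 ≤ (z.1 : ℝ) ^ 2 + (z.2 : ℝ) ^ 2 ∧
    (z.1 : ℝ) ^ 2 + (z.2 : ℝ) ^ 2 ≤ 2 * ((sn z : ℤ) : ℝ) ^ 2 := by
  have h1 : |z.1| ≤ sn z := le_max_left _ _
  have h2 : |z.2| ≤ sn z := le_max_right _ _
  have h3 : sn z = |z.1| ∨ sn z = |z.2| := by
    unfold sn
    rcases le_total |z.1| |z.2| with h | h
    · right; exact max_eq_right h
    · left; exact max_eq_left h
  have q1 : (z.1) ^ 2 ≤ (sn z) ^ 2 := by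
    rw [← sq_abs z.1]; exact pow_le_pow_left₀ (abs_nonneg _) h1 2
  have q2 : (z.2) ^ 2 ≤ (sn z) ^ 2 := by
    rw [← sq_abs z.2]; exact pow_le_pow_left₀ (abs_nonneg _) h2 2
  have q3 : (sn z) ^ 2 ≤ z.1 ^ 2 + z.2 ^ 2 := by
    rcases h3 with h | h <;> rw [h, sq_abs] <;> nlinarith [sq_nonneg z.1, sq_nonneg z.2]
  constructor
  · exact_mod_cast q3
  · have : z.1 ^ 2 + z.2 ^ 2 ≤ 2 * (sn z) ^ 2 := by linarith
    exact_mod_cast this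

lemma finite_sn_lt (L : ℤ) : {z : Z2 | sn z < L}.Finite :=
  (finite_sn L).subset (fun z h => by
    simp only [Set.mem_ofPred_eq] at h ⊢
    exact h.le)

lemma sn_add_dirs_le (z : Z2) (e : Fin 4) : sn (z + dirs e) ≤ sn z + 1 := by
  have := sn_add_le z (dirs e)
  rwa [sn_dirs] at this

lemma gg_le_pl {L : ℕ} {z : Z2} (hz : sn z ≤ (L : ℤ)) :
    gg L z ≤ (Real.log (2 * (L : ℝ) ^ 2 + 1) - pl z) / Real.log 2 := by
  have hl2 : 0 < Real.log 2 := Real.log_pos (by norm_num)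
  have hb : ∀ w : Z2, sn w ≤ (L : ℤ) → 0 ≤ (Real.log (2 * (L : ℝ) ^ 2 + 1) - pl w) / Real.log 2 := by
    intro w hw
    apply div_nonneg _ hl2.le
    rw [sub_nonneg]
    unfold pl
    apply Real.log_le_log (by positivity)
    have h1 := (sq_sn w).2
    have h2 : ((sn w : ℤ) : ℝ) ≤ L := by exact_mod_cast hw
    have h3 : (0 : ℝ) ≤ ((sn w : ℤ) : ℝ) := by exact_mod_cast sn_nonneg w
    nlinarith
  rcases hz.lt_or_eq with h | h
  · have := mp_loc (finite_sn_lt (L : ℤ))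
      (fun w => (Real.log (2 * (L : ℝ) ^ 2 + 1) - pl w) / Real.log 2 - gg L w) (by
        intro w hw e he
        simp only [Set.mem_ofPred_eq, not_lt] at hw he
        rw [gg_zero he, sub_zero]
        apply hb
        have := sn_add_dirs_le w e
        omega) (by
        intro w hw _
        have e1 : Lp (fun w => (Real.log (2 * (L : ℝ) ^ 2 + 1) - pl w) / Real.log 2 - gg L w) w =
          - Lp pl w / Real.log 2 - Lp (gg L) w := by
          unfold Lp; ring
        rw [e1, gg_Lp hw]
        split_ifs with h0
        · rw [h0, pl_sub0, neg_neg, div_self hl2.ne']; norm_num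
        · rw [sub_zero]
          apply div_nonneg _ hl2.le
          linarith [pl_sub w]) z h
    linarith
  · rw [gg_zero h.ge]
    exact hb z hz

lemma gg_le_log {L : ℕ} {z : Z2} {ρ B : ℝ} (hρ : 0 ≤ ρ) (hz : ρ ≤ ((sn z : ℤ) : ℝ)) (hB1 : 1 ≤ B)
    (hB : 2 * (L : ℝ) ^ 2 + 1 ≤ B * (ρ ^ 2 + 1)) : gg L z ≤ Real.log B / Real.log 2 := by
  have hl2 : 0 < Real.log 2 := Real.log_pos (by norm_num)
  rcases le_total (sn z) (L : ℤ) with h | h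
  · refine (gg_le_pl h).trans ?_
    apply div_le_div_of_nonneg_right _ hl2.le
    rw [sub_le_iff_le_add]
    unfold pl
    rw [← Real.log_mul (by positivity) (by positivity)]
    apply Real.log_le_log (by positivity)
    refine hB.trans ?_
    apply mul_le_mul_of_nonneg_left _ (by linarith)
    have := (sq_sn z).1
    nlinarith
  · rw [gg_zero h]
    exact div_nonneg (Real.log_nonneg hB1) hl2.le

lemma gg_le_nat {L : ℕ} {z : Z2} {ρ : ℝ} (t : ℕ) (hρ : 0 ≤ ρ) (hz : ρ ≤ ((sn z : ℤ) : ℝ))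
    (hB : 2 * (L : ℝ) ^ 2 + 1 ≤ 2 ^ t * (ρ ^ 2 + 1)) : gg L z ≤ t := by
  have h := gg_le_log hρ hz (one_le_pow₀ (by norm_num : (1 : ℝ) ≤ 2)) hB
  rwa [Real.log_pow, mul_div_assoc, div_self (Real.log_pos (by norm_num)).ne', mul_one] at h

lemma uu_nonneg {a A : ℕ} (h : a ≤ A) (z : Z2) : 0 ≤ uu a A z := by
  have haA : (a : ℤ) ≤ A := by exact_mod_cast h
  refine max_principle (finite_sn_lt (a : ℤ)) (uu a A) ?_ ?_ z
  · intro w hw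
    simp only [Set.mem_ofPred_eq, not_lt] at hw
    unfold uu
    rw [gg_zero hw, sub_zero]
    exact gg_nonneg _ _
  · intro w hw _
    simp only [Set.mem_ofPred_eq] at hw
    rw [Lp_uu, mu_supp (by omega), mu_supp (by omega)]; simp

lemma uu_Lp0 {a A : ℕ} (h : a ≤ A) {z : Z2} (hz : sn z < (a : ℤ)) : Lp (uu a A) z = 0 := by
  have haA : (a : ℤ) ≤ A := by exact_mod_cast h
  rw [Lp_uu, mu_supp (by omega), mu_supp (by omega)]; simp

lemma uu_le_gg (a A : ℕ) (z : Z2) : uu a A z ≤ gg A z := by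
  unfold uu; linarith [gg_nonneg a z]

lemma uu_le {a A : ℕ} (h : a ≤ A) {M : ℝ} (hM : ∀ z, (a : ℤ) ≤ sn z → gg A z ≤ M) (z : Z2) :
    uu a A z ≤ M := by
  have := max_principle (finite_sn_lt (a : ℤ)) (fun w => M - uu a A w) (by
    intro w hw
    simp only [Set.mem_ofPred_eq, not_lt] at hw
    linarith [hM w hw, uu_le_gg a A w]) (by
    intro w hw _
    have e1 : Lp (fun w => M - uu a A w) w = - Lp (uu a A) w := by unfold Lp; ring
    rw [e1, uu_Lp0 h hw, neg_zero]) z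
  linarith

lemma uu_le_nat {a A : ℕ} (h : a ≤ A) (t : ℕ)
    (hB : 2 * (A : ℝ) ^ 2 + 1 ≤ 2 ^ t * ((a : ℝ) ^ 2 + 1)) (z : Z2) : uu a A z ≤ t :=
  uu_le h (fun w hw => gg_le_nat t (by positivity : (0 : ℝ) ≤ (a : ℝ)) (by exact_mod_cast hw) hB) z

/-- bounds on the kernel -/
lemma kap_le {a A : ℕ} (h : a ≤ A) {M : ℝ} {x y : Z2}
    (hM : ∀ w, sn (w + -x) = (a : ℤ) → uu a A (w + -y) ≤ M) : kap a A x y ≤ M := by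
  unfold kap
  rw [ip_sub_left ((mu_FS a).shift _) ((mu_FS A).shift _)]
  have h1 := mu_avg_le a (-x) (fun z => uu a A (z + -y)) M hM
  have h2 := mu_avg_ge A (-x) (fun z => uu a A (z + -y)) 0 (fun z _ => uu_nonneg h _)
  linarith

lemma kap_le_log {a A : ℕ} (h : a ≤ A) {ρ B : ℝ} (hρ : 0 ≤ ρ) {x y : Z2}
    (hxy : ρ + a ≤ ((sn (x - y) : ℤ) : ℝ)) (hB1 : 1 ≤ B)
    (hB : 2 * (A : ℝ) ^ 2 + 1 ≤ B * (ρ ^ 2 + 1)) : kap a A x y ≤ Real.log B / Real.log 2 := by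
  apply kap_le h
  intro w hw
  refine (uu_le_gg _ _ _).trans (gg_le_log hρ ?_ hB1 hB)
  have h1 := sn_add_le (w + -y) (-(w + -x))
  rw [sn_neg, hw, show w + -y + -(w + -x) = x - y by abel] at h1
  have h2 : ((sn (x - y) : ℤ) : ℝ) ≤ ((sn (w + -y) : ℤ) : ℝ) + a := by exact_mod_cast h1
  linarith

lemma kap_le_nat {a A : ℕ} (h : a ≤ A) (t : ℕ)
    (hB : 2 * (A : ℝ) ^ 2 + 1 ≤ 2 ^ t * ((a : ℝ) ^ 2 + 1)) (x y : Z2) : kap a A x y ≤ t :=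
  kap_le h (fun _ _ => uu_le_nat h t hB _)

end TP

namespace TP

lemma grad_core {h : Z2 → ℝ} {ρ : ℕ} (hρ : 1 ≤ ρ) {M : ℝ}
    (hL : ∀ z, sn z < (ρ : ℤ) → Lp h z = 0) (hM : ∀ z, sn z ≤ (ρ : ℤ) → |h z| ≤ M) :
    h (1, 0) - h (0, 0) ≤ 2 * M / ρ := by
  have hM0 : 0 ≤ M := (abs_nonneg _).trans (hM (0, 0) (by
    have : sn (0, 0) = 0 := sn_zero
    rw [this]; positivity))
  have b1 := abs_le.1 (hM (1, 0) (by rw [sn_le_iff]; simp; omega))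
  have b0 := abs_le.1 (hM (0, 0) (by rw [sn_le_iff]; simp))
  rcases hρ.eq_or_lt with h1 | h1
  · rw [← h1]; norm_num; linarith
  have hρ' : (2 : ℤ) ≤ ρ := by exact_mod_cast h1
  have hρR : (2 : ℝ) ≤ ρ := by exact_mod_cast h1
  set w : ℝ → ℝ → ℝ := fun x y => 2 * M * ((y ^ 2 - x * (x - 1)) / (ρ : ℝ) ^ 2 + (2 * x - 1) / ρ) with hw
  set ψ : Z2 → ℝ := fun z => if 1 ≤ z.1 then w z.1 z.2 - (h z - h (1 - z.1, z.2)) else 0 with hψ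
  set S : Set Z2 := {z | 1 ≤ z.1 ∧ sn z < (ρ : ℤ)} with hS
  have hSf : S.Finite := (finite_sn_lt (ρ : ℤ)).subset (fun z hz => hz.2)
  have key := mp_loc hSf ψ (by
    intro z hz e he
    have hs := sn_add_dirs_le z e
    obtain ⟨hz1, hz2⟩ := hz
    generalize z + dirs e = v at *
    by_cases hv : 1 ≤ v.1
    · have hvρ : sn v = (ρ : ℤ) := by
        by_contra hc
        exact he ⟨hv, by omega⟩
      have hvi := sn_le_iff.1 hvρ.le
      have c1 := abs_le.1 (hM v hvρ.le)
      have c2 := abs_le.1 (hM (1 - v.1, v.2) (by rw [sn_le_iff]; constructor <;> constructor <;> simp <;> omega))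
      simp only [hψ, if_pos hv]
      have : 1 ≤ ((v.2 : ℝ) ^ 2 - (v.1 : ℝ) * ((v.1 : ℝ) - 1)) / (ρ : ℝ) ^ 2 + (2 * (v.1 : ℝ) - 1) / ρ := by
        rw [div_add_div _ _ (by positivity) (by positivity), le_div_iff₀ (by positivity)]
        have hv1 : (1 : ℝ) ≤ v.1 := by exact_mod_cast hv
        have hv2 : (v.1 : ℝ) ≤ ρ := by exact_mod_cast hvi.1.2
        have hor : (v.1 : ℝ) = ρ ∨ (v.2 : ℝ) ^ 2 = (ρ : ℝ) ^ 2 := by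
          unfold sn at hvρ
          rcases max_choice |v.1| |v.2| with hm | hm
          · left
            rw [hm, abs_of_nonneg (by omega)] at hvρ
            exact_mod_cast hvρ
          · right
            rw [hm] at hvρ
            have : v.2 ^ 2 = (ρ : ℤ) ^ 2 := by rw [← hvρ, sq_abs]
            exact_mod_cast this
        have hρp : (0 : ℝ) < ρ := by linarith
        rcases hor with ho | ho
        · rw [ho]
          nlinarith [mul_nonneg hρp.le (sq_nonneg (v.2 : ℝ))]
        · rw [ho]
          have : (v.1 : ℝ) * ((v.1 : ℝ) - 1) ≤ ρ * (2 * v.1 - 1) := by nlinarith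
          nlinarith
      have h2 : 2 * M ≤ w v.1 v.2 := by
        simp only [hw]
        nlinarith
      linarith
    · simp only [hψ, if_neg hv]; exact le_refl _) (by
    rintro ⟨x, y⟩ ⟨hz1, hz2⟩ hneg
    simp only at hz1
    have hi := sn_lt_iff.1 hz2
    simp only at hi
    have L1 := hL (x, y) hz2
    have L2 := hL (1 - x, y) (by rw [sn_lt_iff]; constructor <;> constructor <;> simp <;> omega)
    unfold Lp at L1 L2 ⊢
    simp only [hψ, Prod.mk_add_mk, add_zero] at L1 L2 hneg ⊢
    rw [if_pos hz1] at hneg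
    simp only [if_pos hz1]
    rw [if_pos (by omega : 1 ≤ x + 1)]
    rw [show 1 - (x + 1) = 1 - x + -1 by ring]
    have wh : w x y - (w (x + 1) y + w (x - 1) y + w x (y + 1) + w x (y - 1)) / 4 = 0 := by
      simp only [hw]; field_simp; ring
    by_cases hx : 1 ≤ x + -1
    · rw [if_pos hx, show 1 - (x + -1) = 1 - x + 1 by ring]
      push_cast
      simp only [← sub_eq_add_neg] at *
      linarith
    · have hx1 : x = 1 := by omega
      rw [if_neg hx]
      subst hx1
      norm_num at *
      have w01 : 0 ≤ w 0 y + w 1 y := by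
        simp only [hw]
        have : 2 * M * (((y : ℝ) ^ 2 - 0 * (0 - 1)) / (ρ : ℝ) ^ 2 + (2 * 0 - 1) / ρ) +
          2 * M * (((y : ℝ) ^ 2 - 1 * (1 - 1)) / (ρ : ℝ) ^ 2 + (2 * 1 - 1) / ρ) =
          4 * M * ((y : ℝ) ^ 2 / (ρ : ℝ) ^ 2) := by ring
        rw [this]; positivity
      simp only [← sub_eq_add_neg] at *
      linarith) (1, 0) (by
      refine ⟨le_refl _, ?_⟩
      rw [sn_lt_iff]; simp; omega)
  simp only [hψ, le_refl, if_true, hw] at key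
  norm_num at key
  rw [show 2 * M / (ρ : ℝ) = 2 * M * (ρ : ℝ)⁻¹ by ring]
  linarith

lemma grad_e1 {h : Z2 → ℝ} {ρ : ℕ} (hρ : 1 ≤ ρ) {M : ℝ} (p : Z2)
    (hL : ∀ z, sn (z - p) < (ρ : ℤ) → Lp h z = 0) (hM : ∀ z, sn (z - p) ≤ (ρ : ℤ) → |h z| ≤ M) :
    |h (p + (1, 0)) - h p| ≤ 2 * M / ρ := by
  have h1 := grad_core (h := fun z => h (z + p)) hρ (M := M)
    (fun z hz => by rw [Lp_shift]; exact hL _ (by simpa using hz)) (fun z hz => hM _ (by simpa using hz))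
  have h2 := grad_core (h := fun z => - h (z + p)) hρ (M := M)
    (fun z hz => by
      have : Lp (fun z => - h (z + p)) z = - Lp (fun z => h (z + p)) z := by unfold Lp; ring
      rw [this, Lp_shift, hL _ (by simpa using hz), neg_zero])
    (fun z hz => by rw [abs_neg]; exact hM _ (by simpa using hz))
  have e0 : ((0, 0) : Z2) + p = p := by ext <;> simp
  rw [e0, add_comm _ p] at h1 h2
  rw [abs_le]; constructor <;> linarith

lemma sn_swap (z : Z2) : sn z.swap = sn z := by unfold sn; simp [max_comm]

lemma grad_e2 {h : Z2 → ℝ} {ρ : ℕ} (hρ : 1 ≤ ρ) {M : ℝ} (p : Z2)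
    (hL : ∀ z, sn (z - p) < (ρ : ℤ) → Lp h z = 0) (hM : ∀ z, sn (z - p) ≤ (ρ : ℤ) → |h z| ≤ M) :
    |h (p + (0, 1)) - h p| ≤ 2 * M / ρ := by
  have hs : ∀ z : Z2, sn (z.swap - p) = sn (z - p.swap) := by
    intro z; rw [← sn_swap]; rfl
  have h1 := grad_e1 (h := fun z => h z.swap) hρ (M := M) p.swap
    (fun z hz => by
      have : Lp (fun z => h z.swap) z = Lp h z.swap := by
        obtain ⟨a, b⟩ := z
        unfold Lp
        simp only [Prod.mk_add_mk, Prod.swap_prod_mk, add_zero]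
        ring
      rw [this]
      apply hL
      rw [hs]; exact hz)
    (fun z hz => hM _ (by rw [hs]; exact hz))
  have e0 : (p.swap + (1, 0)).swap = p + (0, 1) := by ext <;> simp
  simpa [e0] using h1

/-- one of the two positive unit vectors -/
def E2 (e : Z2) : Prop := e = (1, 0) ∨ e = (0, 1)

lemma grad_E {h : Z2 → ℝ} {ρ : ℕ} (hρ : 1 ≤ ρ) {M : ℝ} (p : Z2)
    (hL : ∀ z, sn (z - p) < (ρ : ℤ) → Lp h z = 0) (hM : ∀ z, sn (z - p) ≤ (ρ : ℤ) → |h z| ≤ M)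
    {e : Z2} (he : E2 e) : |h (p + e) - h p| ≤ 2 * M / ρ := by
  rcases he with rfl | rfl
  · exact grad_e1 hρ p hL hM
  · exact grad_e2 hρ p hL hM

end TP

namespace TP

lemma gg_bar_aux {L : ℕ} (hL : 1 ≤ L) (ξ : Z2 → ℤ) (h1 : ∀ z, ξ z ≤ sn z)
    (h2 : ∀ z e, ξ z - 1 ≤ ξ (z + dirs e)) (h3 : ∀ z, Lp (fun z => (ξ z : ℝ)) z = 0)
    {z : Z2} (hz1 : (L : ℤ) < 2 * ξ z) (hz2 : sn z < (L : ℤ)) :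
    gg L z ≤ 8 * ((L : ℝ) - ξ z) / L := by
  have hLp : (0 : ℝ) < L := by exact_mod_cast hL
  have hSf : {z : Z2 | (L : ℤ) < 2 * ξ z ∧ sn z < (L : ℤ)}.Finite :=
    (finite_sn_lt (L : ℤ)).subset (fun z hz => hz.2)
  have key := mp_loc hSf (fun z => 8 * ((L : ℝ) - ξ z) / L - gg L z) (by
    intro w hw e he
    have hs := sn_add_dirs_le w e
    have hx := h2 w e
    obtain ⟨hw1, hw2⟩ := hw
    generalize w + dirs e = v at *
    by_cases hv : (L : ℤ) ≤ sn v
    · rw [gg_zero hv, sub_zero]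
      have : ξ v ≤ (L : ℤ) := (h1 v).trans (by omega)
      have : (ξ v : ℝ) ≤ L := by exact_mod_cast this
      apply div_nonneg _ hLp.le
      linarith
    · have hv2 : 2 * ξ v ≤ (L : ℤ) := by
        by_contra hc
        exact he ⟨by omega, by omega⟩
      have hv3 : (L : ℤ) - 1 ≤ 2 * sn v := by
        have := h1 v
        omega
      have hv2' : 2 * (ξ v : ℝ) ≤ L := by exact_mod_cast hv2
      have hv3' : (L : ℝ) - 1 ≤ 2 * (sn v : ℤ) := by exact_mod_cast hv3
      have hL1 : (1 : ℝ) ≤ L := by exact_mod_cast hL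
      have hg := gg_le_nat (L := L) (z := v) (ρ := ((L : ℝ) - 1) / 2) 4 (by linarith) (by linarith)
        (by nlinarith [sq_nonneg ((L : ℝ) - 2)])
      have : 4 ≤ 8 * ((L : ℝ) - ξ v) / L := by
        rw [le_div_iff₀ hLp]; linarith
      push_cast at hg
      linarith) (by
    intro w hw _
    obtain ⟨hw1, hw2⟩ := hw
    have e1 : Lp (fun z => 8 * ((L : ℝ) - ξ z) / L - gg L z) w =
        - (8 / L) * Lp (fun z => (ξ z : ℝ)) w - Lp (gg L) w := by
      unfold Lp; ring
    rw [e1, h3, gg_Lp hw2, if_neg]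
    · simp
    · rintro rfl
      have := h1 0
      rw [sn_zero] at this
      omega) z ⟨hz1, hz2⟩
  linarith

lemma gg_bar {L : ℕ} (hL : 1 ≤ L) {z : Z2} (hz1 : (L : ℤ) < 2 * sn z) (hz2 : sn z ≤ (L : ℤ)) :
    gg L z ≤ 8 * ((L : ℝ) - (sn z : ℤ)) / L := by
  rcases hz2.lt_or_eq with hz2 | hz2
  · have hA : sn z = z.1 ∨ sn z = -z.1 ∨ sn z = z.2 ∨ sn z = - z.2 := by
      unfold sn
      rcases max_choice |z.1| |z.2| with h | h <;> rw [h]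
      · rcases abs_choice z.1 with h | h <;> rw [h] <;> simp
      · rcases abs_choice z.2 with h | h <;> rw [h] <;> simp
    rcases hA with h | h | h | h
    · rw [h] at hz1 ⊢
      exact gg_bar_aux hL (fun z => z.1) (fun z => (le_abs_self _).trans (le_max_left _ _))
        (fun z e => by fin_cases e <;> simp [dirs] <;> omega)
        (fun z => by unfold Lp; simp; ring) hz1 hz2
    · rw [h] at hz1 ⊢
      exact gg_bar_aux hL (fun z => -z.1) (fun z => (neg_le_abs _).trans (le_max_left _ _))
        (fun z e => by fin_cases e <;> simp [dirs] <;> omega)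
        (fun z => by unfold Lp; simp; ring) hz1 hz2
    · rw [h] at hz1 ⊢
      exact gg_bar_aux hL (fun z => z.2) (fun z => (le_abs_self _).trans (le_max_right _ _))
        (fun z e => by fin_cases e <;> simp [dirs] <;> omega)
        (fun z => by unfold Lp; simp; ring) hz1 hz2
    · rw [h] at hz1 ⊢
      exact gg_bar_aux hL (fun z => -z.2) (fun z => (neg_le_abs _).trans (le_max_right _ _))
        (fun z e => by fin_cases e <;> simp [dirs] <;> omega)
        (fun z => by unfold Lp; simp; ring) hz1 hz2
  · rw [gg_zero hz2.ge, hz2]; simp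

lemma gg_grad {L : ℕ} (hL : 40 ≤ L) {z e : Z2} (he : E2 e) (hz : (L : ℤ) ≤ 4 * sn z) :
    |gg L (z + e) - gg L z| ≤ 224 / L := by
  have hLp : (40 : ℝ) ≤ L := by exact_mod_cast hL
  have hLz : (40 : ℤ) ≤ L := by exact_mod_cast hL
  have hse : sn e = 1 := by rcases he with rfl | rfl <;> simp [sn]
  rcases le_or_gt (L : ℤ) (sn z) with h | h
  · rw [gg_zero h, sub_zero, abs_of_nonneg (gg_nonneg _ _)]
    rcases le_or_gt (L : ℤ) (sn (z + e)) with h' | h'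
    · rw [gg_zero h']; positivity
    · have h3 : (L : ℤ) - 1 ≤ sn (z + e) := by
        have := sn_add_le (z + e) (-e)
        rw [sn_neg, hse] at this
        simp at this
        omega
      refine (gg_bar (by omega) (by omega) h'.le).trans ?_
      apply div_le_div_of_nonneg_right _ (by linarith)
      have : (L : ℝ) - 1 ≤ (sn (z + e) : ℤ) := by exact_mod_cast h3
      linarith
  · have hd : ∀ w : Z2, sn z ≤ sn w + sn (w - z) ∧ sn w ≤ sn z + sn (w - z) := by
      intro w
      have a1 := sn_add_le w (-(w - z))
      have a2 := sn_add_le z (w - z)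
      rw [sn_neg] at a1
      simp at a1 a2
      exact ⟨a1, a2⟩
    by_cases h8 : (L : ℤ) ≤ 8 * (L - sn z)
    · have hρ : 1 ≤ L / 8 := by omega
      have := grad_E (h := gg L) hρ (M := 7) z (by
        intro w hw
        have := hd w
        rw [gg_Lp (by push_cast at hw; omega), if_neg]
        rintro rfl
        rw [sn_zero] at this
        push_cast at hw
        omega) (by
        intro w hw
        have := hd w
        rw [abs_of_nonneg (gg_nonneg _ _)]
        push_cast at hw
        have h9 : (L : ℤ) ≤ 8 * sn w := by omega
        have h9' : (L : ℝ) ≤ 8 * (sn w : ℤ) := by exact_mod_cast h9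
        have := gg_le_nat (L := L) (z := w) (ρ := (L : ℝ) / 8) 7 (by positivity) (by linarith)
          (by nlinarith)
        exact_mod_cast this) he
      refine this.trans ?_
      have h16 : L ≤ 16 * (L / 8) := by omega
      have h16' : (L : ℝ) ≤ 16 * ((L / 8 : ℕ) : ℝ) := by exact_mod_cast h16
      have hpos : (0 : ℝ) < ((L / 8 : ℕ) : ℝ) := by exact_mod_cast hρ
      rw [div_le_div_iff₀ hpos (by linarith)]
      linarith
    · obtain ⟨d, hd'⟩ : ∃ d : ℕ, (d : ℤ) = L - sn z := ⟨((L : ℤ) - sn z).toNat, by omega⟩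
      have hd1 : 1 ≤ d := by omega
      have hdp : (0 : ℝ) < d := by exact_mod_cast hd1
      have := grad_E (h := gg L) hd1 (M := 16 * d / L) z (by
        intro w hw
        have := hd w
        rw [gg_Lp (by omega), if_neg]
        rintro rfl
        rw [sn_zero] at this
        omega) (by
        intro w hw
        have := hd w
        rw [abs_of_nonneg (gg_nonneg _ _)]
        refine (gg_bar (by omega) (by omega) (by omega)).trans ?_
        apply div_le_div_of_nonneg_right _ (by linarith)
        have h9 : (L : ℤ) - sn w ≤ 2 * d := by omega
        have h9' : (L : ℝ) - (sn w : ℤ) ≤ 2 * d := by exact_mod_cast h9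
        linarith) he
      refine this.trans ?_
      rw [div_le_div_iff₀ hdp (by linarith)]
      have : 2 * (16 * (d : ℝ) / L) * L = 32 * d := by field_simp; norm_num
      rw [this]; linarith

lemma uu2_grad {L : ℕ} (hL : 1 ≤ L) {e : Z2} (he : E2 e) (z : Z2) :
    |uu L (2 * L) (z + e) - uu L (2 * L) z| ≤ 400 / L := by
  have hLp : (1 : ℝ) ≤ L := by exact_mod_cast hL
  have hle : L ≤ 2 * L := by omega
  have b0 : ∀ w, 0 ≤ uu L (2 * L) w := uu_nonneg hle
  have b3 : ∀ w, uu L (2 * L) w ≤ 3 := fun w => by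
    have := uu_le_nat hle 3 (by push_cast; nlinarith) w
    exact_mod_cast this
  rcases lt_or_ge L 40 with h | h
  · have h' : (L : ℝ) ≤ 40 := by exact_mod_cast h.le
    have : |uu L (2 * L) (z + e) - uu L (2 * L) z| ≤ 3 := by
      rw [abs_le]; constructor <;> linarith [b0 z, b3 z, b0 (z + e), b3 (z + e)]
    refine this.trans ?_
    rw [le_div_iff₀ (by linarith)]; linarith
  · by_cases hz : (L : ℤ) ≤ 2 * sn z
    · have g1 := gg_grad (L := L) h he (z := z) (by omega)
      have g2 := gg_grad (L := 2 * L) (by omega) he (z := z) (by push_cast; omega)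
      have e1 : uu L (2 * L) (z + e) - uu L (2 * L) z =
        (gg (2 * L) (z + e) - gg (2 * L) z) - (gg L (z + e) - gg L z) := by unfold uu; ring
      rw [e1]
      refine (abs_sub _ _).trans ?_
      push_cast at g2
      have : 224 / (2 * (L : ℝ)) = 112 / L := by field_simp; norm_num
      rw [this] at g2
      have h5 : 400 / (L : ℝ) = 112 / L + 224 / L + 64 / L := by field_simp; norm_num
      have h6 : 0 ≤ 64 / (L : ℝ) := by positivity
      linarith
    · have hρ : 1 ≤ L / 2 := by omega
      have hz' : sn z + ((L / 2 : ℕ) : ℤ) ≤ L := by push_cast; omega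
      have := grad_E (h := uu L (2 * L)) hρ (M := 3) z (by
        intro w hw
        apply uu_Lp0 hle
        have := sn_add_le z (w - z)
        simp only [add_sub_cancel] at this
        omega) (by
        intro w _
        rw [abs_of_nonneg (b0 w)]; exact b3 w) he
      refine this.trans ?_
      have h16 : L ≤ 4 * (L / 2) := by omega
      have h16' : (L : ℝ) ≤ 4 * ((L / 2 : ℕ) : ℝ) := by exact_mod_cast h16
      have hpos : (0 : ℝ) < ((L / 2 : ℕ) : ℝ) := by exact_mod_cast hρ
      rw [div_le_div_iff₀ hpos (by linarith)]
      linarith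

lemma uu_grad {a : ℕ} (ha : 1 ≤ a) {e : Z2} (he : E2 e) (z : Z2) (k : ℕ) :
    |uu a (2 ^ k * a) (z + e) - uu a (2 ^ k * a) z| ≤ 800 / a * (1 - (1 / 2) ^ k) := by
  have hap : (0 : ℝ) < a := by exact_mod_cast ha
  induction k with
  | zero => simp [uu]
  | succ k ih =>
    have h1 := uu2_grad (L := 2 ^ k * a) (Nat.one_le_iff_ne_zero.2 (by positivity)) he z
    have e1 : ∀ w, uu a (2 ^ (k + 1) * a) w = uu a (2 ^ k * a) w + uu (2 ^ k * a) (2 * (2 ^ k * a)) w := by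
      intro w
      unfold uu
      rw [show 2 ^ (k + 1) * a = 2 * (2 ^ k * a) by ring]; ring
    rw [e1, e1]
    have e2 : 800 / (a : ℝ) * (1 - (1 / 2) ^ (k + 1)) =
        800 / a * (1 - (1 / 2) ^ k) + 400 / ((2 ^ k * a : ℕ) : ℝ) := by
      push_cast
      rw [div_pow, div_pow]
      field_simp
      ring
    rw [e2, show ∀ p q r s : ℝ, p + q - (r + s) = (p - r) + (q - s) by intros; ring]
    exact (abs_add_le _ _).trans (add_le_add ih h1)

lemma uu_grad' {a : ℕ} (ha : 1 ≤ a) {e : Z2} (he : E2 e) (z : Z2) (k : ℕ) :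
    |uu a (2 ^ k * a) (z + e) - uu a (2 ^ k * a) z| ≤ 800 / a := by
  have hap : (0 : ℝ) < a := by exact_mod_cast ha
  refine (uu_grad ha he z k).trans ?_
  have h1 : (0 : ℝ) ≤ (1 / 2) ^ k := by positivity
  have h2 : (0 : ℝ) ≤ 800 / a := by positivity
  nlinarith

lemma lip_dir {f : Z2 → ℝ} {G : ℝ} {e : Z2} (h : ∀ z, |f (z + e) - f z| ≤ G) (z : Z2) (m : ℕ) :
    |f (z + m • e) - f z| ≤ m * G := by
  induction m with
  | zero => simp
  | succ m ih =>
    have := h (z + m • e)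
    rw [succ_nsmul, ← add_assoc]
    have e1 : f (z + m • e + e) - f z = (f (z + m • e + e) - f (z + m • e)) + (f (z + m • e) - f z) := by ring
    rw [e1]
    refine (abs_add_le _ _).trans ?_
    push_cast
    linarith

lemma uu_lip {a : ℕ} (ha : 1 ≤ a) (z : Z2) (k m n : ℕ) :
    |uu a (2 ^ k * a) (z + ((m : ℤ), (n : ℤ))) - uu a (2 ^ k * a) z| ≤ (m + n) * (800 / a) := by
  have h1 := lip_dir (fun z => uu_grad' ha (Or.inl rfl : E2 (1, 0)) z k) z m
  have h2 := lip_dir (fun z => uu_grad' ha (Or.inr rfl : E2 (0, 1)) z k) (z + m • (1, 0)) n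
  have e0 : z + m • ((1, 0) : Z2) + n • ((0, 1) : Z2) = z + ((m : ℤ), (n : ℤ)) := by
    ext <;> simp
  rw [e0] at h2
  rw [abs_le] at *
  constructor <;> linarith

/-- variance of increments -/
lemma kap_inc {a : ℕ} (ha : 1 ≤ a) (x : Z2) (k m n : ℕ) :
    kap a (2 ^ k * a) x x - kap a (2 ^ k * a) x (x + ((m : ℤ), (n : ℤ))) -
      kap a (2 ^ k * a) (x + ((m : ℤ), (n : ℤ))) x +
      kap a (2 ^ k * a) (x + ((m : ℤ), (n : ℤ))) (x + ((m : ℤ), (n : ℤ))) ≤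
      4 * ((m + n) * (800 / a)) := by
  set y := x + ((m : ℤ), (n : ℤ)) with hy
  set A := 2 ^ k * a with hA
  set G : ℝ := (m + n) * (800 / a) with hG
  have hu : ∀ z, |uu a A (z + -x) - uu a A (z + -y)| ≤ G := by
    intro z
    have := uu_lip ha (z + -y) k m n
    rwa [show z + -y + ((m : ℤ), (n : ℤ)) = z + -x by rw [hy]; abel] at this
  have key : ∀ p : Z2, |kap a A p x - kap a A p y| ≤ 2 * G := by
    intro p
    have e1 : kap a A p x - kap a A p y =
        ip (fun z => mu a (z + -p)) (fun z => uu a A (z + -x) - uu a A (z + -y)) -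
        ip (fun z => mu A (z + -p)) (fun z => uu a A (z + -x) - uu a A (z + -y)) := by
      unfold kap
      rw [← ip_sub_left ((mu_FS a).shift _) ((mu_FS A).shift _)]
      rw [ip_comm, ip_comm _ (fun z => uu a A (z + -y)),
        ← ip_sub_left ((uu_FS a A).shift _) ((uu_FS a A).shift _), ip_comm]
    rw [e1]
    have a1 := mu_avg_le a (-p) _ G (fun z _ => (abs_le.1 (hu z)).2)
    have a2 := mu_avg_ge a (-p) _ (-G) (fun z _ => (abs_le.1 (hu z)).1)
    have a3 := mu_avg_le A (-p) _ G (fun z _ => (abs_le.1 (hu z)).2)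
    have a4 := mu_avg_ge A (-p) _ (-G) (fun z _ => (abs_le.1 (hu z)).1)
    rw [abs_le]; constructor <;> linarith
  have k1 := abs_le.1 (key x)
  have k2 := abs_le.1 (key y)
  linarith

end TP

namespace TP

variable {Ω : Type*} [MeasureSpace Ω]

lemma exp_int [IsProbabilityMeasure (ℙ : Measure Ω)] {Y : Ω → ℝ} {v : NNReal}
    (h : Measure.map Y (ℙ : Measure Ω) = gaussianReal 0 v) (t : ℝ) :
    Integrable (fun ω => Real.exp (t * Y ω)) (ℙ : Measure Ω) := by
  rw [← mgf_pos_iff, mgf_gaussianReal h]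
  exact Real.exp_pos _

lemma gauss_tail [IsProbabilityMeasure (ℙ : Measure Ω)] {Y : Ω → ℝ} {v : NNReal}
    (h : Measure.map Y (ℙ : Measure Ω) = gaussianReal 0 v) {V t : ℝ} (hV : 0 < V) (hv : (v : ℝ) ≤ V)
    (ht : 0 ≤ t) : (ℙ : Measure Ω) {ω | t ≤ Y ω} ≤ ENNReal.ofReal (Real.exp (-(t ^ 2 / (2 * V)))) := by
  have h1 := measure_ge_le_exp_mul_mgf (μ := (ℙ : Measure Ω)) (X := Y) (t := t / V) t (by positivity)
    (exp_int h _)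
  rw [mgf_gaussianReal h, ← Real.exp_add] at h1
  have h2 : (ℙ : Measure Ω).real {ω | t ≤ Y ω} ≤ Real.exp (-(t ^ 2 / (2 * V))) := by
    refine h1.trans (Real.exp_le_exp.2 ?_)
    have e1 : -(t ^ 2 / (2 * V)) = -(t / V) * t + (0 * (t / V) + V * (t / V) ^ 2 / 2) := by
      field_simp; ring
    rw [e1]
    have : (v : ℝ) * (t / V) ^ 2 ≤ V * (t / V) ^ 2 := by gcongr
    linarith
  rw [← ENNReal.ofReal_toReal (measure_ne_top (ℙ : Measure Ω) {ω | t ≤ Y ω})]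
  exact ENNReal.ofReal_le_ofReal h2

lemma inc_tail [IsProbabilityMeasure (ℙ : Measure Ω)] {X : Z2 → Ω → ℝ} {κ : Z2 → Z2 → ℝ}
    (hX : GDom X κ) {x y : Z2} {V t : ℝ} (hV : 0 < V)
    (hv : κ x x - κ x y - κ y x + κ y y ≤ V) (ht : 0 ≤ t) :
    (ℙ : Measure Ω) {ω | t ≤ X y ω - X x ω} ≤ ENNReal.ofReal (Real.exp (-(t ^ 2 / (2 * V)))) := by
  obtain ⟨v, h1, h2⟩ := hX 2 ![-1, 1] ![x, y]
  simp only [Fin.sum_univ_two, Matrix.cons_val_zero, Matrix.cons_val_one] at h1 h2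
  have e1 : (fun ω => X y ω - X x ω) = fun ω => -1 * X x ω + 1 * X y ω := by funext ω; ring
  rw [← e1] at h1
  exact gauss_tail h1 hV (by linarith) ht

lemma exp_conv {w s : ℝ} (hw0 : 0 ≤ w) (hw1 : w ≤ 1) : Real.exp (s * w) ≤ 1 + w * Real.exp s := by
  have := convexOn_exp.2 (Set.mem_univ 0) (Set.mem_univ s) (by linarith : 0 ≤ 1 - w) hw0 (by ring)
  simp at this
  rw [mul_comm s w]
  linarith

lemma main_term [IsProbabilityMeasure (ℙ : Measure Ω)] {X : Z2 → Ω → ℝ} {κ : Z2 → Z2 → ℝ}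
    (hX : GDom X κ) {n : ℕ} {τ : Type} [Fintype τ] [Nonempty τ] (p : Fin n → τ → Z2)
    (b : Fin n → Fin n → ℝ) (hb : ∀ β β' t t', κ (p β t) (p β' t') ≤ b β β') (hb0 : ∀ β β', 0 ≤ b β β')
    {V T m : ℝ} (hV : 0 < V) (hbV : ∑ β, ∑ β', b β β' ≤ V) (hT : 0 ≤ T) (hm : 0 ≤ m) :
    (ℙ : Measure Ω) {ω | m * Fintype.card τ ≤
      (Nat.card {q : Fin n × τ // T ≤ X (p q.1 q.2) ω} : ℝ)} ≤
      ENNReal.ofReal (2 ^ n * Real.exp (-(T ^ 2 * m ^ 2 / (2 * V)))) := by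
  classical
  set c0 : ℝ := (Fintype.card τ : ℝ) with hc0
  have hcp : 0 < c0 := by rw [hc0]; exact_mod_cast Fintype.card_pos
  set lam : ℝ := T * m / V with hlam
  have hlam0 : 0 ≤ lam := by positivity
  set g : Fin n → Option τ → Ω → ℝ := fun β o ω =>
    o.elim 1 (fun t => (1 / c0) * Real.exp (lam * X (p β t) ω)) with hg
  set Z : Ω → ℝ := fun ω => ∏ β, ∑ o, g β o ω with hZ
  set wt : Option τ → ℝ := fun o => o.elim 1 (fun _ => 1 / c0) with hwt
  have hwt0 : ∀ o, 0 ≤ wt o := by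
    intro o; cases o <;> simp [hwt]; positivity
  set cc : (Fin n → Option τ) → Fin n → ℝ := fun f β => (f β).elim 0 (fun _ => 1) with hcc
  set pt : (Fin n → Option τ) → Fin n → Z2 := fun f β => (f β).elim 0 (p β) with hpt
  have hcc01 : ∀ f β, cc f β = 0 ∨ cc f β = 1 := by
    intro f β
    simp only [hcc]
    cases f β <;> simp
  have hprod : ∀ f ω, ∏ β, g β (f β) ω =
      (∏ β, wt (f β)) * Real.exp (lam * ∑ β, cc f β * X (pt f β) ω) := by
    intro f ω
    rw [Finset.mul_sum, Real.exp_sum, ← Finset.prod_mul_distrib]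
    apply Finset.prod_congr rfl
    intro β _
    simp only [hg, hwt, hcc, hpt]
    cases f β <;> simp
  have hZs : ∀ ω, Z ω = ∑ f : Fin n → Option τ, ∏ β, g β (f β) ω := by
    intro ω
    simp only [hZ]
    rw [Finset.prod_univ_sum, Fintype.piFinset_univ]
  have hf : ∀ f : Fin n → Option τ, Integrable (fun ω => ∏ β, g β (f β) ω) (ℙ : Measure Ω) ∧
      ∫ ω, ∏ β, g β (f β) ω ≤ (∏ β, wt (f β)) * Real.exp (lam ^ 2 * V / 2) := by
    intro f
    obtain ⟨v, h1, h2⟩ := hX n (cc f) (pt f)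
    have hvV : (v : ℝ) ≤ V := by
      refine h2.trans (le_trans ?_ hbV)
      apply Finset.sum_le_sum; intro β _
      apply Finset.sum_le_sum; intro β' _
      simp only [hcc, hpt]
      cases h : f β <;> cases h' : f β' <;> simp [hb0, hb]
    simp only [hprod]
    refine ⟨(exp_int h1 lam).const_mul _, ?_⟩
    rw [integral_const_mul]
    apply mul_le_mul_of_nonneg_left _ (Finset.prod_nonneg fun β _ => hwt0 _)
    have := mgf_gaussianReal h1 lam
    unfold mgf at this
    rw [this]
    apply Real.exp_le_exp.2
    have : (v : ℝ) * lam ^ 2 ≤ V * lam ^ 2 := by gcongr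
    linarith
  have hZint : Integrable Z (ℙ : Measure Ω) := by
    rw [show Z = fun ω => ∑ f : Fin n → Option τ, ∏ β, g β (f β) ω from funext hZs]
    exact integrable_finsetSum _ (fun f _ => (hf f).1)
  have hZE : ∫ ω, Z ω ≤ 2 ^ n * Real.exp (lam ^ 2 * V / 2) := by
    simp only [hZs]
    rw [integral_finsetSum _ (fun f _ => (hf f).1)]
    refine (Finset.sum_le_sum (fun f _ => (hf f).2)).trans ?_
    rw [← Finset.sum_mul]
    have : ∑ f : Fin n → Option τ, ∏ β, wt (f β) = 2 ^ n := by
      rw [← Fintype.piFinset_univ, ← Finset.prod_univ_sum (fun _ => Finset.univ) (fun _ o => wt o)]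
      rw [Fintype.sum_option]
      simp only [hwt, Option.elim, Finset.sum_const, Finset.card_univ, nsmul_eq_mul, Finset.prod_const,
        Fintype.card_fin]
      rw [← hc0, mul_one_div_cancel hcp.ne']; norm_num
    rw [this]
  have hg0 : ∀ β o ω, 0 ≤ g β o ω := by
    intro β o ω; simp only [hg]; cases o <;> simp; positivity
  have hZ0 : ∀ ω, 0 ≤ Z ω := fun ω => Finset.prod_nonneg fun β _ => Finset.sum_nonneg fun o _ => hg0 _ _ _
  have hsub : {ω | m * c0 ≤ (Nat.card {q : Fin n × τ // T ≤ X (p q.1 q.2) ω} : ℝ)} ⊆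
      {ω | Real.exp (lam * T * m) ≤ Z ω} := by
    intro ω hω
    simp only [Set.mem_ofPred_eq] at hω ⊢
    set w : Fin n → ℝ := fun β => ∑ t : τ, if T ≤ X (p β t) ω then 1 / c0 else 0 with hw
    have hw0 : ∀ β, 0 ≤ w β := fun β => Finset.sum_nonneg fun t _ => by split_ifs <;> positivity
    have hw1 : ∀ β, w β ≤ 1 := by
      intro β
      have : w β ≤ ∑ t : τ, 1 / c0 := Finset.sum_le_sum fun t _ => by
        split_ifs
        · exact le_refl _
        · positivity
      rwa [Finset.sum_const, Finset.card_univ, nsmul_eq_mul, ← hc0, mul_one_div_cancel hcp.ne'] at this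
    have hsum : m ≤ ∑ β, w β := by
      have e1 : (Nat.card {q : Fin n × τ // T ≤ X (p q.1 q.2) ω} : ℝ) = c0 * ∑ β, w β := by
        rw [Nat.card_eq_fintype_card, Fintype.card_subtype, Finset.card_filter]
        push_cast
        rw [Fintype.sum_prod_type, Finset.mul_sum]
        apply Finset.sum_congr rfl; intro β _
        rw [hw, Finset.mul_sum]
        apply Finset.sum_congr rfl; intro t _
        split_ifs
        · rw [mul_one_div_cancel hcp.ne']
        · simp
      rw [e1, mul_comm] at hω
      exact le_of_mul_le_mul_left hω hcp
    calc Real.exp (lam * T * m) ≤ Real.exp (lam * T * ∑ β, w β) := by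
            apply Real.exp_le_exp.2
            exact mul_le_mul_of_nonneg_left hsum (by positivity)
      _ = ∏ β, Real.exp (lam * T * w β) := by rw [Finset.mul_sum, Real.exp_sum]
      _ ≤ Z ω := by
        apply Finset.prod_le_prod (fun β _ => (Real.exp_pos _).le)
        intro β _
        refine (exp_conv (hw0 β) (hw1 β)).trans ?_
        rw [Fintype.sum_option]
        simp only [hg, Option.elim]
        apply add_le_add le_rfl
        rw [hw, Finset.sum_mul]
        apply Finset.sum_le_sum
        intro t _
        split_ifs with h
        · gcongr
        · rw [zero_mul]; positivity
  refine (measure_mono hsub).trans ?_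
  have hmk := mul_meas_ge_le_integral_of_nonneg (μ := (ℙ : Measure Ω))
    (Filter.Eventually.of_forall hZ0) hZint (Real.exp (lam * T * m))
  rw [← ENNReal.ofReal_toReal (measure_ne_top (ℙ : Measure Ω) {ω | Real.exp (lam * T * m) ≤ Z ω})]
  apply ENNReal.ofReal_le_ofReal
  have h3 : Real.exp (lam * T * m) * ((ℙ : Measure Ω) {ω | Real.exp (lam * T * m) ≤ Z ω}).toReal ≤
      2 ^ n * Real.exp (lam ^ 2 * V / 2) := hmk.trans hZE
  rw [← le_div_iff₀' (Real.exp_pos _), mul_div_assoc, ← Real.exp_sub] at h3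
  refine h3.trans (le_of_eq ?_)
  congr 2
  rw [hlam]; field_simp; ring

end TP

namespace TP

lemma geom_tl (p : ℕ) : ∑ l ∈ Finset.range p, (3 / 4 : ℝ) ^ l / 4 ≤ 1 := by
  have : ∑ l ∈ Finset.range p, (3 / 4 : ℝ) ^ l / 4 = 1 - (3 / 4 : ℝ) ^ p := by
    induction p with
    | zero => simp
    | succ p ih => rw [Finset.sum_range_succ, ih, pow_succ]; ring
  rw [this]
  have : (0 : ℝ) ≤ (3 / 4 : ℝ) ^ p := by positivity
  linarith

lemma geom_half (p : ℕ) : ∑ l ∈ Finset.range p, (1 / 2 : ℝ) ^ l ≤ 2 := by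
  have : ∑ l ∈ Finset.range p, (1 / 2 : ℝ) ^ l = 2 - 2 * (1 / 2 : ℝ) ^ p := by
    induction p with
    | zero => simp
    | succ p ih => rw [Finset.sum_range_succ, ih, pow_succ]; ring
  rw [this]
  have : (0 : ℝ) ≤ (1 / 2 : ℝ) ^ p := by positivity
  linarith

lemma series_bd {b : ℝ} (hb : 17 ≤ b) (p : ℕ) :
    ∑ l ∈ Finset.range p, (4 : ℝ) ^ (l + 1) * Real.exp (-(b * (9 / 8) ^ l)) ≤ 8 * Real.exp (-b) := by
  have h8 : 4 * Real.exp (-(17 / 8 : ℝ)) ≤ 1 / 2 := by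
    have h1 : (8 : ℝ) ≤ Real.exp (17 / 8) := by
      have h2 : (2.7 : ℝ) ≤ Real.exp 1 := by linarith [Real.exp_one_gt_d9]
      have h3 : Real.exp (17 / 8 : ℝ) = Real.exp 1 * Real.exp 1 * Real.exp (1 / 8) := by
        rw [← Real.exp_add, ← Real.exp_add]; norm_num
      have h4 : (1 / 8 + 1 : ℝ) ≤ Real.exp (1 / 8) := Real.add_one_le_exp _
      rw [h3]
      nlinarith [mul_le_mul h2 h2 (by norm_num) (by positivity)]
    rw [Real.exp_neg]
    have : (Real.exp (17 / 8))⁻¹ ≤ (8 : ℝ)⁻¹ := inv_anti₀ (by norm_num) h1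
    linarith
  have key : ∀ l ∈ Finset.range p, (4 : ℝ) ^ (l + 1) * Real.exp (-(b * (9 / 8) ^ l)) ≤
      4 * Real.exp (-b) * (1 / 2 : ℝ) ^ l := by
    intro l _
    have h1 : 1 + (l : ℝ) * (1 / 8) ≤ (9 / 8 : ℝ) ^ l := by
      have := one_add_mul_le_pow (by norm_num : (-2 : ℝ) ≤ 1 / 8) l
      rwa [show (1 : ℝ) + 1 / 8 = 9 / 8 by norm_num] at this
    have h2 : Real.exp (-(b * (9 / 8) ^ l)) ≤ Real.exp (-b) * Real.exp (-(17 / 8 : ℝ)) ^ l := by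
      rw [← Real.exp_nat_mul, ← Real.exp_add]
      apply Real.exp_le_exp.2
      have hl : (0 : ℝ) ≤ l := by positivity
      nlinarith [mul_nonneg hl (by linarith : 0 ≤ b - 17)]
    calc (4 : ℝ) ^ (l + 1) * Real.exp (-(b * (9 / 8) ^ l))
        ≤ (4 : ℝ) ^ (l + 1) * (Real.exp (-b) * Real.exp (-(17 / 8 : ℝ)) ^ l) := by gcongr
      _ = 4 * Real.exp (-b) * (4 * Real.exp (-(17 / 8 : ℝ))) ^ l := by rw [mul_pow]; ring
      _ ≤ 4 * Real.exp (-b) * (1 / 2 : ℝ) ^ l := by gcongr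
  refine (Finset.sum_le_sum key).trans ?_
  rw [← Finset.mul_sum]
  have := geom_half p
  have h0 := Real.exp_pos (-b)
  nlinarith

lemma osc_term {Ω : Type*} [MeasureSpace Ω] [IsProbabilityMeasure (ℙ : Measure Ω)] {X : Z2 → Ω → ℝ}
    {a k p : ℕ} (hX : 1 ≤ p → GDom X (kap a (2 ^ k * a))) (ha : 1 ≤ p → 2 * a = 2 ^ p) (c : Z2) {T : ℝ}
    (hT : 0 < T) (hTb : 17 ≤ T ^ 2 / 204800) :
    (ℙ : Measure Ω) {ω | ∃ w1 w2 : ℕ, w1 < 2 ^ p ∧ w2 < 2 ^ p ∧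
      T ≤ X (c + ((w1 : ℤ), (w2 : ℤ))) ω - X c ω} ≤
      ENNReal.ofReal (8 * Real.exp (-(T ^ 2 / 204800))) := by
  set E : ℕ → ℕ × ℕ → Set Ω := fun l i =>
    {ω | T * ((3 / 4 : ℝ) ^ l / 4) ≤ X (c + (((i.1 * 2 ^ (p - l - 1) : ℕ) : ℤ), ((i.2 * 2 ^ (p - l - 1) : ℕ) : ℤ))) ω -
      X (c + (((i.1 / 2 * 2 ^ (p - l) : ℕ) : ℤ), ((i.2 / 2 * 2 ^ (p - l) : ℕ) : ℤ))) ω} with hE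
  have hsub : {ω | ∃ w1 w2 : ℕ, w1 < 2 ^ p ∧ w2 < 2 ^ p ∧
      T ≤ X (c + ((w1 : ℤ), (w2 : ℤ))) ω - X c ω} ⊆
      ⋃ l ∈ Finset.range p, ⋃ i ∈ Finset.range (2 ^ (l + 1)) ×ˢ Finset.range (2 ^ (l + 1)), E l i := by
    rintro ω ⟨w1, w2, h1, h2, hω⟩
    by_contra hc
    simp only [Set.mem_iUnion, not_exists] at hc
    set f : ℕ → ℝ := fun l => X (c + (((w1 / 2 ^ (p - l) * 2 ^ (p - l) : ℕ) : ℤ),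
      ((w2 / 2 ^ (p - l) * 2 ^ (p - l) : ℕ) : ℤ))) ω with hf
    have hfp : f p = X (c + ((w1 : ℤ), (w2 : ℤ))) ω := by simp [hf]
    have hf0 : f 0 = X c ω := by
      simp only [hf, Nat.sub_zero, Nat.div_eq_of_lt h1, Nat.div_eq_of_lt h2]
      have : c + (((0 * 2 ^ p : ℕ) : ℤ), ((0 * 2 ^ p : ℕ) : ℤ)) = c := by ext <;> simp
      rw [this]
    have hstep : ∀ l ∈ Finset.range p, f (l + 1) - f l < T * ((3 / 4 : ℝ) ^ l / 4) := by
      intro l hl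
      have hlp := Finset.mem_range.1 hl
      have hpow : 2 ^ (p - l) = 2 ^ (p - l - 1) * 2 := by rw [← pow_succ]; congr 1; omega
      have hp2 : 2 ^ p = 2 ^ (p - l - 1) * 2 ^ (l + 1) := by rw [← pow_add]; congr 1; omega
      have := hc l hl (w1 / 2 ^ (p - l - 1), w2 / 2 ^ (p - l - 1)) (by
        rw [Finset.mem_product, Finset.mem_range, Finset.mem_range]
        constructor
        · exact Nat.div_lt_of_lt_mul (by rw [← hp2]; exact h1)
        · exact Nat.div_lt_of_lt_mul (by rw [← hp2]; exact h2))
      simp only [hE, Set.mem_ofPred_eq, not_le, Nat.div_div_eq_div_mul, ← hpow] at this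
      simpa only [hf, ← Nat.sub_sub] using this
    have htel := Finset.sum_range_sub f p
    rw [hfp, hf0] at htel
    rcases Nat.eq_zero_or_pos p with hp0 | hp0
    · subst hp0
      simp at htel
      linarith
    · have hlt : ∑ l ∈ Finset.range p, (f (l + 1) - f l) <
          ∑ l ∈ Finset.range p, T * ((3 / 4 : ℝ) ^ l / 4) :=
        Finset.sum_lt_sum_of_nonempty ⟨0, Finset.mem_range.2 hp0⟩ hstep
      rw [← Finset.mul_sum, htel] at hlt
      have := geom_tl p
      nlinarith
  have hprob : ∀ l ∈ Finset.range p, ∀ i : ℕ × ℕ, (ℙ : Measure Ω) (E l i) ≤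
      ENNReal.ofReal (Real.exp (-(T ^ 2 / 204800 * (9 / 8) ^ l))) := by
    intro l hl i
    have hlp := Finset.mem_range.1 hl
    have hpow : 2 ^ (p - l) = 2 * 2 ^ (p - l - 1) := by rw [← pow_succ']; congr 1; omega
    have h2a := ha (by omega)
    have ha1 : 1 ≤ a := by
      have : 0 < 2 ^ p := by positivity
      omega
    have ht0 : 0 ≤ T * ((3 / 4 : ℝ) ^ l / 4) := by positivity
    have hVp : (0 : ℝ) < 6400 * (1 / 2) ^ l := by positivity
    refine (inc_tail (hX (by omega)) (V := 6400 * (1 / 2) ^ l) hVp ?_ ht0).trans ?_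
    · have hk := kap_inc ha1 (c + (((i.1 / 2 * 2 ^ (p - l) : ℕ) : ℤ), ((i.2 / 2 * 2 ^ (p - l) : ℕ) : ℤ)))
        k (i.1 % 2 * 2 ^ (p - l - 1)) (i.2 % 2 * 2 ^ (p - l - 1))
      have e0 : ∀ q : ℕ, q / 2 * 2 ^ (p - l) + q % 2 * 2 ^ (p - l - 1) = q * 2 ^ (p - l - 1) := by
        intro q
        rw [hpow]
        nth_rewrite 3 [← Nat.div_add_mod q 2]
        ring
      have e1 : c + (((i.1 / 2 * 2 ^ (p - l) : ℕ) : ℤ), ((i.2 / 2 * 2 ^ (p - l) : ℕ) : ℤ)) +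
          (((i.1 % 2 * 2 ^ (p - l - 1) : ℕ) : ℤ), ((i.2 % 2 * 2 ^ (p - l - 1) : ℕ) : ℤ)) =
          c + (((i.1 * 2 ^ (p - l - 1) : ℕ) : ℤ), ((i.2 * 2 ^ (p - l - 1) : ℕ) : ℤ)) := by
        rw [add_assoc]
        congr 1
        rw [Prod.mk_add_mk, ← Nat.cast_add, ← Nat.cast_add, e0, e0]
      rw [e1] at hk
      refine hk.trans ?_
      have m1 : ((i.1 % 2 * 2 ^ (p - l - 1) : ℕ) : ℝ) ≤ 2 ^ (p - l - 1) := by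
        have : i.1 % 2 * 2 ^ (p - l - 1) ≤ 1 * 2 ^ (p - l - 1) := Nat.mul_le_mul_right _ (by omega)
        rw [one_mul] at this
        exact_mod_cast this
      have m2 : ((i.2 % 2 * 2 ^ (p - l - 1) : ℕ) : ℝ) ≤ 2 ^ (p - l - 1) := by
        have : i.2 % 2 * 2 ^ (p - l - 1) ≤ 1 * 2 ^ (p - l - 1) := Nat.mul_le_mul_right _ (by omega)
        rw [one_mul] at this
        exact_mod_cast this
      have hap : (0 : ℝ) < a := by exact_mod_cast ha1
      have h2a' : 2 * (a : ℝ) = 2 ^ p := by exact_mod_cast h2a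
      have hp3 : (2 : ℝ) ^ p = 2 ^ (p - l - 1) * 2 * 2 ^ l := by
        rw [← pow_succ, ← pow_add]; congr 1; omega
      have haa : (a : ℝ) = 2 ^ (p - l - 1) * 2 ^ l := by
        have : 2 * (a : ℝ) = 2 * (2 ^ (p - l - 1) * 2 ^ l) := by rw [h2a', hp3]; ring
        linarith
      have e2 : (6400 : ℝ) * (1 / 2) ^ l = 4 * ((2 ^ (p - l - 1) + 2 ^ (p - l - 1)) * (800 / a)) := by
        rw [haa, div_pow]
        field_simp
        norm_num
      rw [e2]
      gcongr
    · apply ENNReal.ofReal_le_ofReal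
      apply Real.exp_le_exp.2
      apply le_of_eq
      have : (9 / 8 : ℝ) ^ l = ((3 / 4) ^ l) ^ 2 / (1 / 2) ^ l := by
        rw [← pow_mul, mul_comm l 2, pow_mul, ← div_pow]; norm_num
      rw [this]
      field_simp
      norm_num
  refine (measure_mono hsub).trans ?_
  refine (measure_biUnion_finset_le _ _).trans ?_
  have hl : ∀ l ∈ Finset.range p,
      (ℙ : Measure Ω) (⋃ i ∈ Finset.range (2 ^ (l + 1)) ×ˢ Finset.range (2 ^ (l + 1)), E l i) ≤
      ENNReal.ofReal ((4 : ℝ) ^ (l + 1) * Real.exp (-(T ^ 2 / 204800 * (9 / 8) ^ l))) := by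
    intro l hl
    refine (measure_biUnion_finset_le _ _).trans ?_
    refine (Finset.sum_le_sum (fun i _ => hprob l hl i)).trans ?_
    rw [Finset.sum_const, Finset.card_product, Finset.card_range, nsmul_eq_mul,
      ENNReal.ofReal_mul (by positivity)]
    apply le_of_eq
    congr 1
    rw [← mul_pow, ENNReal.ofReal_pow (by norm_num)]
    norm_num
  refine (Finset.sum_le_sum hl).trans ?_
  rw [← ENNReal.ofReal_sum_of_nonneg (fun l _ => by positivity)]
  exact ENNReal.ofReal_le_ofReal (series_bd hTb p)

end TP

namespace TP

lemma sum_inv_sqrt (n : ℕ) : ∑ d ∈ Finset.range n, 1 / √((d : ℝ) + 1) ≤ 2 * √n := by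
  induction n with
  | zero => simp
  | succ n ih =>
    rw [Finset.sum_range_succ]
    push_cast
    have h1 : 0 ≤ √(n : ℝ) := Real.sqrt_nonneg _
    have h2 : 0 < √((n : ℝ) + 1) := Real.sqrt_pos.2 (by positivity)
    have h3 : √(n : ℝ) ^ 2 = n := Real.sq_sqrt (by positivity)
    have h4 : √((n : ℝ) + 1) ^ 2 = n + 1 := Real.sq_sqrt (by positivity)
    have : 1 / √((n : ℝ) + 1) ≤ 2 * √((n : ℝ) + 1) - 2 * √(n : ℝ) := by
      rw [div_le_iff₀ h2]
      nlinarith [sq_nonneg (√((n : ℝ) + 1) - √(n : ℝ))]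
    linarith

lemma sum_dist {n : ℕ} (F : ℕ → ℝ) (hF : ∀ d, 0 ≤ F d) (β : Fin n) :
    ∑ β' : Fin n, F (Nat.dist β β') ≤ 2 * ∑ d ∈ Finset.range n, F d := by
  classical
  rw [← Finset.sum_filter_add_sum_filter_not Finset.univ (fun β' : Fin n => β' ≤ β), two_mul]
  apply add_le_add
  · rw [← Finset.sum_image (g := fun β' : Fin n => Nat.dist β β')]
    · apply Finset.sum_le_sum_of_subset_of_nonneg
      · intro d hd
        obtain ⟨β', h1, rfl⟩ := Finset.mem_image.1 hd
        simp only [Finset.mem_filter, Finset.mem_univ, true_and, Fin.le_def] at h1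
        rw [Finset.mem_range]
        unfold Nat.dist
        omega
      · intro d _ _; exact hF d
    · intro x hx y hy hxy
      simp only [Finset.coe_filter, Finset.mem_univ, true_and, Set.mem_ofPred_eq, Fin.le_def] at hx hy
      change Nat.dist β x = Nat.dist β y at hxy
      unfold Nat.dist at hxy
      apply Fin.ext
      omega
  · rw [← Finset.sum_image (g := fun β' : Fin n => Nat.dist β β')]
    · apply Finset.sum_le_sum_of_subset_of_nonneg
      · intro d hd
        obtain ⟨β', h1, rfl⟩ := Finset.mem_image.1 hd
        simp only [Finset.mem_filter, Finset.mem_univ, true_and, Fin.le_def] at h1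
        rw [Finset.mem_range]
        unfold Nat.dist
        omega
      · intro d _ _; exact hF d
    · intro x hx y hy hxy
      simp only [Finset.coe_filter, Finset.mem_univ, true_and, Set.mem_ofPred_eq, Fin.le_def] at hx hy
      change Nat.dist β x = Nat.dist β y at hxy
      unfold Nat.dist at hxy
      apply Fin.ext
      omega

/-- block weight -/
noncomputable def FF (k d : ℕ) : ℝ := (if d ≤ 1 then 3 * (k : ℝ) else 0) + 11 * (√k * (1 / √((d : ℝ) + 1)))

lemma FF_nonneg (k d : ℕ) : 0 ≤ FF k d := by
  unfold FF; split_ifs <;> positivity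

lemma FF_sum (k : ℕ) : ∑ β : Fin k, ∑ β' : Fin k, FF k (Nat.dist β β') ≤ 56 * (k : ℝ) ^ 2 := by
  have h1 : ∑ d ∈ Finset.range k, FF k d ≤ 28 * k := by
    unfold FF
    rw [Finset.sum_add_distrib, ← Finset.mul_sum, ← Finset.mul_sum]
    have h2 := sum_inv_sqrt k
    have h3 : √(k : ℝ) * √(k : ℝ) = k := Real.mul_self_sqrt (by positivity)
    have h4 : √(k : ℝ) * ∑ d ∈ Finset.range k, 1 / √((d : ℝ) + 1) ≤ 2 * k := by
      calc _ ≤ √(k : ℝ) * (2 * √k) := mul_le_mul_of_nonneg_left h2 (Real.sqrt_nonneg _)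
        _ = 2 * k := by linear_combination 2 * h3
    have h5 : ∑ d ∈ Finset.range k, (if d ≤ 1 then 3 * (k : ℝ) else 0) ≤ 6 * k := by
      rw [← Finset.sum_filter, Finset.sum_const, nsmul_eq_mul]
      have : ((Finset.range k).filter (fun d => d ≤ 1)).card ≤ (Finset.range 2).card :=
        Finset.card_le_card (by
          intro d hd
          simp only [Finset.mem_filter, Finset.mem_range] at hd ⊢
          omega)
      rw [Finset.card_range] at this
      have h6 : ((((Finset.range k).filter (fun d => d ≤ 1)).card : ℕ) : ℝ) ≤ 2 := by exact_mod_cast this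
      have hk : (0 : ℝ) ≤ k := by positivity
      nlinarith
    linarith
  have h2 : ∀ β : Fin k, ∑ β' : Fin k, FF k (Nat.dist β β') ≤ 56 * k := by
    intro β
    have := sum_dist (FF k) (FF_nonneg k) β
    linarith
  refine (Finset.sum_le_sum (fun β _ => h2 β)).trans ?_
  rw [Finset.sum_const, Finset.card_univ, Fintype.card_fin, nsmul_eq_mul]
  apply le_of_eq; ring

/-- station index -/
noncomputable def stn (K : ℝ) (u v : ℝ × ℝ) (i : ℕ) : Z2 :=
  (⌊u.1 + i / K * v.1⌋, ⌊u.2 + i / K * v.2⌋)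

/-- the box index of the tube -/
noncomputable def tub (K : ℝ) (q : ℕ) (u v : ℝ × ℝ) {n : ℕ} (β : Fin n) (t : Fin q × (Fin 27 × Fin 27)) : Z2 :=
  stn K u v (β * q + t.1) + (((t.2.1 : ℕ) : ℤ) - 13, ((t.2.2 : ℕ) : ℤ) - 13)

lemma fl_sep {x y D : ℝ} {o o' : Fin 27} (h : D ≤ |x - y|) :
    D - 27 ≤ |((⌊x⌋ + (((o : ℕ) : ℤ) - 13) - (⌊y⌋ + (((o' : ℕ) : ℤ) - 13)) : ℤ) : ℝ)| := by
  have hx1 := Int.floor_le x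
  have hx2 := Int.lt_floor_add_one x
  have hy1 := Int.floor_le y
  have hy2 := Int.lt_floor_add_one y
  have ho : ((o : ℕ) : ℝ) ≤ 26 := by exact_mod_cast (by omega : (o : ℕ) ≤ 26)
  have ho' : ((o' : ℕ) : ℝ) ≤ 26 := by exact_mod_cast (by omega : (o' : ℕ) ≤ 26)
  have ho0 : (0 : ℝ) ≤ ((o : ℕ) : ℝ) := by positivity
  have ho0' : (0 : ℝ) ≤ ((o' : ℕ) : ℝ) := by positivity
  push_cast
  rcases le_abs.1 h with h | h
  · refine le_trans ?_ (le_abs_self _)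
    linarith
  · refine le_trans ?_ (neg_le_abs _)
    linarith

lemma tub_sep {k : ℕ} {K : ℝ} {q : ℕ} {u v : ℝ × ℝ} (hk : 0 < k) (hKp : 0 < K) (hq : K / k ≤ q)
    (hv : K / 2 ≤ |v.1| ∨ K / 2 ≤ |v.2|) {β β' : Fin k} (t t' : Fin q × (Fin 27 × Fin 27)) {D : ℕ}
    (hD : Nat.dist β β' = D + 1) :
    D * K / (2 * k) - 27 ≤ ((sn (tub K q u v β t - tub K q u v β' t') : ℤ) : ℝ) := by
  have hkp : (0 : ℝ) < k := by exact_mod_cast hk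
  have hi : (D : ℝ) * q ≤ |((β * q + t.1 : ℕ) : ℝ) - ((β' * q + t'.1 : ℕ) : ℝ)| := by
    have h1 := t.1.2
    have h2 := t'.1.2
    unfold Nat.dist at hD
    have hqp : 0 < q := lt_of_le_of_lt (Nat.zero_le _) h1
    rcases le_total (β : ℕ) (β' : ℕ) with h | h
    · have e1 : (β' : ℕ) = β + (D + 1) := by omega
      have e2 : β * q + t.1 + D * q ≤ β' * q + t'.1 := by
        rw [e1]
        have : (β + (D + 1)) * q = β * q + D * q + q := by ring
        omega
      have e3 : ((β * q + t.1 : ℕ) : ℝ) + D * q ≤ ((β' * q + t'.1 : ℕ) : ℝ) := by exact_mod_cast e2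
      rw [abs_sub_comm]
      exact le_trans (by linarith) (le_abs_self _)
    · have e1 : (β : ℕ) = β' + (D + 1) := by omega
      have e2 : β' * q + t'.1 + D * q ≤ β * q + t.1 := by
        rw [e1]
        have : (β' + (D + 1)) * q = β' * q + D * q + q := by ring
        omega
      have e3 : ((β' * q + t'.1 : ℕ) : ℝ) + D * q ≤ ((β * q + t.1 : ℕ) : ℝ) := by exact_mod_cast e2
      exact le_trans (by linarith) (le_abs_self _)
  have hDK : (D : ℝ) * (K / k) ≤ |((β * q + t.1 : ℕ) : ℝ) - ((β' * q + t'.1 : ℕ) : ℝ)| := by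
    refine le_trans ?_ hi
    gcongr
  have hx : ∀ c w : ℝ, K / 2 ≤ |w| → D * K / (2 * k) ≤
      |(c + ((β * q + t.1 : ℕ) : ℝ) / K * w) - (c + ((β' * q + t'.1 : ℕ) : ℝ) / K * w)| := by
    intro c w hw
    rw [show (c + ((β * q + t.1 : ℕ) : ℝ) / K * w) - (c + ((β' * q + t'.1 : ℕ) : ℝ) / K * w) =
      (((β * q + t.1 : ℕ) : ℝ) - ((β' * q + t'.1 : ℕ) : ℝ)) * w / K by ring, abs_div, abs_mul,
      abs_of_pos hKp, le_div_iff₀ hKp]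
    calc D * K / (2 * k) * K = (D * (K / k)) * (K / 2) := by field_simp
      _ ≤ _ := by gcongr
  rcases hv with hv | hv
  · refine (fl_sep (o := t.2.1) (o' := t'.2.1) (hx u.1 v.1 hv)).trans ?_
    have : |(tub K q u v β t - tub K q u v β' t').1| ≤ sn (tub K q u v β t - tub K q u v β' t') :=
      le_max_left _ _
    rw [← Int.cast_abs]
    exact_mod_cast this
  · refine (fl_sep (o := t.2.2) (o' := t'.2.2) (hx u.2 v.2 hv)).trans ?_
    have : |(tub K q u v β t - tub K q u v β' t').2| ≤ sn (tub K q u v β t - tub K q u v β' t') :=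
      le_max_right _ _
    rw [← Int.cast_abs]
    exact_mod_cast this

/-- scaling of a box index -/
def scl (r : ℕ) (z : Z2) : Z2 := ((r : ℤ) * z.1, (r : ℤ) * z.2)

lemma sn_scl (r : ℕ) (z w : Z2) : ((sn (scl r z - scl r w) : ℤ) : ℝ) = r * ((sn (z - w) : ℤ) : ℝ) := by
  have : sn (scl r z - scl r w) = r * sn (z - w) := by
    unfold sn scl
    simp only [Prod.fst_sub, Prod.snd_sub, ← mul_sub, abs_mul, Nat.abs_cast]
    rw [mul_max_of_nonneg _ _ (by positivity)]
  rw [this]; push_cast; ring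

lemma log_bd {x : ℝ} (hx : 1 ≤ x) : Real.log (8 * x ^ 2) / Real.log 2 ≤ 6 * √x := by
  have hl2 : (0.69 : ℝ) < Real.log 2 := by linarith [Real.log_two_gt_d9]
  have hs1 : 1 ≤ √x := by rw [Real.one_le_sqrt]; exact hx
  rw [div_le_iff₀ (by linarith)]
  have e1 : Real.log (8 * x ^ 2) = 3 * Real.log 2 + 4 * Real.log (√x) := by
    rw [Real.log_mul (by norm_num) (by positivity), Real.log_pow, show (8 : ℝ) = 2 ^ 3 by norm_num,
      Real.log_pow, Real.log_sqrt (by linarith)]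
    push_cast; ring
  rw [e1]
  have h2 : Real.log (√x) ≤ √x - 1 := Real.log_le_sub_one_of_pos (by linarith)
  nlinarith

lemma kap_tub {k p a A q : ℕ} (hk : 1 ≤ k) (h2A : 2 * A = 2 ^ k * 2 ^ p) (h2a : 2 * a ≤ 2 ^ p)
    (h2a' : 2 ^ p ≤ 2 * a + 1)
    (hK : 110 * k ≤ 2 ^ k) {u v : ℝ × ℝ} (hq : (2 : ℝ) ^ k / k ≤ q)
    (hv : (2 : ℝ) ^ k / 2 ≤ |v.1| ∨ (2 : ℝ) ^ k / 2 ≤ |v.2|) (β β' : Fin k)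
    (t t' : Fin q × (Fin 27 × Fin 27)) :
    kap a A (scl (2 ^ p) (tub (2 ^ k) q u v β t)) (scl (2 ^ p) (tub (2 ^ k) q u v β' t')) ≤
      FF k (Nat.dist β β') := by
  have hkp : (1 : ℝ) ≤ k := by exact_mod_cast hk
  have hKp : (0 : ℝ) < 2 ^ k := by positivity
  have hrp : (1 : ℝ) ≤ 2 ^ p := one_le_pow₀ (by norm_num)
  have h2aR : 2 * (a : ℝ) ≤ 2 ^ p := by exact_mod_cast h2a
  have h2aR' : (2 : ℝ) ^ p ≤ 2 * a + 1 := by exact_mod_cast h2a'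
  have h2AR : 2 * (A : ℝ) = 2 ^ k * 2 ^ p := by exact_mod_cast h2A
  have haA : a ≤ A := by
    have : 1 * 2 ^ p ≤ 2 ^ k * 2 ^ p := Nat.mul_le_mul_right _ (Nat.one_le_two_pow)
    omega
  have hAR : (A : ℝ) = 2 ^ k * 2 ^ p / 2 := by linarith
  rcases Nat.lt_or_ge (Nat.dist β β') 2 with hd | hd
  · have h1 : kap a A (scl (2 ^ p) (tub (2 ^ k) q u v β t)) (scl (2 ^ p) (tub (2 ^ k) q u v β' t')) ≤
        ((2 * k + 1 : ℕ) : ℝ) := by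
      apply kap_le_nat haA
      have e1 : (2 : ℝ) ^ (2 * k + 1) = 2 * (2 ^ k) ^ 2 := by rw [pow_succ, mul_comm 2 k, pow_mul]; ring
      rw [e1, hAR]
      have h4 : (2 : ℝ) ^ p * 2 ^ p ≤ 4 * (a : ℝ) ^ 2 + 2 := by
        have ha0 : (0 : ℝ) ≤ a := by positivity
        rcases Nat.eq_zero_or_pos a with h0 | h0
        · subst h0
          simp at h2aR'
          have : (2 : ℝ) ^ p = 1 := le_antisymm h2aR' hrp
          rw [this]; norm_num
        · have : 2 ^ p = 2 * a := by
            rcases Nat.eq_zero_or_pos p with hp | hp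
            · subst hp; simp at h2a; omega
            · obtain ⟨s, rfl⟩ : ∃ s, p = s + 1 := ⟨p - 1, by omega⟩
              rw [pow_succ] at *
              omega
          have : (2 : ℝ) ^ p = 2 * a := by exact_mod_cast this
          rw [this]; nlinarith
      have hK1 : (1 : ℝ) ≤ (2 ^ k) ^ 2 := one_le_pow₀ (one_le_pow₀ (by norm_num))
      nlinarith [mul_le_mul_of_nonneg_left h4 (by positivity : (0 : ℝ) ≤ (2 ^ k) ^ 2)]
    refine h1.trans ?_
    unfold FF
    rw [if_pos (by omega)]
    have : 0 ≤ 11 * (√(k : ℝ) * (1 / √((Nat.dist β β' : ℝ) + 1))) := by positivity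
    push_cast
    linarith
  · obtain ⟨D, hD⟩ : ∃ D, Nat.dist β β' = D + 1 := ⟨Nat.dist β β' - 1, by omega⟩
    have hD1 : 1 ≤ D := by omega
    have hDk : D ≤ k := by
      have := β.2; have := β'.2
      unfold Nat.dist at hD
      omega
    have hD1R : (1 : ℝ) ≤ D := by exact_mod_cast hD1
    have hDkR : (D : ℝ) ≤ k := by exact_mod_cast hDk
    have hsep := tub_sep (u := u) (by omega) hKp hq hv t t' hD
    have hKR : 110 * (k : ℝ) ≤ 2 ^ k := by exact_mod_cast hK
    have hx1 : 1 ≤ (k : ℝ) / D := by rw [le_div_iff₀ (by linarith)]; linarith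
    have h1 : kap a A (scl (2 ^ p) (tub (2 ^ k) q u v β t)) (scl (2 ^ p) (tub (2 ^ k) q u v β' t')) ≤
        Real.log (8 * ((k : ℝ) / D) ^ 2) / Real.log 2 := by
      apply kap_le_log haA (ρ := 2 ^ p * (D * 2 ^ k / (4 * k))) (by positivity)
      · rw [sn_scl]
        have h27 : 55 / 2 ≤ (D : ℝ) * 2 ^ k / (4 * k) := by
          rw [le_div_iff₀ (by positivity)]
          nlinarith
        have e2 : (D : ℝ) * 2 ^ k / (2 * k) = 2 * (D * 2 ^ k / (4 * k)) := by field_simp; norm_num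
        rw [e2] at hsep
        push_cast
        have h5 := mul_le_mul_of_nonneg_left hsep (by linarith : (0 : ℝ) ≤ 2 ^ p)
        have h6 := mul_le_mul_of_nonneg_left h27 (by linarith : (0 : ℝ) ≤ 2 ^ p)
        linarith
      · nlinarith
      · have e3 : 8 * ((k : ℝ) / D) ^ 2 * ((2 ^ p * (D * 2 ^ k / (4 * k))) ^ 2 + 1) =
            2 * (2 ^ k * 2 ^ p / 2) ^ 2 + 8 * ((k : ℝ) / D) ^ 2 := by
          field_simp
          ring
        rw [e3, hAR]
        nlinarith
    refine h1.trans ((log_bd hx1).trans ?_)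
    unfold FF
    rw [if_neg (by omega), zero_add, hD, Real.sqrt_div (by positivity)]
    push_cast
    have hsD : 0 < √(D : ℝ) := Real.sqrt_pos.2 (by linarith)
    have hsD2 : 0 < √((D : ℝ) + 1 + 1) := Real.sqrt_pos.2 (by linarith)
    have hsk : 0 ≤ √(k : ℝ) := Real.sqrt_nonneg _
    have h6 : 6 * √((D : ℝ) + 1 + 1) ≤ 11 * √(D : ℝ) := by
      apply abs_le_of_sq_le_sq' _ (by positivity) |>.2
      rw [mul_pow, mul_pow, Real.sq_sqrt (by linarith), Real.sq_sqrt (by linarith)]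
      linarith
    rw [show 6 * (√(k : ℝ) / √(D : ℝ)) = √(k : ℝ) * (6 / √(D : ℝ)) by ring,
      show 11 * (√(k : ℝ) * (1 / √((D : ℝ) + 1 + 1))) = √(k : ℝ) * (11 / √((D : ℝ) + 1 + 1)) by ring]
    apply mul_le_mul_of_nonneg_left _ hsk
    rw [div_le_div_iff₀ hsD hsD2]
    exact h6

end TP

namespace TP

noncomputable def C7 : ℝ := 1 / (448 * 17496 ^ 2)

lemma pow_big {k : ℕ} (hk : 20 ≤ k) : 110 * k ≤ 2 ^ k ∧ 11665 ≤ 2 ^ k := by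
  induction k, hk using Nat.le_induction with
  | base => norm_num
  | succ n hn ih => rw [pow_succ]; omega

lemma prob_bound {Ω : Type*} [MeasureSpace Ω] [IsProbabilityMeasure (ℙ : Measure Ω)]
    {X : Z2 → Ω → ℝ} {k p a A : ℕ} (hk : 20 ≤ k) (h2A : 2 * A = 2 ^ k * 2 ^ p) (h2a : 2 * a ≤ 2 ^ p)
    (h2a' : 2 ^ p ≤ 2 * a + 1) (hX : GDom X (kap a A))
    {q : ℕ} (hq : q = 2 ^ k / k + 1) {u v : ℝ × ℝ}
    (hv : (2 : ℝ) ^ k / 2 ≤ |v.1| ∨ (2 : ℝ) ^ k / 2 ≤ |v.2|) {ε δ : ℝ} (hε : 0 < ε) (hδ : 0 < δ) (hδ1 : δ ≤ 1)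
    (hεk : 4000 ≤ √k * ε) :
    ℙ {ω | (∃ (β : Fin k) (t : Fin q × (Fin 27 × Fin 27)), ∃ w1 w2 : ℕ, w1 < 2 ^ p ∧ w2 < 2 ^ p ∧
        ε * k / 2 ≤ X (scl (2 ^ p) (tub (2 ^ k) q u v β t) + ((w1 : ℤ), (w2 : ℤ))) ω -
          X (scl (2 ^ p) (tub (2 ^ k) q u v β t)) ω) ∨
      δ * 2 ^ k / 12 ≤ (Nat.card {s : Fin k × (Fin q × (Fin 27 × Fin 27)) //
        ε * k / 2 ≤ X (scl (2 ^ p) (tub (2 ^ k) q u v s.1 s.2)) ω} : ℝ)} ≤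
    ENNReal.ofReal ((2 ^ k) ^ 2 * Real.exp (-C7 * ε ^ 2 * k ^ 2 * δ ^ 2)) := by
  have hkp : (0 : ℝ) < k := by exact_mod_cast (by omega : 0 < k)
  obtain ⟨hK1, hK2⟩ := pow_big hk
  have hqp : 0 < q := by rw [hq]; exact Nat.succ_pos _
  have hkq : k * q ≤ 2 * 2 ^ k := by
    have := Nat.mul_div_le (2 ^ k) k
    have h2 : k * q = k * (2 ^ k / k) + k := by rw [hq]; ring
    omega
  have hq2 : (2 : ℝ) ^ k / k ≤ q := by
    rw [div_le_iff₀ hkp]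
    have := Nat.lt_div_mul_add (a := 2 ^ k) (b := k) (by omega)
    have h2 : q * k = 2 ^ k / k * k + k := by rw [hq]; ring
    have h3 : 2 ^ k ≤ q * k := by omega
    exact_mod_cast h3
  have hkqR : (k : ℝ) * q ≤ 2 * 2 ^ k := by exact_mod_cast hkq
  have : Nonempty (Fin q × (Fin 27 × Fin 27)) := ⟨(⟨0, hqp⟩, 0, 0)⟩
  have hcard : (Fintype.card (Fin q × (Fin 27 × Fin 27)) : ℝ) = q * 729 := by
    simp [Fintype.card_prod]
  have hE : 16000000 ≤ ε ^ 2 * k ^ 2 := by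
    have h1 : 4000 ^ 2 ≤ (√k * ε) ^ 2 := pow_le_pow_left₀ (by norm_num) hεk 2
    rw [mul_pow, Real.sq_sqrt hkp.le] at h1
    have hk1 : (1 : ℝ) ≤ k := by exact_mod_cast (by omega : 1 ≤ k)
    nlinarith [sq_nonneg ε, mul_nonneg (sq_nonneg ε) (mul_nonneg hkp.le (sub_nonneg.2 hk1))]
  set e := Real.exp (-C7 * ε ^ 2 * k ^ 2 * δ ^ 2) with he
  have hmain := main_term hX (n := k) (fun β t => scl (2 ^ p) (tub (2 ^ k) q u v β t))
    (fun β β' => FF k (Nat.dist β β')) (fun β β' t t' => kap_tub (by omega) h2A h2a h2a' hK1 hq2 hv β β' t t')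
    (fun β β' => FF_nonneg _ _) (V := 56 * (k : ℝ) ^ 2) (by positivity) (FF_sum k)
    (T := ε * k / 2) (m := δ * k / 17496) (by positivity) (by positivity)
  have hosc : ∀ (β : Fin k) (t : Fin q × (Fin 27 × Fin 27)), ℙ {ω | ∃ w1 w2 : ℕ, w1 < 2 ^ p ∧ w2 < 2 ^ p ∧
        ε * k / 2 ≤ X (scl (2 ^ p) (tub (2 ^ k) q u v β t) + ((w1 : ℤ), (w2 : ℤ))) ω -
          X (scl (2 ^ p) (tub (2 ^ k) q u v β t)) ω} ≤ ENNReal.ofReal (8 * e) := by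
    intro β t
    have h1 : 1 ≤ p → 2 * a = 2 ^ p := by
      intro hp
      obtain ⟨s, rfl⟩ : ∃ s, p = s + 1 := ⟨p - 1, by omega⟩
      rw [pow_succ] at *
      omega
    refine (osc_term (a := a) (k := k) (p := p) ?_ h1 _ (by positivity) ?_).trans ?_
    · intro hp
      have : A = 2 ^ k * a := by
        have := h1 hp
        rw [← this] at h2A
        have : 2 ^ k * (2 * a) = 2 * (2 ^ k * a) := by ring
        omega
      rw [← this]; exact hX
    · have : (ε * k / 2) ^ 2 = ε ^ 2 * k ^ 2 / 4 := by ring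
      rw [this]; linarith
    · apply ENNReal.ofReal_le_ofReal
      apply mul_le_mul_of_nonneg_left _ (by norm_num)
      apply Real.exp_le_exp.2
      have : (ε * k / 2) ^ 2 = ε ^ 2 * k ^ 2 / 4 := by ring
      rw [this]
      have hd : δ ^ 2 ≤ 1 := by nlinarith
      have h3 : (ε ^ 2 * k ^ 2) * δ ^ 2 ≤ ε ^ 2 * k ^ 2 := mul_le_of_le_one_right (by positivity) hd
      unfold C7
      nlinarith
  have hosc2 : ℙ {ω | ∃ (β : Fin k) (t : Fin q × (Fin 27 × Fin 27)), ∃ w1 w2 : ℕ, w1 < 2 ^ p ∧ w2 < 2 ^ p ∧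
        ε * k / 2 ≤ X (scl (2 ^ p) (tub (2 ^ k) q u v β t) + ((w1 : ℤ), (w2 : ℤ))) ω -
          X (scl (2 ^ p) (tub (2 ^ k) q u v β t)) ω} ≤ ENNReal.ofReal (11664 * 2 ^ k * e) := by
    have hU : {ω | ∃ (β : Fin k) (t : Fin q × (Fin 27 × Fin 27)), ∃ w1 w2 : ℕ, w1 < 2 ^ p ∧ w2 < 2 ^ p ∧
        ε * k / 2 ≤ X (scl (2 ^ p) (tub (2 ^ k) q u v β t) + ((w1 : ℤ), (w2 : ℤ))) ω -
          X (scl (2 ^ p) (tub (2 ^ k) q u v β t)) ω} =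
        ⋃ s : Fin k × (Fin q × (Fin 27 × Fin 27)), {ω | ∃ w1 w2 : ℕ, w1 < 2 ^ p ∧ w2 < 2 ^ p ∧
        ε * k / 2 ≤ X (scl (2 ^ p) (tub (2 ^ k) q u v s.1 s.2) + ((w1 : ℤ), (w2 : ℤ))) ω -
          X (scl (2 ^ p) (tub (2 ^ k) q u v s.1 s.2)) ω} := by
      ext ω
      simp only [Set.mem_iUnion, Set.mem_ofPred_eq, Prod.exists]
    rw [hU]
    refine (measure_iUnion_fintype_le _ _).trans ?_
    refine (Finset.sum_le_sum (fun s _ => hosc s.1 s.2)).trans ?_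
    rw [Finset.sum_const, nsmul_eq_mul, Finset.card_univ, ← ENNReal.ofReal_natCast,
      ← ENNReal.ofReal_mul (by positivity)]
    apply ENNReal.ofReal_le_ofReal
    rw [Fintype.card_prod, Fintype.card_fin, Nat.cast_mul, hcard]
    have he0 : 0 < e := Real.exp_pos _
    nlinarith
  have hmain2 : ℙ {ω | δ * 2 ^ k / 12 ≤ (Nat.card {s : Fin k × (Fin q × (Fin 27 × Fin 27)) //
        ε * k / 2 ≤ X (scl (2 ^ p) (tub (2 ^ k) q u v s.1 s.2)) ω} : ℝ)} ≤ ENNReal.ofReal (2 ^ k * e) := by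
    refine (measure_mono ?_).trans (hmain.trans ?_)
    · intro ω hω
      simp only [Set.mem_ofPred_eq] at hω ⊢
      refine le_trans ?_ hω
      rw [hcard]
      have := mul_le_mul_of_nonneg_left hkqR hδ.le
      linarith
    · apply ENNReal.ofReal_le_ofReal
      apply mul_le_mul_of_nonneg_left _ (by positivity)
      apply Real.exp_le_exp.2
      apply le_of_eq
      unfold C7
      field_simp
      ring
  have hK2R : (11665 : ℝ) ≤ 2 ^ k := by exact_mod_cast hK2
  have he0 : 0 < e := Real.exp_pos _
  refine (measure_union_le _ _).trans ((add_le_add hosc2 hmain2).trans ?_)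
  rw [← ENNReal.ofReal_add (by positivity) (by positivity)]
  apply ENNReal.ofReal_le_ofReal
  have : (2 : ℝ) ^ k * e * 11665 ≤ 2 ^ k * e * 2 ^ k := mul_le_mul_of_nonneg_left hK2R (by positivity)
  nlinarith

end TP

namespace TP

lemma e2_sq (p q : ℝ × ℝ) : e2 p q ^ 2 = (p.1 - q.1) ^ 2 + (p.2 - q.2) ^ 2 :=
  Real.sq_sqrt (by positivity)

lemma e2_nonneg (p q : ℝ × ℝ) : 0 ≤ e2 p q := Real.sqrt_nonneg _

lemma e2_fst (p q : ℝ × ℝ) : |p.1 - q.1| ≤ e2 p q := by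
  apply Real.abs_le_sqrt
  nlinarith [sq_nonneg (p.2 - q.2)]

lemma e2_snd (p q : ℝ × ℝ) : |p.2 - q.2| ≤ e2 p q := by
  apply Real.abs_le_sqrt
  nlinarith [sq_nonneg (p.1 - q.1)]

lemma e5_aux {K : ℝ} (hK : 20 ≤ K) : (4 / K ^ 2 + 4 / K ^ 4) * (K + 1) ^ 2 ≤ 8 := by
  have hKp : 0 < K := by linarith
  rw [show 4 / K ^ 2 + 4 / K ^ 4 = (4 * K ^ 2 + 4) / K ^ 4 by field_simp, div_mul_eq_mul_div,
    div_le_iff₀ (by positivity)]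
  have h3 : (K + 1) ^ 2 ≤ 6 / 5 * K ^ 2 := by nlinarith
  have h4 : 0 ≤ 4 * K ^ 2 + 4 := by positivity
  have h5 : (4 * K ^ 2 + 4) ≤ 6 * K ^ 2 := by nlinarith
  have h6 : (4 * K ^ 2 + 4) * (K + 1) ^ 2 ≤ (6 * K ^ 2) * (6 / 5 * K ^ 2) :=
    mul_le_mul h5 h3 (by positivity) (by positivity)
  have h7 : 0 < K ^ 4 := by positivity
  linarith [show (6 * K ^ 2) * (6 / 5 * K ^ 2) = 36 / 5 * K ^ 4 by ring]

lemma ell_seg {s f w : ℝ × ℝ} {K r : ℝ} (hK : 20 ≤ K) (hr : 0 < r) (h1 : K * r ≤ e2 s f)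
    (h2 : e2 s f ≤ (K + 1) * r) (hw : e2 s w + e2 f w ≤ (1 + 2 / K ^ 2) * e2 s f) :
    ∃ t : ℝ, 0 ≤ t ∧ t ≤ 1 ∧ |w.1 - (s.1 + t * (f.1 - s.1))| ≤ 2 * r ∧
      |w.2 - (s.2 + t * (f.2 - s.2))| ≤ 2 * r := by
  have ha := e2_nonneg s w
  have hb := e2_nonneg f w
  have ha2 := e2_sq s w
  have hb2 := e2_sq f w
  have hD2 := e2_sq s f
  have hDp : 0 < e2 s f := lt_of_lt_of_le (by positivity) h1
  set a := e2 s w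
  set b := e2 f w
  set D := e2 s f
  have hS : 0 < a + b := by
    rcases (add_nonneg ha hb).eq_or_lt with h | h
    · exfalso
      have ea : a = 0 := by linarith
      have eb : b = 0 := by linarith
      rw [ea] at ha2
      rw [eb] at hb2
      have q1 : s.1 - w.1 = 0 := by nlinarith [sq_nonneg (s.1 - w.1), sq_nonneg (s.2 - w.2)]
      have q2 : s.2 - w.2 = 0 := by nlinarith [sq_nonneg (s.1 - w.1), sq_nonneg (s.2 - w.2)]
      have q3 : f.1 - w.1 = 0 := by nlinarith [sq_nonneg (f.1 - w.1), sq_nonneg (f.2 - w.2)]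
      have q4 : f.2 - w.2 = 0 := by nlinarith [sq_nonneg (f.1 - w.1), sq_nonneg (f.2 - w.2)]
      have q5 : s.1 - f.1 = 0 := by linarith
      have q6 : s.2 - f.2 = 0 := by linarith
      rw [q5, q6] at hD2
      nlinarith
    · exact h
  have hSD : (a + b) ^ 2 - D ^ 2 ≤ 8 * r ^ 2 := by
    have e1 : (a + b) ^ 2 ≤ ((1 + 2 / K ^ 2) * D) ^ 2 := pow_le_pow_left₀ hS.le hw 2
    have e2 : D ^ 2 ≤ ((K + 1) * r) ^ 2 := pow_le_pow_left₀ hDp.le h2 2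
    have e3 : ((1 + 2 / K ^ 2) * D) ^ 2 - D ^ 2 = (4 / K ^ 2 + 4 / K ^ 4) * D ^ 2 := by
      field_simp; ring
    have e4 : (4 / K ^ 2 + 4 / K ^ 4) * D ^ 2 ≤ (4 / K ^ 2 + 4 / K ^ 4) * ((K + 1) * r) ^ 2 := by gcongr
    have e5 := e5_aux hK
    have e6 : (4 / K ^ 2 + 4 / K ^ 4) * ((K + 1) * r) ^ 2 ≤ 8 * r ^ 2 := by
      rw [mul_pow, ← mul_assoc]; gcongr
    linarith
  have key : (b * (w.1 - s.1) + a * (w.1 - f.1)) ^ 2 + (b * (w.2 - s.2) + a * (w.2 - f.2)) ^ 2 ≤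
      ((a + b) * (2 * r)) ^ 2 := by
    have k1 : (b * (w.1 - s.1) + a * (w.1 - f.1)) ^ 2 + (b * (w.2 - s.2) + a * (w.2 - f.2)) ^ 2 =
        a * b * ((a + b) ^ 2 - D ^ 2) := by
      rw [hD2]
      linear_combination (-(b ^ 2) - a * b) * ha2 + (-(a ^ 2) - a * b) * hb2
    rw [k1]
    have k2 : a * b * ((a + b) ^ 2 - D ^ 2) ≤ a * b * (8 * r ^ 2) :=
      mul_le_mul_of_nonneg_left hSD (by positivity)
    have k3 := mul_nonneg (sq_nonneg (a - b)) (sq_nonneg r)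
    have k4 := mul_nonneg (sq_nonneg (a + b)) (sq_nonneg r)
    linarith [show ((a + b) * (2 * r)) ^ 2 - a * b * (8 * r ^ 2) = 2 * ((a - b) ^ 2 * r ^ 2) + 2 * ((a + b) ^ 2 * r ^ 2) by ring]
  have hpos : 0 ≤ (a + b) * (2 * r) := by positivity
  refine ⟨a / (a + b), by positivity, by rw [div_le_one hS]; linarith, ?_, ?_⟩
  · rw [show w.1 - (s.1 + a / (a + b) * (f.1 - s.1)) = (b * (w.1 - s.1) + a * (w.1 - f.1)) / (a + b) by
      field_simp; ring, abs_div, abs_of_pos hS, div_le_iff₀ hS, mul_comm (2 * r)]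
    exact abs_le_of_sq_le_sq ((le_add_of_nonneg_right (sq_nonneg _)).trans key) hpos
  · rw [show w.2 - (s.2 + a / (a + b) * (f.2 - s.2)) = (b * (w.2 - s.2) + a * (w.2 - f.2)) / (a + b) by
      field_simp; ring, abs_div, abs_of_pos hS, div_le_iff₀ hS, mul_comm (2 * r)]
    exact abs_le_of_sq_le_sq ((le_add_of_nonneg_left (sq_nonneg _)).trans key) hpos

/-- one coordinate of an end-box, rescaled -/
lemma end_coord {r K x b : ℝ} (hr : 1 ≤ r) (hK : 20 ≤ K) (h1 : b * (r / K) - 1 / 2 ≤ x)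
    (h2 : x ≤ (b + 1) * (r / K) - 1 / 2) : |x / r - b / K| ≤ 1 := by
  have hx : x = r * (x / r) := by field_simp
  set y := x / r
  rw [hx] at h1 h2
  have e1 : b * (r / K) = r * (b / K) := by ring
  have e2 : (b + 1) * (r / K) = r * (b / K) + r * (1 / K) := by ring
  have e3 : 1 / K ≤ 1 := by rw [div_le_one (by linarith)]; linarith
  rw [e1] at h1
  rw [e2] at h2
  rw [abs_le]
  constructor <;> nlinarith

lemma coord_idx {r : ℕ} (hr : 1 ≤ r) (z : ℤ) : ((z / (r : ℤ) : ℤ) : ℝ) ≤ (z : ℝ) / r ∧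
    (z : ℝ) / r ≤ ((z / (r : ℤ) : ℤ) : ℝ) + 1 := by
  have hrp : (0 : ℝ) < r := by exact_mod_cast hr
  have hrz : (0 : ℤ) < r := by exact_mod_cast hr
  have h1 := Int.ediv_mul_le z hrz.ne'
  have h2 := Int.lt_ediv_add_one_mul_self z hrz
  constructor
  · rw [le_div_iff₀ hrp]; exact_mod_cast h1
  · rw [div_le_iff₀ hrp]; exact_mod_cast h2.le

/-- one coordinate of the cover -/
lemma cover_coord {r : ℕ} {K s f w bs bf t : ℝ} {z : ℤ} {i : ℕ} (hr : 1 ≤ r) (hK : 20 ≤ K)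
    (hs : |s / r - bs / K| ≤ 1) (hf : |f / r - bf / K| ≤ 1) (ht0 : 0 ≤ t) (ht1 : t ≤ 1)
    (hw : |w - (s + t * (f - s))| ≤ 2 * r) (hz : |(z : ℝ) - w| ≤ 4 * r) (hsf : |s - f| ≤ (K + 1) * r)
    (hi1 : (i : ℝ) ≤ t * K) (hi2 : t * K ≤ i + 1) :
    |z / (r : ℤ) - ⌊bs / K + i / K * ((bf - bs) / K)⌋| ≤ 13 := by
  have hrp : (0 : ℝ) < r := by exact_mod_cast hr
  obtain ⟨c1, c2⟩ := coord_idx hr z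
  have ez : (z : ℝ) = r * ((z : ℝ) / r) := by field_simp
  have es : s = r * (s / r) := by field_simp
  have ef : f = r * (f / r) := by field_simp
  have ew : w = r * (w / r) := by field_simp
  generalize hZ : (z : ℝ) / r = Z at *
  generalize hS : s / r = S at *
  generalize hF : f / r = F at *
  generalize hW : w / r = W at *
  rw [ez, ew, ← mul_sub, abs_mul, abs_of_pos hrp, mul_comm, mul_le_mul_iff_left₀ hrp] at hz
  rw [ew, es, ef, show (r : ℝ) * W - (r * S + t * (r * F - r * S)) = r * (W - (S + t * (F - S))) by ring,
    abs_mul, abs_of_pos hrp, mul_comm, mul_le_mul_iff_left₀ hrp] at hw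
  rw [es, ef, ← mul_sub, abs_mul, abs_of_pos hrp, mul_comm, mul_le_mul_iff_left₀ hrp] at hsf
  generalize hIz : z / (r : ℤ) = I at *
  have hKp : 0 < K := by linarith
  set x := bs / K
  have ex : (bf - bs) / K = bf / K - x := by simp only [x]; ring
  rw [ex]
  set y := bf / K
  have hyx : |y - x| ≤ K + 3 := by
    rw [abs_le] at *
    constructor <;> linarith
  have hti : |t - i / K| ≤ 1 / K := by
    rw [abs_le]
    have e1 : (i : ℝ) / K ≤ t := by rw [div_le_iff₀ hKp]; exact hi1
    have e2 : t ≤ i / K + 1 / K := by rw [← add_div, le_div_iff₀ hKp]; exact hi2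
    have : 0 < 1 / K := by positivity
    constructor <;> linarith
  have hm : |(t - i / K) * (y - x)| ≤ 2 := by
    rw [abs_mul]
    calc |t - i / K| * |y - x| ≤ 1 / K * (K + 3) := by gcongr
      _ ≤ 2 := by rw [one_div_mul_eq_div, div_le_iff₀ hKp]; linarith
  have hc : |(S + t * (F - S)) - (x + t * (y - x))| ≤ 1 := by
    rw [abs_le] at *
    constructor <;> nlinarith
  have hfl1 := Int.floor_le (x + i / K * (y - x))
  have hfl2 := Int.lt_floor_add_one (x + i / K * (y - x))
  generalize ⌊x + i / K * (y - x)⌋ = J at *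
  have : |((I - J : ℤ) : ℝ)| ≤ 13 := by
    push_cast
    rw [abs_le] at *
    constructor <;> nlinarith
  rw [← Int.cast_abs] at this
  exact_mod_cast this

noncomputable def uB (k : ℕ) (B₁ : Z2) : ℝ × ℝ := ((B₁.1 : ℝ) / 2 ^ k, (B₁.2 : ℝ) / 2 ^ k)
noncomputable def vB (k : ℕ) (B₁ B₂ : Z2) : ℝ × ℝ :=
  (((B₂.1 : ℝ) - B₁.1) / 2 ^ k, ((B₂.2 : ℝ) - B₁.2) / 2 ^ k)

lemma K20 {k : ℕ} (hk : 20 ≤ k) : (20 : ℝ) ≤ 2 ^ k := by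
  have := (pow_big hk).2
  have : 20 ≤ 2 ^ k := by omega
  exact_mod_cast this

lemma vcond {k r : ℕ} (hk : 20 ≤ k) (hr : 1 ≤ r) {s f : ℝ × ℝ} {B₁ B₂ : Z2}
    (hs : s ∈ BDbox ((r : ℝ) / 2 ^ k) B₁) (hf : f ∈ BDbox ((r : ℝ) / 2 ^ k) B₂)
    (h1 : (2 : ℝ) ^ k * r ≤ e2 s f) :
    (2 : ℝ) ^ k / 2 ≤ |(vB k B₁ B₂).1| ∨ (2 : ℝ) ^ k / 2 ≤ |(vB k B₁ B₂).2| := by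
  have hK := K20 hk
  have hr1 : (1 : ℝ) ≤ r := by exact_mod_cast hr
  have hrp : (0 : ℝ) < r := by linarith
  have a1 := end_coord hr1 hK hs.1 hs.2.1
  have a2 := end_coord hr1 hK hs.2.2.1 hs.2.2.2
  have b1 := end_coord hr1 hK hf.1 hf.2.1
  have b2 := end_coord hr1 hK hf.2.2.1 hf.2.2.2
  unfold vB
  simp only [sub_div]
  generalize (2 : ℝ) ^ k = K at *
  by_contra hcon
  push Not at hcon
  obtain ⟨c1, c2⟩ := hcon
  have d1 : |s.1 / r - f.1 / r| ≤ K / 2 + 2 := by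
    rw [abs_lt] at c1
    rw [abs_le] at *
    constructor <;> linarith
  have d2 : |s.2 / r - f.2 / r| ≤ K / 2 + 2 := by
    rw [abs_lt] at c2
    rw [abs_le] at *
    constructor <;> linarith
  rw [← sub_div, abs_div, abs_of_pos hrp, div_le_iff₀ hrp] at d1 d2
  have g1 := sq_le_sq' (by linarith [abs_nonneg (s.1 - f.1)]) d1
  have g2 := sq_le_sq' (by linarith [abs_nonneg (s.2 - f.2)]) d2
  rw [sq_abs] at g1 g2
  have g3 := pow_le_pow_left₀ (by positivity) h1 2
  rw [e2_sq] at g3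
  have g4 : (K * r) ^ 2 ≤ 2 * ((K / 2 + 2) * r) ^ 2 := by linarith
  have g5 : K ^ 2 ≤ 2 * (K / 2 + 2) ^ 2 := by
    rw [mul_pow, mul_pow, ← mul_assoc] at g4
    exact le_of_mul_le_mul_right g4 (by positivity)
  nlinarith

lemma cover {k q r : ℕ} (hk : 20 ≤ k) (hq : q = 2 ^ k / k + 1) (hr : 1 ≤ r) {s f w : ℝ × ℝ} {B₁ B₂ : Z2}
    (hs : s ∈ BDbox ((r : ℝ) / 2 ^ k) B₁) (hf : f ∈ BDbox ((r : ℝ) / 2 ^ k) B₂)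
    (h1 : (2 : ℝ) ^ k * r ≤ e2 s f) (h2 : e2 s f ≤ (2 ^ k + 1) * r)
    (hw : e2 s w + e2 f w ≤ (1 + 2 / ((2 : ℝ) ^ k) ^ 2) * e2 s f) {z : Z2}
    (hz : e2 (castZ z) w ≤ 4 * r) :
    ∃ (β : Fin k) (t : Fin q × (Fin 27 × Fin 27)),
      tub (2 ^ k) q (uB k B₁) (vB k B₁ B₂) β t = (z.1 / (r : ℤ), z.2 / (r : ℤ)) := by
  have hK := K20 hk
  have hr1 : (1 : ℝ) ≤ r := by exact_mod_cast hr
  have hrp : (0 : ℝ) < r := by linarith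
  have a1 := end_coord hr1 hK hs.1 hs.2.1
  have a2 := end_coord hr1 hK hs.2.2.1 hs.2.2.2
  have b1 := end_coord hr1 hK hf.1 hf.2.1
  have b2 := end_coord hr1 hK hf.2.2.1 hf.2.2.2
  obtain ⟨t, ht0, ht1, hw1, hw2⟩ := ell_seg hK hrp h1 h2 hw
  set i := ⌊t * 2 ^ k⌋₊ with hi
  have hi1 : (i : ℝ) ≤ t * 2 ^ k := Nat.floor_le (by positivity)
  have hi2 : t * 2 ^ k ≤ i + 1 := (Nat.lt_floor_add_one _).le
  have hiK : i ≤ 2 ^ k := by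
    have : (i : ℝ) ≤ 2 ^ k := hi1.trans (mul_le_of_le_one_left (by positivity) ht1)
    exact_mod_cast this
  have hqp : 0 < q := by rw [hq]; exact Nat.succ_pos _
  have hdiv : i / q < k := by
    rw [Nat.div_lt_iff_lt_mul hqp]
    have := Nat.lt_div_mul_add (a := 2 ^ k) (b := k) (by omega)
    have h2 : k * q = 2 ^ k / k * k + k := by rw [hq]; ring
    omega
  have hmod := Nat.mod_lt i hqp
  have m1 := cover_coord (z := z.1) hr hK a1 b1 ht0 ht1 hw1 ((e2_fst (castZ z) w).trans hz)
    ((e2_fst s f).trans h2) hi1 hi2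
  have m2 := cover_coord (z := z.2) hr hK a2 b2 ht0 ht1 hw2 ((e2_snd (castZ z) w).trans hz)
    ((e2_snd s f).trans h2) hi1 hi2
  rw [abs_le] at m1 m2
  refine ⟨⟨i / q, hdiv⟩, ⟨⟨i % q, hmod⟩,
    ⟨(z.1 / (r : ℤ) - ⌊(B₁.1 : ℝ) / 2 ^ k + i / 2 ^ k * (((B₂.1 : ℝ) - B₁.1) / 2 ^ k)⌋ + 13).toNat, by omega⟩,
    ⟨(z.2 / (r : ℤ) - ⌊(B₁.2 : ℝ) / 2 ^ k + i / 2 ^ k * (((B₂.2 : ℝ) - B₁.2) / 2 ^ k)⌋ + 13).toNat, by omega⟩⟩, ?_⟩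
  unfold tub stn uB vB
  have e : i / q * q + i % q = i := Nat.div_add_mod' i q
  simp only [e]
  ext
  · simp only [Prod.fst_add]
    rw [Int.toNat_of_nonneg (by omega)]
    ring
  · simp only [Prod.snd_add]
    rw [Int.toNat_of_nonneg (by omega)]
    ring

end TP

namespace TP

lemma count_le {ι σ : Type*} [Finite ι] [Finite σ] (S : ι → Prop) (Pr : σ → Prop) (g : σ → Z2) (h : ι → Z2)
    (M : ℕ) (hfib : ∀ y, Nat.card {i // S i ∧ h i = y} ≤ M) (hc : ∀ i, S i → ∃ s, Pr s ∧ g s = h i) :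
    Nat.card {i // S i} ≤ M * Nat.card {s // Pr s} := by
  classical
  have := Fintype.ofFinite ι
  have := Fintype.ofFinite σ
  choose φ h1 h2 using hc
  let ψ : {i // S i} → {s // Pr s} := fun i => ⟨φ i.1 i.2, h1 i.1 i.2⟩
  have key := Finset.card_le_mul_card_image (f := ψ) Finset.univ M (by
    intro b _
    refine le_trans ?_ (hfib (g b.1))
    rw [Nat.card_eq_fintype_card, ← Fintype.card_coe]
    refine Fintype.card_le_of_injective
      (fun i => (⟨i.1.1, i.1.2, ?_⟩ : {i // S i ∧ h i = g b.1})) ?_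
    · have := (Finset.mem_filter.1 i.2).2
      exact (h2 _ i.1.2).symm.trans (congrArg (fun x => g x.1) this)
    · intro i i' hii
      apply Subtype.ext
      apply Subtype.ext
      exact congrArg (fun x => x.1) hii)
  rw [Nat.card_eq_fintype_card, Nat.card_eq_fintype_card]
  rw [Finset.card_univ] at key
  refine key.trans (Nat.mul_le_mul_left _ ?_)
  exact Finset.card_le_univ _

lemma self_ext {Ω : Type*} [MeasureSpace Ω] (η : Z2 → Ω → ℝ) (x : Z2) : IsHarmExt η η (boxZ x 1) := by
  refine ⟨fun _ _ => rfl, ?_⟩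
  rintro z ⟨hz, hzb⟩
  exfalso
  apply hzb
  refine ⟨hz, (z.1 + 1, z.2), ?_, ?_⟩
  · unfold Adj; simp
  · simp only [boxZ, Set.mem_ofPred_eq] at hz ⊢
    omega

lemma field_gdom {Ω : Type*} [MeasureSpace Ω] [IsProbabilityMeasure (ℙ : Measure Ω)] {N k : ℕ} (hk : 1 ≤ k)
    {η : Z2 → Ω → ℝ} (hη : IsDGFF (V5N N) η) {H : ℤ → Z2 → Ω → ℝ}
    (hH : ∀ (r : ℕ) (x : Z2), ∃ F : Z2 → Ω → ℝ,
      IsHarmExt η F (boxZ x (((2 ^ k : ℕ) : ℤ) ^ r)) ∧ H (((2 ^ k : ℕ) : ℤ) ^ r) x = F x) (j : ℕ) :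
    ∃ a A : ℕ, 2 * A = 2 ^ k * 2 ^ (k * j) ∧ 2 * a ≤ 2 ^ (k * j) ∧ 2 ^ (k * j) ≤ 2 * a + 1 ∧
      GDom (etaJ η H (2 ^ k) j) (kap a A) := by
  have hrep : ∀ (n L : ℕ) (hn : 2 * L = 2 ^ (k * n)) (x : Z2) (ω : Ω),
      H (((2 ^ k : ℕ) : ℤ) ^ n) x ω = ip (fun z => mu L (z + -x)) (fun z => η z ω) := by
    intro n L hn x ω
    obtain ⟨F, hF, hFx⟩ := hH n x
    rw [hFx]
    refine H_rep ?_ hF ω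
    have : ((2 ^ k : ℕ) : ℤ) ^ n = 2 * (L : ℤ) := by
      rw [pow_mul] at hn
      exact_mod_cast hn.symm
    rw [this]
    omega
  have hhalf : ∀ n, 1 ≤ n → 2 * 2 ^ (k * n - 1) = 2 ^ (k * n) := by
    intro n hn
    rw [← pow_succ']
    congr 1
    have : 1 * 1 ≤ k * n := Nat.mul_le_mul hk hn
    omega
  have e : 2 ^ (k * (j + 1)) = 2 ^ k * 2 ^ (k * j) := by rw [← pow_add]; congr 1; ring
  rcases Nat.eq_zero_or_pos j with h0 | h0
  · subst h0
    refine ⟨0, 2 ^ (k * 1 - 1), ?_, by simp, by simp, ?_⟩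
    · rw [hhalf 1 le_rfl]; simp
    · refine gdom hη ?_
      intro x ω
      have h1 := hrep 1 _ (hhalf 1 le_rfl) x ω
      rw [← h1, ← H_rep (L := 0) (by norm_num) (self_ext η x) ω]
      simp [etaJ]
  · refine ⟨2 ^ (k * j - 1), 2 ^ (k * (j + 1) - 1), ?_, (hhalf j h0).le, ?_, ?_⟩
    · rw [hhalf (j + 1) (by omega), e]
    · rw [hhalf j h0]; exact Nat.le_succ _
    · refine gdom hη ?_
      intro x ω
      rw [← hrep j _ (hhalf j h0) x ω, ← hrep (j + 1) _ (hhalf (j + 1) (by omega)) x ω]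
      simp [etaJ, h0.ne']

lemma lat_box {r : ℕ} (hr : 1 ≤ r) (z : Z2) : castZ z ∈ BDbox (r : ℝ) (z.1 / (r : ℤ), z.2 / (r : ℤ)) := by
  have hrz : (0 : ℤ) < r := by exact_mod_cast hr
  have aux : ∀ y : ℤ, ((y / (r : ℤ) : ℤ) : ℝ) * r - 1 / 2 ≤ y ∧ (y : ℝ) ≤ (((y / (r : ℤ) : ℤ) : ℝ) + 1) * r - 1 / 2 := by
    intro y
    have h1 := Int.ediv_mul_le y hrz.ne'
    have h2 : y + 1 ≤ (y / (r : ℤ) + 1) * r := Int.lt_ediv_add_one_mul_self y hrz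
    have h1R : ((y / (r : ℤ) : ℤ) : ℝ) * r ≤ y := by exact_mod_cast h1
    have h2R : (y : ℝ) + 1 ≤ (((y / (r : ℤ) : ℤ) : ℝ) + 1) * r := by exact_mod_cast h2
    constructor <;> linarith
  exact ⟨(aux z.1).1, (aux z.1).2, (aux z.2).1, (aux z.2).2⟩

lemma lat_dec {r : ℕ} (hr : 1 ≤ r) (z : Z2) : ∃ w1 w2 : ℕ, w1 < r ∧ w2 < r ∧
    z = scl r (z.1 / (r : ℤ), z.2 / (r : ℤ)) + ((w1 : ℤ), (w2 : ℤ)) := by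
  have hrz : (0 : ℤ) < r := by exact_mod_cast hr
  refine ⟨(z.1 % r).toNat, (z.2 % r).toNat, ?_, ?_, ?_⟩
  · have := Int.emod_lt_of_pos z.1 hrz
    have := Int.emod_nonneg z.1 hrz.ne'
    omega
  · have := Int.emod_lt_of_pos z.2 hrz
    have := Int.emod_nonneg z.2 hrz.ne'
    omega
  · unfold scl
    ext
    · simp only [Prod.fst_add]
      rw [Int.toNat_of_nonneg (Int.emod_nonneg _ hrz.ne'), Int.mul_ediv_add_emod]
    · simp only [Prod.snd_add]
      rw [Int.toNat_of_nonneg (Int.emod_nonneg _ hrz.ne'), Int.mul_ediv_add_emod]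

/-- deterministic step -/
lemma det_step {Ω : Type*} {X : Z2 → Ω → ℝ} {k p q d M : ℕ} {ω : Ω} {u v : ℝ × ℝ} {ε δ : ℝ}
    (S : Fin d → Prop) (z : Fin d → Z2) (hM : 0 < M)
    (hfib : ∀ y, Nat.card {i // S i ∧ ((z i).1 / ((2 ^ p : ℕ) : ℤ), (z i).2 / ((2 ^ p : ℕ) : ℤ)) = y} ≤ M)
    (hX : ∀ i, S i → ε * k ≤ X (z i) ω)
    (hcov : ∀ i, S i → ∃ (β : Fin k) (t : Fin q × (Fin 27 × Fin 27)),
      tub (2 ^ k) q u v β t = ((z i).1 / ((2 ^ p : ℕ) : ℤ), (z i).2 / ((2 ^ p : ℕ) : ℤ)))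
    (hcard : M * (δ * 2 ^ k / 12) ≤ (Nat.card {i // S i} : ℝ)) :
    (∃ (β : Fin k) (t : Fin q × (Fin 27 × Fin 27)), ∃ w1 w2 : ℕ, w1 < 2 ^ p ∧ w2 < 2 ^ p ∧
        ε * k / 2 ≤ X (scl (2 ^ p) (tub (2 ^ k) q u v β t) + ((w1 : ℤ), (w2 : ℤ))) ω -
          X (scl (2 ^ p) (tub (2 ^ k) q u v β t)) ω) ∨
      δ * 2 ^ k / 12 ≤ (Nat.card {s : Fin k × (Fin q × (Fin 27 × Fin 27)) //
        ε * k / 2 ≤ X (scl (2 ^ p) (tub (2 ^ k) q u v s.1 s.2)) ω} : ℝ) := by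
  by_cases hosc : (∃ (β : Fin k) (t : Fin q × (Fin 27 × Fin 27)), ∃ w1 w2 : ℕ, w1 < 2 ^ p ∧ w2 < 2 ^ p ∧
        ε * k / 2 ≤ X (scl (2 ^ p) (tub (2 ^ k) q u v β t) + ((w1 : ℤ), (w2 : ℤ))) ω -
          X (scl (2 ^ p) (tub (2 ^ k) q u v β t)) ω)
  · exact Or.inl hosc
  · right
    push Not at hosc
    have h := count_le S (fun s : Fin k × (Fin q × (Fin 27 × Fin 27)) =>
        ε * k / 2 ≤ X (scl (2 ^ p) (tub (2 ^ k) q u v s.1 s.2)) ω)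
      (fun s => tub (2 ^ k) q u v s.1 s.2)
      (fun i => ((z i).1 / ((2 ^ p : ℕ) : ℤ), (z i).2 / ((2 ^ p : ℕ) : ℤ))) M hfib (by
        intro i hi
        obtain ⟨β, t, hbt⟩ := hcov i hi
        refine ⟨(β, t), ?_, hbt⟩
        obtain ⟨w1, w2, hw1, hw2, hz⟩ := lat_dec (r := 2 ^ p) Nat.one_le_two_pow (z i)
        have h1 := hosc β t w1 w2 hw1 hw2
        have h2 := hX i hi
        rw [hbt] at h1 ⊢
        rw [← hz] at h1
        linarith)
    have hMR : (0 : ℝ) < M := by exact_mod_cast hM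
    have h' : (Nat.card {i // S i} : ℝ) ≤ M * (Nat.card {s : Fin k × (Fin q × (Fin 27 × Fin 27)) //
        ε * k / 2 ≤ X (scl (2 ^ p) (tub (2 ^ k) q u v s.1 s.2)) ω} : ℝ) := by exact_mod_cast h
    exact le_of_mul_le_mul_left (hcard.trans h') hMR

end TP

/-- **Proposition 4.1.** There are universal constants `C₇, C₈ > 0` such that for
all large `K = 2^k`, all `1 ≤ j ≤ m-1`, all pairs of end-boxes `B₁, B₂ ∈ BD_{K^{j-2}}`
and all `δ ≥ C₈/(√k ε)`, the probability that some tame path `P ∈ SL_j` with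
`x_P ∈ B₁`, `y_P ∈ B₂` has a fraction at least `δ` of open subpaths (in the sense of
Proposition 3.1 for `j ≥ 2`, resp. of interior lattice points with `η₀ ≥ εk` for
`j = 1`) is at most `K² e^{-C₇ ε² k² δ²}`. -/
theorem tame_paths_few_open_subpaths :
    ∃ C₇ : ℝ, 0 < C₇ ∧ ∃ C₈ : ℝ, 0 < C₈ ∧ ∃ k₀ : ℕ,
      ∀ k : ℕ, k₀ ≤ k → ∀ K : ℕ, K = 2 ^ k →
        ∀ m N : ℕ, K ^ m ≤ N → N < K ^ (m + 1) →
          ∀ (Ω : Type) (_ : MeasureSpace Ω), IsProbabilityMeasure (ℙ : Measure Ω) →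
            ∀ η : Z2 → Ω → ℝ, IsDGFF (V5N N) η →
              ∀ H : ℤ → Z2 → Ω → ℝ,
                (∀ (r : ℕ) (x : Z2), ∃ F : Z2 → Ω → ℝ,
                  IsHarmExt η F (boxZ x ((K : ℤ) ^ r)) ∧ H ((K : ℤ) ^ r) x = F x) →
                ∀ ε : ℝ, 0 < ε →
                  ∀ δ : ℝ, C₈ / (Real.sqrt k * ε) ≤ δ → δ ≤ 1 →
                    ∀ j : ℕ, 1 ≤ j → j + 1 ≤ m →
                      ∀ B₁ B₂ : Z2,
                        ℙ {ω : Ω |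
                          ∃ P : GridPath, P ∈ SL K j ∧ Tame K (j - 1) P ∧
                            P.start ∈ BDbox ((K : ℝ) ^ j / (K : ℝ) ^ 2) B₁ ∧
                            P.fin ∈ BDbox ((K : ℝ) ^ j / (K : ℝ) ^ 2) B₂ ∧
                            ((2 ≤ j ∧
                              ∃ d : ℕ, K ≤ d ∧
                              ∃ ℓ : ℝ, (K : ℝ) ^ (j - 1) ≤ ℓ ∧
                                ℓ ≤ (1 + 1 / (K : ℝ)) * (K : ℝ) ^ (j - 1) ∧
                              ∃ Q : Fin d → GridPath,
                                (∀ i, SubPath (Q i) P ∧ Q i ∈ SL K (j - 1) ∧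
                                  (Q i).norm = ℓ ∧
                                  (Q i).image ⊆ cball (Q i).start ℓ) ∧
                                (∀ i i', i ≠ i' → PathDisj (Q i) (Q i')) ∧
                                (∀ idx : Z2,
                                  Nat.card {i : Fin d //
                                    ((Q i).image ∩
                                      BDbox ((K : ℝ) ^ (j - 1)) idx).Nonempty} ≤ 12) ∧
                                δ * d ≤ (Nat.card {i : Fin d //
                                  OpenPath η H K (j - 1) ε k (Q i) ω} : ℝ)) ∨
                            (j = 1 ∧
                              ∃ d : ℕ, (K : ℝ) / 2 ≤ (d : ℝ) ∧
                              ∃ z : Fin d → Z2, Function.Injective z ∧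
                                (∀ i, z i ∈ P.lattice ∧ castZ (z i) ≠ P.start ∧
                                  castZ (z i) ≠ P.fin) ∧
                                δ * d ≤ (Nat.card {i : Fin d //
                                  ε * k ≤ etaJ η H K 0 (z i) ω} : ℝ)))} ≤
                        ENNReal.ofReal
                          ((K : ℝ) ^ 2 * Real.exp (-C₇ * ε ^ 2 * k ^ 2 * δ ^ 2)) := by
  refine ⟨TP.C7, by unfold TP.C7; positivity, 4000, by norm_num, 20, ?_⟩
  intro k hk K hK m N _ _ Ω _ hprob η hη H hH ε hε δ hδ hδ1 j hj _ B₁ B₂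
  subst hK
  have hkp : (0 : ℝ) < k := by exact_mod_cast (by omega : 0 < k)
  have hsk : 0 < Real.sqrt k := Real.sqrt_pos.2 hkp
  have hδ0 : 0 < δ := lt_of_lt_of_le (by positivity) hδ
  have hεk : 4000 ≤ √(k : ℝ) * ε := by
    have := hδ.trans hδ1
    rwa [div_le_one (by positivity)] at this
  obtain ⟨j, rfl⟩ : ∃ i, j = i + 1 := ⟨j - 1, by omega⟩
  simp only [Nat.add_sub_cancel]
  obtain ⟨a, A, h2A, h2a, h2a', hG⟩ := TP.field_gdom (by omega) hη hH j
  have hr1 : 1 ≤ 2 ^ (k * j) := Nat.one_le_two_pow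
  have hKj : (((2 ^ k : ℕ) : ℝ)) ^ j = ((2 ^ (k * j) : ℕ) : ℝ) := by push_cast; rw [pow_mul]
  have hKp : (0 : ℝ) < 2 ^ k := by positivity
  have hbox : (((2 ^ k : ℕ) : ℝ)) ^ (j + 1) / (((2 ^ k : ℕ) : ℝ)) ^ 2 = ((2 ^ (k * j) : ℕ) : ℝ) / 2 ^ k := by
    rw [pow_succ, hKj]; push_cast; field_simp
  rw [hbox, hKj]
  have hsl : ∀ P : GridPath, P ∈ SL (2 ^ k) (j + 1) →
      (2 : ℝ) ^ k * ((2 ^ (k * j) : ℕ) : ℝ) ≤ e2 P.start P.fin ∧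
      e2 P.start P.fin ≤ (2 ^ k + 1) * ((2 ^ (k * j) : ℕ) : ℝ) := by
    rintro P ⟨h1, h2, -⟩
    rw [pow_succ, hKj] at h1 h2
    unfold GridPath.norm at h1 h2
    constructor
    · refine le_trans (le_of_eq ?_) h1
      push_cast; ring
    · refine h2.trans (le_of_eq ?_)
      push_cast; field_simp
  by_cases hv : (2 : ℝ) ^ k / 2 ≤ |(TP.vB k B₁ B₂).1| ∨ (2 : ℝ) ^ k / 2 ≤ |(TP.vB k B₁ B₂).2|
  swap
  · refine (measure_mono (t := (∅ : Set Ω)) ?_).trans (by rw [measure_empty]; exact zero_le)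
    intro ω hω
    exfalso
    revert hω
    rintro ⟨P, hP, -, hs, hf, -⟩
    exact hv (TP.vcond hk hr1 hs hf (hsl P hP).1)
  refine le_trans (measure_mono ?_) ((TP.prob_bound hk h2A h2a h2a' hG rfl (u := TP.uB k B₁) hv hε hδ0 hδ1 hεk).trans
    (le_of_eq (by push_cast; rfl)))
  rintro ω ⟨P, hP, hT, hs, hf, hcase⟩
  obtain ⟨hD1, hD2⟩ := hsl P hP
  have hcov : ∀ z : Z2, castZ z ∈ P.image → ∃ (β : Fin k) (t : Fin (2 ^ k / k + 1) × (Fin 27 × Fin 27)),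
      TP.tub (2 ^ k) (2 ^ k / k + 1) (TP.uB k B₁) (TP.vB k B₁ B₂) β t =
        (z.1 / ((2 ^ (k * j) : ℕ) : ℤ), z.2 / ((2 ^ (k * j) : ℕ) : ℤ)) := by
    intro z hz
    obtain ⟨w, hw, hzw⟩ := hT _ hz
    rw [hKj] at hzw
    refine TP.cover hk rfl hr1 hs hf hD1 hD2 ?_ hzw
    have hw' : e2 P.start w + e2 P.fin w ≤ (1 + 2 / (((2 ^ k : ℕ) : ℝ)) ^ 2) * e2 P.start P.fin := hw
    push_cast at hw'
    exact hw'
  rcases hcase with ⟨-, d, hd, ℓ, -, -, Q, hQ, -, hvis, hcnt⟩ | ⟨hj1, d, hd, z, hzinj, hz, hcnt⟩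
  · have hex : ∀ i, OpenPath η H (2 ^ k) j ε k (Q i) ω → ∃ z : Z2, castZ z ∈ (Q i).image ∧
        ε * k ≤ etaJ η H (2 ^ k) j z ω := fun i hi => hi
    choose! z hz1 hz2 using hex
    refine TP.det_step (M := 12) (fun i => OpenPath η H (2 ^ k) j ε k (Q i) ω) z (by norm_num) ?_ hz2 ?_ ?_
    · intro y
      refine le_trans ?_ (hvis y)
      refine Nat.card_le_card_of_injective
        (fun i => (⟨i.1, castZ (z i.1), hz1 _ i.2.1, ?_⟩ : {i : Fin d //
          ((Q i).image ∩ BDbox (((2 ^ (k * j) : ℕ) : ℝ)) y).Nonempty})) ?_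
      · have := TP.lat_box hr1 (z i.1)
        rwa [i.2.2] at this
      · intro i i' hii
        exact Subtype.ext (congrArg (fun x => x.1) hii)
    · intro i hi
      apply hcov
      obtain ⟨t, ht, hte⟩ := hz1 i hi
      obtain ⟨s1, s2, s3⟩ := (hQ i).1
      exact ⟨t, ⟨s1.trans ht.1, ht.2.trans s2⟩, by rw [← s3 t ht]; exact hte⟩
    · refine le_trans ?_ hcnt
      have : (2 : ℝ) ^ k ≤ d := by exact_mod_cast hd
      have := mul_le_mul_of_nonneg_left this hδ0.le
      push_cast
      linarith
  · obtain rfl : j = 0 := by omega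
    refine TP.det_step (M := 1) (fun i => ε * k ≤ etaJ η H (2 ^ k) 0 (z i) ω) z (by norm_num) ?_ (fun i hi => hi)
      (fun i _ => hcov _ (hz i).1) ?_
    · intro y
      have : Subsingleton {i // ε * k ≤ etaJ η H (2 ^ k) 0 (z i) ω ∧
          ((z i).1 / ((2 ^ (k * 0) : ℕ) : ℤ), (z i).2 / ((2 ^ (k * 0) : ℕ) : ℤ)) = y} := by
        constructor
        rintro ⟨i, -, hi⟩ ⟨i', -, hi'⟩
        apply Subtype.ext
        apply hzinj
        rw [← hi'] at hi
        simpa [Prod.ext_iff] using hi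
      exact Finite.card_le_one_iff_subsingleton.2 this
    · refine le_trans ?_ hcnt
      push_cast at hd
      have := mul_le_mul_of_nonneg_left hd hδ0.le
      have h0 : 0 < δ * 2 ^ k := by positivity
      push_cast
      linarith
end

section
/- Let ξ be a real random variable with 0 ≤ ξ ≤ 1 almost surely, let c > 0, let k ≥ 6 be an integer, and let δ₀ ≥ 0 be such that P(ξ > z) ≤ 2·exp(−c k² (z − δ₀)²) for all z ≥ δ₀. Then: (1) for every a > 0, E[e^{aξ}] ≤ (1 + a/√c)·exp(a²/(4ck²) + aδ₀); and (2) if moreover √c · k² ≥ 1, then for every δ with δ₀ ≤ δ ≤ δ₀ + 1, taking a = 2ck²(δ − δ₀), one has E[e^{a(ξ−δ)}] ≤ 3√c·k²·exp(−ck²(δ − δ₀)²). -/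
open MeasureTheory ProbabilityTheory Real

lemma aux_gauss (a b : ℝ) (hb : 0 < b) :
    ∫⁻ t : ℝ, ENNReal.ofReal (2 * Real.exp (-b * t ^ 2) * (a * Real.exp (a * t))) =
      ENNReal.ofReal (2 * a * Real.exp (a ^ 2 / (4 * b)) * √(π / b)) ∨ a ≤ 0 := by
  by_cases ha : a ≤ 0
  · exact Or.inr ha
  left
  push Not at ha
  have h : ∀ t : ℝ, 2 * Real.exp (-b * t ^ 2) * (a * Real.exp (a * t)) =
      (2 * a * Real.exp (a ^ 2 / (4 * b))) * Real.exp (-b * (t - a / (2 * b)) ^ 2) := by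
    intro t
    have : Real.exp (-b * t ^ 2) * Real.exp (a * t) =
        Real.exp (a ^ 2 / (4 * b)) * Real.exp (-b * (t - a / (2 * b)) ^ 2) := by
      rw [← Real.exp_add, ← Real.exp_add]
      congr 1
      field_simp
      ring
    linear_combination (2 * a) * this
  simp_rw [h]
  rw [← ofReal_integral_eq_lintegral_ofReal]
  · rw [integral_const_mul, integral_sub_right_eq_self (fun t : ℝ => Real.exp (-b * t ^ 2)),
      integral_gaussian]
  · exact ((integrable_exp_neg_mul_sq hb).comp_sub_right _).const_mul _
  · exact Filter.Eventually.of_forall fun t => by positivity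

lemma aux_main (Ω : Type) [MeasureSpace Ω] [IsProbabilityMeasure (ℙ : Measure Ω)]
    (ξ : Ω → ℝ) (hξ : Measurable ξ) (b δ₀ : ℝ) (hb : 0 < b)
    (htail : ∀ z : ℝ, δ₀ ≤ z → ℙ {ω : Ω | z < ξ ω} ≤
      ENNReal.ofReal (2 * Real.exp (-b * (z - δ₀) ^ 2))) (a : ℝ) (ha : 0 < a) :
    ∫ ω, Real.exp (a * ξ ω) ≤
      Real.exp (a * δ₀) * (1 + 2 * a * Real.exp (a ^ 2 / (4 * b)) * √(π / b)) := by
  rw [integral_eq_lintegral_of_nonneg_ae (Filter.Eventually.of_forall fun _ => (Real.exp_pos _).le)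
    (by fun_prop)]
  refine ENNReal.toReal_le_of_le_ofReal (by positivity) ?_
  have hX : ∀ ω, Real.exp (a * max (ξ ω - δ₀) 0) - 1 =
      ∫ t in (0:ℝ)..(max (ξ ω - δ₀) 0), a * Real.exp (a * t) := by
    intro ω
    rw [intervalIntegral.integral_eq_sub_of_hasDerivAt (f := fun t => Real.exp (a * t))]
    · simp
    · intro x _
      have := ((hasDerivAt_id x).const_mul a).exp
      simpa [mul_comm] using this
    · exact Continuous.intervalIntegrable (by fun_prop) _ _
  have hlc := lintegral_comp_eq_lintegral_meas_lt_mul (ℙ : Measure Ω)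
    (f := fun ω => max (ξ ω - δ₀) 0) (g := fun t => a * Real.exp (a * t))
    (Filter.Eventually.of_forall fun ω => le_max_right _ _)
    (by fun_prop)
    (fun t _ => Continuous.intervalIntegrable (by fun_prop) _ _)
    (Filter.Eventually.of_forall fun t => by positivity)
  have hle : ∫⁻ ω, ENNReal.ofReal (∫ t in (0:ℝ)..(max (ξ ω - δ₀) 0), a * Real.exp (a * t)) ≤
      ENNReal.ofReal (2 * a * Real.exp (a ^ 2 / (4 * b)) * √(π / b)) := by
    rw [hlc, ← (aux_gauss a b hb).resolve_right (not_le.2 ha)]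
    refine le_trans ?_ (setLIntegral_le_lintegral (Set.Ioi 0) _)
    refine setLIntegral_mono' measurableSet_Ioi fun t ht => ?_
    rw [ENNReal.ofReal_mul (p := 2 * Real.exp (-b * t ^ 2)) (by positivity)]
    refine mul_le_mul' ?_ le_rfl
    have ht' : (0:ℝ) < t := ht
    have := htail (t + δ₀) (by linarith)
    rw [add_sub_cancel_right] at this
    refine le_trans (measure_mono ?_) this
    intro ω hω
    simp only [Set.mem_setOf_eq, lt_max_iff] at hω ⊢
    rcases hω with h | h <;> linarith
  calc ∫⁻ ω, ENNReal.ofReal (Real.exp (a * ξ ω))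
      ≤ ∫⁻ ω, ENNReal.ofReal (Real.exp (a * δ₀)) * (1 + ENNReal.ofReal
          (∫ t in (0:ℝ)..(max (ξ ω - δ₀) 0), a * Real.exp (a * t))) := by
        refine lintegral_mono fun ω => ?_
        have h1 : 0 ≤ Real.exp (a * max (ξ ω - δ₀) 0) - 1 := by
          rw [sub_nonneg]; exact Real.one_le_exp (by positivity)
        rw [← hX, ← ENNReal.ofReal_one, ← ENNReal.ofReal_add zero_le_one h1,
          ← ENNReal.ofReal_mul (Real.exp_pos _).le]
        apply ENNReal.ofReal_le_ofReal
        rw [add_sub_cancel, ← Real.exp_add, Real.exp_le_exp, ← mul_add]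
        gcongr
        linarith [le_max_left (ξ ω - δ₀) 0]
    _ = ENNReal.ofReal (Real.exp (a * δ₀)) * (1 + ∫⁻ ω, ENNReal.ofReal
          (∫ t in (0:ℝ)..(max (ξ ω - δ₀) 0), a * Real.exp (a * t))) := by
        rw [lintegral_const_mul' _ _ ENNReal.ofReal_ne_top, lintegral_add_left measurable_const]
        simp
    _ ≤ _ := by
        rw [ENNReal.ofReal_mul (Real.exp_pos _).le, ENNReal.ofReal_add zero_le_one (by positivity),
          ENNReal.ofReal_one]
        gcongr

/-- **Moment generating function bounds from a Gaussian-type tail (Step 2 of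
Lemma 4.4).** If `0 ≤ ξ ≤ 1` a.s. and `P(ξ > z) ≤ 2 e^{-ck²(z-δ₀)²}` for all
`z ≥ δ₀`, then (1) `E[e^{aξ}] ≤ (1 + a/√c) e^{a²/(4ck²) + aδ₀}` for all `a > 0`;
and (2) if `√c k² ≥ 1`, then for `δ₀ ≤ δ ≤ δ₀ + 1`, with `a = 2ck²(δ-δ₀)`,
`E[e^{a(ξ-δ)}] ≤ 3√c k² e^{-ck²(δ-δ₀)²}`. -/
theorem mgf_bound_from_tail :
    ∀ (Ω : Type) (_ : MeasureSpace Ω), IsProbabilityMeasure (ℙ : Measure Ω) →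
      ∀ ξ : Ω → ℝ, Measurable ξ →
        (∀ᵐ ω ∂(ℙ : Measure Ω), 0 ≤ ξ ω ∧ ξ ω ≤ 1) →
        ∀ c : ℝ, 0 < c → ∀ k : ℕ, 6 ≤ k → ∀ δ₀ : ℝ, 0 ≤ δ₀ →
          (∀ z : ℝ, δ₀ ≤ z →
            ℙ {ω : Ω | z < ξ ω} ≤
              ENNReal.ofReal (2 * Real.exp (-c * (k : ℝ) ^ 2 * (z - δ₀) ^ 2))) →
          (∀ a : ℝ, 0 < a →
            ∫ ω, Real.exp (a * ξ ω) ≤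
              (1 + a / Real.sqrt c) *
                Real.exp (a ^ 2 / (4 * c * (k : ℝ) ^ 2) + a * δ₀)) ∧
          (1 ≤ Real.sqrt c * (k : ℝ) ^ 2 →
            ∀ δ : ℝ, δ₀ ≤ δ → δ ≤ δ₀ + 1 →
              ∫ ω, Real.exp (2 * c * (k : ℝ) ^ 2 * (δ - δ₀) * (ξ ω - δ)) ≤
                3 * Real.sqrt c * (k : ℝ) ^ 2 *
                  Real.exp (-c * (k : ℝ) ^ 2 * (δ - δ₀) ^ 2)) := by
  intro Ω _ hP ξ hξ _ c hc k hk δ₀ hδ₀ htail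
  have hk' : (6:ℝ) ≤ k := by exact_mod_cast hk
  have hk0 : (0:ℝ) < k := by linarith
  have hs : 0 < √c := Real.sqrt_pos.2 hc
  have hb : 0 < c * (k:ℝ) ^ 2 := by positivity
  have part1 : ∀ a : ℝ, 0 < a → ∫ ω, Real.exp (a * ξ ω) ≤ (1 + a / Real.sqrt c) *
      Real.exp (a ^ 2 / (4 * c * (k : ℝ) ^ 2) + a * δ₀) := by
    intro a ha
    refine (aux_main Ω ξ hξ (c * (k:ℝ) ^ 2) δ₀ hb
      (by simpa only [neg_mul] using htail) a ha).trans ?_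
    rw [Real.exp_add, ← mul_assoc 4 c]
    have h1 : 1 ≤ Real.exp (a ^ 2 / (4 * c * (k : ℝ) ^ 2)) := Real.one_le_exp (by positivity)
    have h2 : 2 * √(π / (c * (k:ℝ) ^ 2)) ≤ 1 / √c := by
      rw [Real.sqrt_div pi_pos.le, Real.sqrt_mul hc.le, Real.sqrt_sq hk0.le]
      have h3 : √π ≤ 2 := by
        rw [Real.sqrt_le_left (by norm_num)]
        linarith [Real.pi_lt_four]
      rw [← mul_div_assoc, div_le_div_iff₀ (by positivity) hs]
      nlinarith [mul_le_mul_of_nonneg_left h3 hs.le, mul_le_mul_of_nonneg_left hk' hs.le]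
    set E := Real.exp (a ^ 2 / (4 * c * (k : ℝ) ^ 2))
    have h4 : 1 + 2 * a * E * √(π / (c * (k:ℝ) ^ 2)) ≤ (1 + a / √c) * E := by
      have := mul_le_mul_of_nonneg_left h2 (by positivity : 0 ≤ a * E)
      have e : (1 + a / √c) * E = E + a * E * (1 / √c) := by ring
      rw [e]
      linarith
    calc _ ≤ Real.exp (a * δ₀) * ((1 + a / √c) * E) := by gcongr
      _ = _ := by ring
  refine ⟨part1, fun h1 δ hδ hδ' => ?_⟩
  rcases hδ.eq_or_lt with rfl | hlt
  · simp
    linarith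
  have hd : 0 < δ - δ₀ := by linarith
  have h := part1 (2 * c * (k : ℝ) ^ 2 * (δ - δ₀)) (by positivity)
  set a := 2 * c * (k : ℝ) ^ 2 * (δ - δ₀) with ha
  have e1 : ∀ ω, Real.exp (a * (ξ ω - δ)) = Real.exp (-(a * δ)) * Real.exp (a * ξ ω) := by
    intro ω
    rw [← Real.exp_add]
    congr 1
    ring
  simp_rw [e1]
  rw [integral_const_mul]
  have e2 : a / √c = 2 * √c * (k:ℝ) ^ 2 * (δ - δ₀) := by
    rw [div_eq_iff hs.ne', ha]
    nth_rewrite 1 [← Real.mul_self_sqrt hc.le]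
    ring
  have e3 : Real.exp (-(a * δ)) * Real.exp (a ^ 2 / (4 * c * (k : ℝ) ^ 2) + a * δ₀) =
      Real.exp (-c * (k : ℝ) ^ 2 * (δ - δ₀) ^ 2) := by
    rw [← Real.exp_add]
    congr 1
    have : a ^ 2 / (4 * c * (k : ℝ) ^ 2) = c * (k:ℝ) ^ 2 * (δ - δ₀) ^ 2 := by
      rw [ha]
      field_simp
      ring
    rw [this, ha]
    ring
  have e4 : 1 + a / √c ≤ 3 * √c * (k:ℝ) ^ 2 := by
    rw [e2]
    nlinarith
  calc _ ≤ Real.exp (-(a * δ)) * ((1 + a / √c) *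
        Real.exp (a ^ 2 / (4 * c * (k : ℝ) ^ 2) + a * δ₀)) := by gcongr
    _ = (1 + a / √c) * Real.exp (-c * (k : ℝ) ^ 2 * (δ - δ₀) ^ 2) := by rw [← e3]; ring
    _ ≤ _ := by gcongr
end
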